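/- For every integer n of the form n = 9·2^{k+1} − 16 with k ≥ 1, there exists a 3-connected maximal 1-plane graph G on n vertices whose underlying graph has crossing number cr(G) = (n−2)/3. (Consequently, the lower bound cr(G) ≥ (n−2)/3 for 3-connected immovable maximal 1-plane graphs is tight for infinitely many n.) -/

import Mathlib

open Set

/-- A drawing of a simple graph in the plane: each vertex is assigned a distinct point,
and each edge a continuous arc (an injective continuous curve) joining its endpoints. -/
structure Drawing {V : Type} (G : SimpleGraph V) where
  pos : V → ℝ × ℝ
  pos_inj : Function.Injective pos
  arc : ∀ ⦃u v : V⦄, G.Adj u v → Set (ℝ × ℝ)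
  arc_symm : ∀ ⦃u v : V⦄ (h : G.Adj u v), arc h.symm = arc h
  arc_isArc : ∀ ⦃u v : V⦄ (h : G.Adj u v), ∃ γ : ℝ → ℝ × ℝ,
    ContinuousOn γ (Set.Icc 0 1) ∧ Set.InjOn γ (Set.Icc 0 1) ∧
    γ 0 = pos u ∧ γ 1 = pos v ∧ arc h = γ '' Set.Icc (0 : ℝ) 1

namespace Drawing

variable {V : Type} {G : SimpleGraph V} (D : Drawing G)

/-- The interior of the arc of an edge (the arc minus its endpoints). -/
def arcInt ⦃u v : V⦄ (h : G.Adj u v) : Set (ℝ × ℝ) :=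
  D.arc h \ {D.pos u, D.pos v}

/-- The interior of the drawing of an abstract edge `e : Sym2 V`. -/
def edgeInt (e : Sym2 V) : Set (ℝ × ℝ) :=
  {p | ∃ (u v : V) (h : G.Adj u v), e = s(u, v) ∧ p ∈ D.arcInt h}

/-- Two edges cross if they are distinct and their interiors meet. -/
def Cross (e f : Sym2 V) : Prop :=
  e ≠ f ∧ (D.edgeInt e ∩ D.edgeInt f).Nonempty

/-- The set of crossing points of the drawing. -/
def crossingSet : Set (ℝ × ℝ) :=
  {p | ∃ e f : Sym2 V, e ≠ f ∧ p ∈ D.edgeInt e ∧ p ∈ D.edgeInt f}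

/-- A good drawing: no vertex lies on the arc of a non-incident edge, any two distinct
edges meet in at most one interior point, and edges sharing an endpoint do not cross. -/
def IsGood : Prop :=
  (∀ (w : V) ⦃u v : V⦄ (h : G.Adj u v), D.pos w ∈ D.arc h → w = u ∨ w = v) ∧
  (∀ e f : Sym2 V, e ≠ f → (D.edgeInt e ∩ D.edgeInt f).Subsingleton) ∧
  (∀ ⦃u v w : V⦄ (h₁ : G.Adj u v) (h₂ : G.Adj u w), v ≠ w →
    D.arcInt h₁ ∩ D.arcInt h₂ = ∅)

/-- A drawing is 1-planar if every edge is crossed at most once. -/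
def IsOnePlanar : Prop :=
  ∀ e : Sym2 V, {f : Sym2 V | D.Cross e f}.Subsingleton

/-- The number of crossings of the drawing (each unordered pair of crossing edges
contributes one crossing). -/
noncomputable def crNum : ℕ :=
  Set.ncard {p : Sym2 V × Sym2 V | D.Cross p.1 p.2} / 2

/-- The subset of the plane covered by the drawing. -/
def drawingSet : Set (ℝ × ℝ) :=
  Set.range D.pos ∪ ⋃ (u : V) (v : V) (h : G.Adj u v), D.arc h

/-- A face of the drawing: a connected component of the complement of the drawing. -/
def IsFace (F : Set (ℝ × ℝ)) : Prop :=
  ∃ p ∉ D.drawingSet, F = connectedComponentIn D.drawingSetᶜ p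

/-- The set `∂(F)` of vertices on the boundary of a face `F`. -/
def faceVerts (F : Set (ℝ × ℝ)) : Set V :=
  {v | D.pos v ∈ frontier F}

/-- A true face of the planarization `G^×`: a face of the drawing whose boundary
contains no crossing point (i.e. it is incident with no fake vertex). -/
def IsTrueFace (F : Set (ℝ × ℝ)) : Prop :=
  D.IsFace F ∧ ∀ p ∈ D.crossingSet, p ∉ frontier F

/-- Two faces are adjacent if their boundaries share a common edge of the planarization,
i.e. they share a boundary point that is neither a vertex nor a crossing point. -/
def FaceAdj (F₁ F₂ : Set (ℝ × ℝ)) : Prop :=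
  F₁ ≠ F₂ ∧ ∃ p, p ∈ frontier F₁ ∧ p ∈ frontier F₂ ∧
    p ∉ Set.range D.pos ∧ p ∉ D.crossingSet

/-- The planarization `G^×` (crossings made into vertices of degree `4`) is a
triangulation: every face of the drawing has exactly three vertices of `G^×`
(true vertices or crossing points) on its boundary. -/
def PlanarizationIsTriangulation : Prop :=
  ∀ F : Set (ℝ × ℝ), D.IsFace F →
    ((Set.range D.pos ∪ D.crossingSet) ∩ frontier F).ncard = 3

/-- A maximal 1-plane graph: the drawing is good and 1-planar, and no edge between two
distinct non-adjacent vertices can be added to the drawing so that the result is still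
a good 1-planar drawing. -/
def IsMaximalOnePlane : Prop :=
  D.IsGood ∧ D.IsOnePlanar ∧
  ∀ u v : V, u ≠ v → ¬G.Adj u v →
    ∀ D' : Drawing (G ⊔ SimpleGraph.fromEdgeSet {s(u, v)}),
      D'.pos = D.pos →
      (∀ ⦃x y : V⦄ (h : G.Adj x y),
        D'.arc ((SimpleGraph.sup_adj _ _ _ _).mpr (Or.inl h)) = D.arc h) →
      ¬(D'.IsGood ∧ D'.IsOnePlanar)

/-- A maximal 1-plane graph is immovable if its number of crossings does not exceed that
of any good 1-planar drawing obtained from it by redrawing exactly one edge. -/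
def Immovable : Prop :=
  ∀ D' : Drawing G, D'.IsGood → D'.IsOnePlanar → D'.pos = D.pos →
    (∃ (u v : V) (_ : G.Adj u v), ∀ ⦃x y : V⦄ (h' : G.Adj x y),
      s(x, y) ≠ s(u, v) → D'.arc h' = D.arc h') →
    D.crNum ≤ D'.crNum

/-- The drawing induced on a subgraph. -/
def restrict {H : SimpleGraph V} (hle : H ≤ G) : Drawing H where
  pos := D.pos
  pos_inj := D.pos_inj
  arc := fun _ _ h => D.arc (hle h)
  arc_symm := fun _ _ h => D.arc_symm (hle h)
  arc_isArc := fun _ _ h => D.arc_isArc (hle h)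

/-- `H` is a planar skeleton `G_P` of the 1-plane graph `(G, D)`: it is obtained from `G`
by removing exactly one edge from each pair of crossing edges. -/
def IsPlanarSkeleton {H : SimpleGraph V} (_ : H ≤ G) : Prop :=
  (∀ e f : Sym2 V, D.Cross e f → (e ∈ H.edgeSet ↔ f ∉ H.edgeSet)) ∧
  ∀ e ∈ G.edgeSet, (¬∃ f, D.Cross e f) → e ∈ H.edgeSet

/-- `c_G(v)`: the number of crossing edges of the drawing incident with `v`. -/
noncomputable def cDeg (v : V) : ℕ :=
  Set.ncard {w : V | G.Adj v w ∧ ∃ f, D.Cross s(v, w) f}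

end Drawing

/-- The crossing number of a graph: the least number of crossings in a good drawing. -/
noncomputable def crossingNumber {V : Type} (G : SimpleGraph V) : ℕ :=
  sInf {n | ∃ D : Drawing G, D.IsGood ∧ D.crNum = n}

/-- A graph is `k`-connected if it stays connected after deleting any set of fewer than
`k` vertices. -/
def KConnected {V : Type} (G : SimpleGraph V) (k : ℕ) : Prop :=
  ∀ S : Set V, S.ncard < k → (G.induce Sᶜ).Connected

/-- A graph is 1-planar if it admits a good 1-planar drawing. -/
def Is1Planar {V : Type} (G : SimpleGraph V) : Prop :=
  ∃ D : Drawing G, D.IsGood ∧ D.IsOnePlanar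

/-- A maximal 1-planar graph: 1-planar, and adding any edge between distinct
non-adjacent vertices destroys 1-planarity. -/
def IsMaximal1Planar {V : Type} (G : SimpleGraph V) : Prop :=
  Is1Planar G ∧ ∀ u v : V, u ≠ v → ¬G.Adj u v →
    ¬Is1Planar (G ⊔ SimpleGraph.fromEdgeSet {s(u, v)})

theorem log_change {l l' : ℝ → ℂ} (hl : Continuous l) (hl' : Continuous l') {c : ℂ}
    (h : ∀ s, Complex.exp (l s) = c * Complex.exp (l' s)) : l 1 - l 0 = l' 1 - l' 0 := by
  have hc : ∀ s, Complex.exp (l s - l' s) = c := by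
    intro s
    rw [Complex.exp_sub, h s, mul_div_cancel_right₀ _ (Complex.exp_ne_zero _)]
  have key : (fun s => l s - l' s) = fun _ => l 0 - l' 0 := by
    refine Complex.isCoveringMap_exp.eq_of_comp_eq (hl.sub hl') continuous_const ?_ 0 rfl
    funext s
    simp only [Function.comp]
    exact Subtype.ext ((hc s).trans (hc 0).symm)
  have := congrFun key 1
  linear_combination this

theorem exists_log_comp {A : Type} [TopologicalSpace A] [SimplyConnectedSpace A]
    [LocallyPathConnectedSpace A] (g : A → ℂ) (hg : Continuous g) (h0 : ∀ a, g a ≠ 0) :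
    ∃ f : A → ℂ, Continuous f ∧ ∀ a, Complex.exp (f a) = g a := by
  obtain ⟨a0⟩ : Nonempty A := inferInstance
  rcases Complex.isCoveringMapOn_exp.existsUnique_continuousMap_lifts
    ⟨g, hg⟩ (a₀ := a0) (Complex.exp_log (h0 a0)) (fun x => h0 x) with ⟨f, ⟨-, hf⟩, -⟩
  exact ⟨f, f.continuous, fun a => congrFun hf a⟩

/-- `K₅` has no drawing in which independent edges are disjoint. -/
theorem K5_paths (w : Fin 5 → ℂ) (e : Fin 5 → Fin 5 → ℝ → ℂ)
    (hw : Function.Injective w)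
    (hc : ∀ i j, i < j → Continuous (e i j))
    (h0 : ∀ i j, i < j → e i j 0 = w i) (h1 : ∀ i j, i < j → e i j 1 = w j)
    (hv : ∀ i j k, i < j → k ≠ i → k ≠ j → ∀ s, e i j s ≠ w k)
    (hd : ∀ i j k l, i < j → k < l → i ≠ k → i ≠ l → j ≠ k → j ≠ l → ∀ s t, e i j s ≠ e k l t) :
    False := by
  obtain ⟨al, hal, hals⟩ : ∃ al : Fin 5 → Fin 5 → ℂ, (∀ a b, a ≠ b → Complex.exp (al a b) = w a - w b) ∧
      ∀ a b, a ≠ b → al a b - al b a = ((if a < b then -1 else 1 : ℤ) : ℂ) * (Real.pi * Complex.I) := by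
    refine ⟨fun a b => if a < b then Complex.log (w a - w b) else Complex.log (w b - w a) + Real.pi * Complex.I, ?_, ?_⟩
    · intro a b hab
      dsimp only
      split_ifs with h
      · exact Complex.exp_log (sub_ne_zero.2 (hw.ne hab))
      · rw [Complex.exp_add, Complex.exp_log (sub_ne_zero.2 (hw.ne hab.symm)), Complex.exp_pi_mul_I]
        ring
    · intro a b hab
      dsimp only
      rcases lt_or_gt_of_ne hab with h | h
      · rw [if_pos h, if_neg (not_lt.2 h.le), if_pos h]; push_cast; ring
      · rw [if_pos h, if_neg (not_lt.2 h.le), if_neg (not_lt.2 h.le)]; push_cast; ring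
  have exA : ∀ i j k : Fin 5, ∃ A : ℂ, i < j → k ≠ i → k ≠ j →
      ∀ (l : ℝ → ℂ) (c : ℂ), Continuous l → (∀ s, Complex.exp (l s) = c * (e i j s - w k)) →
        l 1 - l 0 = A := by
    intro i j k
    by_cases h : i < j ∧ k ≠ i ∧ k ≠ j
    · obtain ⟨hij, hki, hkj⟩ := h
      obtain ⟨f, hf, hf'⟩ := exists_log_comp (fun s : ℝ => e i j s - w k)
        ((hc i j hij).sub continuous_const) (fun s => sub_ne_zero.2 (hv i j k hij hki hkj s))
      refine ⟨f 1 - f 0, fun _ _ _ l c hl h => log_change (c := c) hl hf ?_⟩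
      intro s; rw [h s, hf' s]
    · exact ⟨0, fun a b c => absurd ⟨a, b, c⟩ h⟩
  choose A hA using exA
  have exN : ∀ i j k : Fin 5, ∃ n : ℤ, i < j → k ≠ i → k ≠ j →
      A i j k = al j k - al i k + n * (2 * Real.pi * Complex.I) := by
    intro i j k
    by_cases h : i < j ∧ k ≠ i ∧ k ≠ j
    · obtain ⟨hij, hki, hkj⟩ := h
      obtain ⟨f, hf, hf'⟩ := exists_log_comp (fun s : ℝ => e i j s - w k)
        ((hc i j hij).sub continuous_const) (fun s => sub_ne_zero.2 (hv i j k hij hki hkj s))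
      have e1 := hA i j k hij hki hkj f 1 hf (fun s => by rw [hf' s, one_mul])
      have e2 : Complex.exp (f 1) = Complex.exp (al j k) := by rw [hf', h1 i j hij, hal j k hkj.symm]
      have e3 : Complex.exp (f 0) = Complex.exp (al i k) := by rw [hf', h0 i j hij, hal i k hki.symm]
      obtain ⟨n1, hn1⟩ := Complex.exp_eq_exp_iff_exists_int.1 e2
      obtain ⟨n2, hn2⟩ := Complex.exp_eq_exp_iff_exists_int.1 e3
      refine ⟨n1 - n2, fun _ _ _ => ?_⟩
      rw [← e1, hn1, hn2]; push_cast; ring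
    · exact ⟨0, fun a b c => absurd ⟨a, b, c⟩ h⟩
  choose N hN using exN
  have sq : ∀ i j k l : Fin 5, i < j → k < l → i ≠ k → i ≠ l → j ≠ k → j ≠ l →
      A i j k + A k l j = A k l i + A i j l := by
    intro i j k l hij hkl hik hil hjk hjl
    obtain ⟨f, hf, hf'⟩ := exists_log_comp (fun p : ℝ × ℝ => e i j p.1 - e k l p.2)
      (((hc i j hij).comp continuous_fst).sub ((hc k l hkl).comp continuous_snd))
      (fun p => sub_ne_zero.2 (hd i j k l hij hkl hik hil hjk hjl _ _))
    have a1 := hA i j k hij hik.symm hjk.symm (fun s => f (s, 0)) 1 (by fun_prop)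
      (fun s => by rw [hf', h0 k l hkl, one_mul])
    have a2 := hA i j l hij hil.symm hjl.symm (fun s => f (s, 1)) 1 (by fun_prop)
      (fun s => by rw [hf', h1 k l hkl, one_mul])
    have a3 := hA k l i hkl hik hil (fun s => f (0, s)) (-1) (by fun_prop)
      (fun s => by rw [hf', h0 i j hij]; ring)
    have a4 := hA k l j hkl hjk hjl (fun s => f (1, s)) (-1) (by fun_prop)
      (fun s => by rw [hf', h1 i j hij]; ring)
    rw [← a1, ← a2, ← a3, ← a4]; ring
  have sqN : ∀ i j k l : Fin 5, i < j → k < l → i ≠ k → i ≠ l → j ≠ k → j ≠ l →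
      2 * (N i j k - N i j l + N k l j - N k l i) + (if j < k then -1 else 1) + (if k < i then -1 else 1)
        + (if i < l then -1 else 1) + (if l < j then -1 else 1 : ℤ) = 0 := by
    intro i j k l hij hkl hik hil hjk hjl
    have h := sq i j k l hij hkl hik hil hjk hjl
    rw [hN i j k hij hik.symm hjk.symm, hN k l j hkl hjk hjl, hN k l i hkl hik hil,
      hN i j l hij hil.symm hjl.symm] at h
    have e1 := hals j k hjk
    have e2 := hals k i hik.symm
    have e3 := hals i l hil
    have e4 := hals l j hjl.symm
    have hpi : ((Real.pi : ℂ) * Complex.I) ≠ 0 :=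
      mul_ne_zero (by exact_mod_cast Real.pi_ne_zero) Complex.I_ne_zero
    have : (((2 * (N i j k - N i j l + N k l j - N k l i) + (if j < k then -1 else 1) + (if k < i then -1 else 1)
        + (if i < l then -1 else 1) + (if l < j then -1 else 1 : ℤ) : ℤ)) : ℂ) * (Real.pi * Complex.I) = 0 := by
      rw [Int.cast_add, Int.cast_add, Int.cast_add, Int.cast_add, add_mul, add_mul, add_mul, add_mul,
        ← e1, ← e2, ← e3, ← e4]
      push_cast
      linear_combination h
    exact_mod_cast (mul_eq_zero.1 this).resolve_right hpi
  have s1 := sqN 0 1 2 3 (by decide) (by decide) (by decide) (by decide) (by decide) (by decide)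
  have s2 := sqN 0 1 2 4 (by decide) (by decide) (by decide) (by decide) (by decide) (by decide)
  have s3 := sqN 0 1 3 4 (by decide) (by decide) (by decide) (by decide) (by decide) (by decide)
  have s4 := sqN 0 2 1 3 (by decide) (by decide) (by decide) (by decide) (by decide) (by decide)
  have s5 := sqN 0 2 1 4 (by decide) (by decide) (by decide) (by decide) (by decide) (by decide)
  have s6 := sqN 0 2 3 4 (by decide) (by decide) (by decide) (by decide) (by decide) (by decide)
  have s7 := sqN 0 3 1 2 (by decide) (by decide) (by decide) (by decide) (by decide) (by decide)
  have s8 := sqN 0 3 1 4 (by decide) (by decide) (by decide) (by decide) (by decide) (by decide)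
  have s9 := sqN 0 3 2 4 (by decide) (by decide) (by decide) (by decide) (by decide) (by decide)
  have s10 := sqN 0 4 1 2 (by decide) (by decide) (by decide) (by decide) (by decide) (by decide)
  have s11 := sqN 0 4 1 3 (by decide) (by decide) (by decide) (by decide) (by decide) (by decide)
  have s12 := sqN 0 4 2 3 (by decide) (by decide) (by decide) (by decide) (by decide) (by decide)
  have s13 := sqN 1 2 3 4 (by decide) (by decide) (by decide) (by decide) (by decide) (by decide)
  have s14 := sqN 1 3 2 4 (by decide) (by decide) (by decide) (by decide) (by decide) (by decide)
  have s15 := sqN 1 4 2 3 (by decide) (by decide) (by decide) (by decide) (by decide) (by decide)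
  simp at s1 s2 s3 s4 s5 s6 s7 s8 s9 s10 s11 s12 s13 s14 s15
  omega

/-- A `K₅` minor: five disjoint connected branch sets, pairwise joined by edges. -/
def HasK5 {W : Type} (H : SimpleGraph W) : Prop :=
  ∃ φ : Fin 5 → Set W,
    (∀ i, ∀ a ∈ φ i, ∀ b ∈ φ i, Relation.ReflTransGen (fun x y => H.Adj x y ∧ x ∈ φ i ∧ y ∈ φ i) a b) ∧
    (∀ i j, i ≠ j → Disjoint (φ i) (φ j)) ∧
    (∀ i j, i ≠ j → ∃ u ∈ φ i, ∃ v ∈ φ j, H.Adj u v)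

theorem HasK5.mono {W : Type} {H H' : SimpleGraph W} (hle : H ≤ H') (h : HasK5 H) : HasK5 H' := by
  obtain ⟨φ, h1, h2, h3⟩ := h
  refine ⟨φ, fun i a ha b hb => Relation.ReflTransGen.mono (fun x y hxy => ⟨hle hxy.1, hxy.2⟩) _ _ (h1 i a ha b hb), h2, ?_⟩
  intro i j hij
  obtain ⟨u, hu, v, hv, h⟩ := h3 i j hij
  exact ⟨u, hu, v, hv, hle h⟩

/-- Contraction of `v` into `u`. -/
def contractG {W : Type} (H : SimpleGraph W) (u v : W) : SimpleGraph W where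
  Adj a b := a ≠ b ∧ a ≠ v ∧ b ≠ v ∧ (H.Adj a b ∨ (a = u ∧ H.Adj v b) ∨ (b = u ∧ H.Adj a v))
  symm := ⟨by
    rintro a b ⟨h1, h2, h3, h4⟩
    refine ⟨h1.symm, h3, h2, ?_⟩
    rcases h4 with h | ⟨h, h'⟩ | ⟨h, h'⟩
    · exact Or.inl h.symm
    · exact Or.inr (Or.inr ⟨h, h'.symm⟩)
    · exact Or.inr (Or.inl ⟨h, h'.symm⟩)⟩
  loopless := ⟨fun a h => h.1 rfl⟩

theorem HasK5.of_contract {W : Type} {H : SimpleGraph W} {u v : W} (huv : H.Adj u v)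
    (h : HasK5 (contractG H u v)) : HasK5 H := by
  classical
  obtain ⟨φ, h1, h2, h3⟩ := h
  have huv' : u ≠ v := huv.ne
  set π : W → W := fun x => if x = v then u else x with hπ
  have πv : π v = u := by simp [hπ]
  have πo : ∀ x, x ≠ v → π x = x := fun x hx => by simp [hπ, hx]
  refine ⟨fun i => π ⁻¹' φ i, ?_, ?_, ?_⟩
  · intro i a ha b hb
    have step : ∀ x y, (contractG H u v).Adj x y ∧ x ∈ φ i ∧ y ∈ φ i →
        Relation.ReflTransGen (fun x y => H.Adj x y ∧ x ∈ π ⁻¹' φ i ∧ y ∈ π ⁻¹' φ i) x y := by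
      rintro x y ⟨⟨_, hxv, hyv, hh⟩, hx, hy⟩
      have hx' : π x ∈ φ i := by rwa [πo x hxv]
      have hy' : π y ∈ φ i := by rwa [πo y hyv]
      rcases hh with h | ⟨rfl, h⟩ | ⟨rfl, h⟩
      · exact Relation.ReflTransGen.single ⟨h, hx', hy'⟩
      · have : π v ∈ φ i := by rwa [πv]
        exact (Relation.ReflTransGen.single ⟨huv, hx', this⟩).tail ⟨h, this, hy'⟩
      · have : π v ∈ φ i := by rwa [πv]
        exact (Relation.ReflTransGen.single ⟨h, hx', this⟩).tail ⟨huv.symm, this, hy'⟩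
    have path : ∀ x y, Relation.ReflTransGen (fun x y => (contractG H u v).Adj x y ∧ x ∈ φ i ∧ y ∈ φ i) x y →
        Relation.ReflTransGen (fun x y => H.Adj x y ∧ x ∈ π ⁻¹' φ i ∧ y ∈ π ⁻¹' φ i) x y := by
      intro x y hxy
      induction hxy with
      | refl => exact .refl
      | tail _ h ih => exact ih.trans (step _ _ h)
    have fix : ∀ x, π x ∈ φ i →
        Relation.ReflTransGen (fun x y => H.Adj x y ∧ x ∈ π ⁻¹' φ i ∧ y ∈ π ⁻¹' φ i) x (π x) ∧
        Relation.ReflTransGen (fun x y => H.Adj x y ∧ x ∈ π ⁻¹' φ i ∧ y ∈ π ⁻¹' φ i) (π x) x := by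
      intro x hx
      by_cases hxv : x = v
      · subst hxv
        rw [πv] at hx ⊢
        have hx2 : π u ∈ φ i := by rwa [πo u huv']
        have hx3 : π x ∈ φ i := by rwa [πv]
        exact ⟨.single ⟨huv.symm, hx3, hx2⟩, .single ⟨huv, hx2, hx3⟩⟩
      · rw [πo x hxv]; exact ⟨.refl, .refl⟩
    exact ((fix a ha).1.trans (path _ _ (h1 i _ ha _ hb))).trans (fix b hb).2
  · intro i j hij
    exact (h2 i j hij).preimage π
  · intro i j hij
    obtain ⟨a, ha, b, hb, _, hav, hbv, hh⟩ := h3 i j hij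
    have ha' : π a ∈ φ i := by rwa [πo a hav]
    have hb' : π b ∈ φ j := by rwa [πo b hbv]
    rcases hh with h | ⟨rfl, h⟩ | ⟨rfl, h⟩
    · exact ⟨a, ha', b, hb', h⟩
    · exact ⟨v, by simpa [πv] using ha, b, hb', h⟩
    · exact ⟨a, ha', v, by simpa [πv] using hb, h⟩

open Classical in
theorem card_contract {W : Type} [Fintype W] (H : SimpleGraph W) {u v : W} (huv : H.Adj u v) :
    H.edgeFinset.card ≤ (contractG H u v).edgeFinset.card + 1 +
      (H.neighborFinset v ∩ H.neighborFinset u).card := by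
  set A := H.edgeFinset.filter (fun e => v ∉ e) with hA
  set X := (H.neighborFinset v \ H.neighborFinset u).erase u with hX
  set B := X.image (fun x => s(u, x)) with hB
  have hsub : A ∪ B ⊆ (contractG H u v).edgeFinset := by
    intro e he
    rw [Finset.mem_union] at he
    rcases he with he | he
    · rw [hA, Finset.mem_filter] at he
      obtain ⟨he, hv⟩ := he
      induction e with
      | _ a b =>
        simp only [SimpleGraph.mem_edgeFinset, SimpleGraph.mem_edgeSet, Sym2.mem_iff, not_or] at he hv ⊢
        exact ⟨he.ne, Ne.symm hv.1, Ne.symm hv.2, Or.inl he⟩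
    · simp only [hB, hX, Finset.mem_image, Finset.mem_erase, Finset.mem_sdiff,
        SimpleGraph.mem_neighborFinset] at he
      obtain ⟨x, ⟨hxu, hvx, hux⟩, rfl⟩ := he
      simp only [SimpleGraph.mem_edgeFinset, SimpleGraph.mem_edgeSet]
      exact ⟨hxu.symm, huv.ne, hvx.ne', Or.inr (Or.inl ⟨rfl, hvx⟩)⟩
  have hdisj : Disjoint A B := by
    rw [Finset.disjoint_left]
    intro e he he'
    simp only [hB, hX, Finset.mem_image, Finset.mem_erase, Finset.mem_sdiff,
        SimpleGraph.mem_neighborFinset] at he'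
    obtain ⟨x, ⟨hxu, hvx, hux⟩, rfl⟩ := he'
    simp [hA] at he
    exact hux he.1
  have hcB : B.card = X.card := by
    apply Finset.card_image_of_injective
    intro a b hab
    exact Sym2.congr_right.1 hab
  have hcX : X.card = (H.neighborFinset v \ H.neighborFinset u).card - 1 := by
    apply Finset.card_erase_of_mem
    simp [huv.symm]
  have h1 : (H.neighborFinset v \ H.neighborFinset u).card + (H.neighborFinset v ∩ H.neighborFinset u).card
      = H.degree v := by
    rw [Finset.card_sdiff_add_card_inter, SimpleGraph.card_neighborFinset_eq_degree]
  have h2 : A.card + H.degree v = H.edgeFinset.card := by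
    rw [← H.card_incidenceFinset_eq_degree v, H.incidenceFinset_eq_filter v, hA, add_comm]
    exact Finset.card_filter_add_card_filter_not (s := H.edgeFinset) (fun e => v ∈ e)
  have h3 := Finset.card_le_card hsub
  rw [Finset.card_union_of_disjoint hdisj] at h3
  omega

theorem HasK5.of_sets {W : Type} {H : SimpleGraph W} {v r p q s t : W}
    (h1 : H.Adj v r) (h2 : H.Adj v p) (h4 : H.Adj v s) (h5 : H.Adj v t)
    (h6 : H.Adj r p) (h8 : H.Adj r s) (h9 : H.Adj r t)
    (h10 : H.Adj p q) (h11 : H.Adj q s) (h12 : H.Adj p t) (h13 : H.Adj s t)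
    (n1 : q ≠ v) (n2 : q ≠ r) (n4 : q ≠ t) (n5 : p ≠ s) : HasK5 H := by
  refine ⟨![{v}, {r}, {p, q}, {s}, {t}], ?_, ?_, ?_⟩
  · intro i
    fin_cases i <;> simp
    · exact .refl
    · exact .refl
    · refine ⟨⟨.refl, .single ⟨h10, by simp, by simp⟩⟩, .single ⟨h10.symm, by simp, by simp⟩, .refl⟩
    · exact .refl
    · exact .refl
  · have := h1.ne; have := h2.ne; have := h4.ne; have := h5.ne; have := h6.ne; have := h8.ne
    have := h9.ne; have := h11.ne; have := h12.ne; have := h13.ne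
    intro i j hij
    fin_cases i <;> fin_cases j <;> first | exact absurd rfl hij | (simp; grind)
  · intro i j hij
    have := h1.symm; have := h2.symm; have := h4.symm; have := h5.symm; have := h6.symm; have := h8.symm
    have := h9.symm; have := h11.symm; have := h12.symm; have := h13.symm
    fin_cases i <;> fin_cases j <;> first | exact absurd rfl hij | (simp; grind)

theorem HasK5.of_clique {W : Type} {H : SimpleGraph W} {v r p s t : W}
    (h1 : H.Adj v r) (h2 : H.Adj v p) (h4 : H.Adj v s) (h5 : H.Adj v t)
    (h6 : H.Adj r p) (h8 : H.Adj r s) (h9 : H.Adj r t)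
    (h10 : H.Adj p s) (h12 : H.Adj p t) (h13 : H.Adj s t) : HasK5 H := by
  refine ⟨![{v}, {r}, {p}, {s}, {t}], ?_, ?_, ?_⟩
  · intro i
    fin_cases i <;> simp <;> exact .refl
  · have := h1.ne; have := h2.ne; have := h4.ne; have := h5.ne; have := h6.ne; have := h8.ne
    have := h9.ne; have := h10.ne; have := h12.ne; have := h13.ne
    intro i j hij
    fin_cases i <;> fin_cases j <;> first | exact absurd rfl hij | (simp; grind)
  · intro i j hij
    have := h1.symm; have := h2.symm; have := h4.symm; have := h5.symm; have := h6.symm; have := h8.symm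
    have := h9.symm; have := h10.symm; have := h12.symm; have := h13.symm
    fin_cases i <;> fin_cases j <;> first | exact absurd rfl hij | (simp; grind)

open Classical in
/-- A vertex of degree four or five, each incident edge of which is in three triangles. -/
theorem HasK5.of_low_degree {W : Type} [Fintype W] {H : SimpleGraph W} {v : W}
    (hd : H.degree v ≤ 5) (hpos : 0 < H.degree v)
    (h3 : ∀ u, H.Adj v u → 3 ≤ (H.neighborFinset v ∩ H.neighborFinset u).card) : HasK5 H := by
  set S := H.neighborFinset v with hS
  have hSv : ∀ x ∈ S, H.Adj v x := fun x hx => by simpa [hS] using hx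
  have hcard : S.card = H.degree v := H.card_neighborFinset_eq_degree v
  -- every vertex of `S` misses few others
  have hmiss : ∀ x ∈ S, (S.filter (fun y => ¬ H.Adj x y)).card + 3 ≤ S.card := by
    intro x hx
    have h := h3 x (hSv x hx)
    have : S ∩ H.neighborFinset x = S.filter (fun y => H.Adj x y) := by
      ext y; simp
    rw [this] at h
    have := Finset.card_filter_add_card_filter_not (s := S) (fun y => H.Adj x y)
    omega
  have hone : ∀ x ∈ S, ∀ y ∈ S, ∀ z ∈ S, x ≠ y → x ≠ z → y ≠ z → ¬ H.Adj x y → H.Adj x z := by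
    intro x hx y hy z hz hxy hxz hyz hn
    by_contra hn'
    have h := hmiss x hx
    have hsub : ({x, y, z} : Finset W) ⊆ S.filter (fun y => ¬ H.Adj x y) := by
      intro a ha
      simp only [Finset.mem_insert, Finset.mem_singleton] at ha
      rcases ha with rfl | rfl | rfl <;> refine Finset.mem_filter.2 ⟨by assumption, ?_⟩ <;> first | assumption | exact fun h => h.ne rfl
    have := Finset.card_le_card hsub
    rw [Finset.card_eq_three.2 ⟨x, y, z, hxy, hxz, hyz, rfl⟩] at this
    omega
  have hge : 4 ≤ S.card := by
    obtain ⟨u, hu⟩ := Finset.card_pos.1 (hcard ▸ hpos)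
    have := hmiss u hu
    have h1 : 0 < (S.filter (fun y => ¬ H.Adj u y)).card :=
      Finset.card_pos.2 ⟨u, by simp [hu]⟩
    omega
  by_cases hcl : ∀ x ∈ S, ∀ y ∈ S, x ≠ y → H.Adj x y
  · obtain ⟨S', hS', hc⟩ := Finset.exists_subset_card_eq hge
    obtain ⟨a, b, c, d, hab, hac, had, hbc, hbd, hcd, rfl⟩ := Finset.card_eq_four.1 hc
    have ha : a ∈ S := hS' (by simp)
    have hb : b ∈ S := hS' (by simp)
    have hc : c ∈ S := hS' (by simp)
    have hd : d ∈ S := hS' (by simp)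
    exact HasK5.of_clique (hSv a ha) (hSv b hb) (hSv c hc) (hSv d hd) (hcl _ ha _ hb hab)
      (hcl _ ha _ hc hac) (hcl _ ha _ hd had) (hcl _ hb _ hc hbc) (hcl _ hb _ hd hbd) (hcl _ hc _ hd hcd)
  · push Not at hcl
    obtain ⟨x, hx, y, hy, hxy, hn⟩ := hcl
    have h5 : S.card = 5 := by
      have := hmiss x hx
      have h1 : ({x, y} : Finset W) ⊆ S.filter (fun y => ¬ H.Adj x y) := by
        intro a ha
        simp only [Finset.mem_insert, Finset.mem_singleton] at ha
        rcases ha with rfl | rfl <;> refine Finset.mem_filter.2 ⟨by assumption, ?_⟩ <;> first | assumption | exact fun h => h.ne rfl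
      have := Finset.card_le_card h1
      rw [Finset.card_pair hxy] at this
      omega
    have hc3 : ((S.erase x).erase y).card = 3 := by
      rw [Finset.card_erase_of_mem (by simp [hy, hxy.symm]), Finset.card_erase_of_mem hx, h5]
    obtain ⟨a, b, c, hab, hac, hbc, heq⟩ := Finset.card_eq_three.1 hc3
    have hm : ∀ z ∈ ({a, b, c} : Finset W), z ≠ y ∧ z ≠ x ∧ z ∈ S := by
      intro z hz
      rw [← heq] at hz
      simpa using hz
    obtain ⟨hay, hax, ha⟩ := hm a (by simp)
    obtain ⟨hby, hbx, hb⟩ := hm b (by simp)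
    obtain ⟨hcy, hcx, hc⟩ := hm c (by simp)
    have xa := hone x hx y hy a ha hxy hax.symm hay.symm hn
    have xb := hone x hx y hy b hb hxy hbx.symm hby.symm hn
    have xc := hone x hx y hy c hc hxy hcx.symm hcy.symm hn
    have hn' : ¬ H.Adj y x := fun h => hn h.symm
    have ya := hone y hy x hx a ha hxy.symm hay.symm hax.symm hn'
    have yb := hone y hy x hx b hb hxy.symm hby.symm hbx.symm hn'
    have yc := hone y hy x hx c hc hxy.symm hcy.symm hcx.symm hn'
    -- some vertex among `a, b, c` is adjacent to the other two
    have key : ∀ r p t : W, r ∈ S → p ∈ S → t ∈ S → p ≠ t → H.Adj r p → H.Adj r t → H.Adj x r → H.Adj x p → H.Adj x t →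
        H.Adj y r → H.Adj y p → H.Adj y t → HasK5 H := by
      intro r p t hr hp ht hpt rp rt xr xp xt yr yp yt
      exact HasK5.of_sets (v := v) (r := r) (p := x) (q := p) (s := y) (t := t)
        (hSv r hr) (hSv x hx) (hSv y hy) (hSv t ht) xr.symm yr.symm rt xp yp.symm xt yt
        (hSv p hp).ne' rp.ne' hpt hxy
    by_cases hab' : H.Adj a b
    · by_cases hac' : H.Adj a c
      · exact key a b c ha hb hc hbc hab' hac' xa xb xc ya yb yc
      · have : H.Adj c b := hone c hc a ha b hb hac.symm hbc.symm hab (fun h => hac' h.symm)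
        exact key b a c hb ha hc hac hab'.symm this.symm xb xa xc yb ya yc
    · have h1 : H.Adj a c := hone a ha b hb c hc hab hac hbc hab'
      have h2 : H.Adj b c := hone b hb a ha c hc hab.symm hbc hac (fun h => hab' h.symm)
      exact key c a b hc ha hb hab h1.symm h2.symm xc xa xb yc ya yb

open Classical in
theorem exists_le_card {W : Type} [Fintype W] (H0 : SimpleGraph W) (N : ℕ)
    (hN : N ≤ H0.edgeFinset.card) : ∃ H : SimpleGraph W, H ≤ H0 ∧ H.edgeFinset.card = N := by
  obtain ⟨E', hE', hcE'⟩ := Finset.exists_subset_card_eq hN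
  obtain ⟨H, hH⟩ : ∃ H : SimpleGraph W, H.edgeSet = (E' : Set (Sym2 W)) := by
    refine ⟨SimpleGraph.fromEdgeSet (E' : Set (Sym2 W)), ?_⟩
    rw [SimpleGraph.edgeSet_fromEdgeSet]
    ext e
    constructor
    · intro h; exact h.1
    · intro h
      refine ⟨h, ?_⟩
      have := hE' h
      rw [SimpleGraph.mem_edgeFinset] at this
      exact H0.not_isDiag_of_mem_edgeSet this
  refine ⟨H, ?_, ?_⟩
  · intro a b hab
    rw [← SimpleGraph.mem_edgeSet, hH] at hab
    simpa using hE' hab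
  · rw [← hcE']
    congr 1
    ext e
    rw [SimpleGraph.mem_edgeFinset, hH, Finset.mem_coe]

open Classical in
/-- Mader: a graph with at least `3 n - 5` edges on `n ≥ 3` vertices has a `K₅` minor. -/
theorem mader {W : Type} [Fintype W] : ∀ (n : ℕ) (S : Finset W) (H : SimpleGraph W),
    S.card = n → 3 ≤ n → (∀ a b, H.Adj a b → a ∈ S) → 3 * n ≤ H.edgeFinset.card + 5 → HasK5 H := by
  intro n
  induction n with
  | zero => intro S H _ h; omega
  | succ n ih =>
    intro S H0 hS hn hsupp0 hE0
    -- reduce to exactly `3 n - 5` edges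
    obtain ⟨H, hle, hE⟩ := exists_le_card H0 (3 * (n + 1) - 5) (by omega)
    have hsupp : ∀ a b, H.Adj a b → a ∈ S := fun a b h => hsupp0 a b (hle h)
    refine HasK5.mono hle ?_
    -- degree sum
    have hsum : ∑ x ∈ S, H.degree x = 2 * H.edgeFinset.card := by
      rw [← H.sum_degrees_eq_twice_card_edges]
      apply Finset.sum_subset (Finset.subset_univ S)
      intro x _ hx
      rw [← SimpleGraph.card_neighborFinset_eq_degree, Finset.card_eq_zero, Finset.eq_empty_iff_forall_notMem]
      intro y hy
      rw [SimpleGraph.mem_neighborFinset] at hy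
      exact hx (hsupp _ _ hy)
    have hdeg : ∀ x ∈ S, H.degree x ≤ n := by
      intro x hx
      rw [← SimpleGraph.card_neighborFinset_eq_degree]
      have : H.neighborFinset x ⊆ S.erase x := by
        intro y hy
        rw [SimpleGraph.mem_neighborFinset] at hy
        exact Finset.mem_erase.2 ⟨hy.ne', hsupp _ _ hy.symm⟩
      have := Finset.card_le_card this
      rw [Finset.card_erase_of_mem hx] at this
      omega
    have hn3 : 3 ≤ n := by
      by_contra hlt
      have : n = 2 := by omega
      subst this
      have h := Finset.sum_le_sum hdeg
      rw [hsum, Finset.sum_const, hS] at h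
      simp at h
      omega
    obtain ⟨v, hvS, hv5⟩ : ∃ v ∈ S, H.degree v ≤ 5 := by
      by_contra hcon
      push Not at hcon
      have h : ∑ x ∈ S, 6 ≤ ∑ x ∈ S, H.degree x := Finset.sum_le_sum fun x hx => hcon x hx
      rw [hsum, Finset.sum_const, hS] at h
      simp at h
      omega
    by_cases hv0 : H.degree v = 0
    · refine ih (S.erase v) H (by rw [Finset.card_erase_of_mem hvS]; omega) hn3 ?_ (by omega)
      intro a b hab
      refine Finset.mem_erase.2 ⟨?_, hsupp a b hab⟩
      rintro rfl
      rw [← SimpleGraph.card_neighborFinset_eq_degree, Finset.card_eq_zero] at hv0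
      have : b ∈ H.neighborFinset a := by simpa using hab
      rw [hv0] at this
      simp at this
    · by_cases h3 : ∀ u, H.Adj v u → 3 ≤ (H.neighborFinset v ∩ H.neighborFinset u).card
      · exact HasK5.of_low_degree hv5 (Nat.pos_of_ne_zero hv0) h3
      · push Not at h3
        obtain ⟨u, hvu, hlt⟩ := h3
        refine HasK5.of_contract hvu.symm
          (ih (S.erase v) _ (by rw [Finset.card_erase_of_mem hvS]; omega) hn3 ?_ ?_)
        · rintro a b ⟨_, hav, hbv, h | ⟨rfl, h⟩ | ⟨rfl, h⟩⟩
          · exact Finset.mem_erase.2 ⟨hav, hsupp _ _ h⟩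
          · exact Finset.mem_erase.2 ⟨hav, hsupp _ _ hvu.symm⟩
          · exact Finset.mem_erase.2 ⟨hav, hsupp _ _ h⟩
        · have := card_contract H hvu.symm
          omega

theorem joinedIn_arc {V : Type} {G : SimpleGraph V} (D : Drawing G) {u v : V} (h : G.Adj u v) :
    JoinedIn (D.arc h) (D.pos u) (D.pos v) := by
  obtain ⟨γ, hc, _, h0, h1, ha⟩ := D.arc_isArc h
  rw [ha, ← h0, ← h1]
  have hp : IsPathConnected (γ '' Icc (0 : ℝ) 1) :=
    ((convex_Icc (0 : ℝ) 1).isPathConnected ⟨0, by simp⟩).image' hc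
  exact hp.joinedIn _ ⟨0, by simp, rfl⟩ _ ⟨1, by simp, rfl⟩

theorem pos_mem_arc {V : Type} {G : SimpleGraph V} (D : Drawing G) {u v : V} (h : G.Adj u v) :
    D.pos u ∈ D.arc h ∧ D.pos v ∈ D.arc h := ⟨(joinedIn_arc D h).source_mem, (joinedIn_arc D h).target_mem⟩

/-- The part of the drawing spanned by a set of vertices. -/
def spanSet {V : Type} {G : SimpleGraph V} (D : Drawing G) (A : Set V) : Set (ℝ × ℝ) :=
  {p | ∃ (u v : V) (h : G.Adj u v), u ∈ A ∧ v ∈ A ∧ p ∈ D.arc h}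

theorem spanSet_vertex {V : Type} {G : SimpleGraph V} (D : Drawing G) (hg : D.IsGood) {A : Set V} {w : V}
    (h : D.pos w ∈ spanSet D A) : w ∈ A := by
  obtain ⟨u, v, h, hu, hv, hp⟩ := h
  rcases hg.1 w h hp with rfl | rfl <;> assumption

theorem spanSet_disjoint {V : Type} {G : SimpleGraph V} (D : Drawing G) (hg : D.IsGood)
    (hnc : ∀ e f, ¬ D.Cross e f) {A B : Set V} (hAB : Disjoint A B) :
    Disjoint (spanSet D A) (spanSet D B) := by
  rw [Set.disjoint_left] at hAB ⊢
  rintro p ⟨u, v, h, hu, hv, hp⟩ ⟨x, y, h', hx, hy, hp'⟩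
  by_cases h1 : p = D.pos u
  · subst h1
    exact hAB hu (spanSet_vertex D hg ⟨x, y, h', hx, hy, hp'⟩)
  by_cases h2 : p = D.pos v
  · subst h2
    exact hAB hv (spanSet_vertex D hg ⟨x, y, h', hx, hy, hp'⟩)
  by_cases h3 : p = D.pos x
  · subst h3
    exact hAB (spanSet_vertex D hg ⟨u, v, h, hu, hv, hp⟩) hx
  by_cases h4 : p = D.pos y
  · subst h4
    exact hAB (spanSet_vertex D hg ⟨u, v, h, hu, hv, hp⟩) hy
  refine hnc s(u, v) s(x, y) ⟨?_, p, ⟨u, v, h, rfl, hp, by simp [h1, h2]⟩, ⟨x, y, h', rfl, hp', by simp [h3, h4]⟩⟩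
  intro he
  have : u ∈ s(x, y) := he ▸ Sym2.mem_mk_left u v
  rcases Sym2.mem_iff.1 this with rfl | rfl
  · exact hAB hu hx
  · exact hAB hu hy

theorem spanSet_joined {V : Type} {G : SimpleGraph V} (D : Drawing G) {A B : Set V} (hBA : B ⊆ A) {a u : V}
    (h : Relation.ReflTransGen (fun x y => G.Adj x y ∧ x ∈ B ∧ y ∈ B) a u)
    (hu : D.pos u ∈ spanSet D A) : JoinedIn (spanSet D A) (D.pos a) (D.pos u) := by
  induction h using Relation.ReflTransGen.head_induction_on with
  | refl => exact JoinedIn.refl hu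
  | head h _ ih =>
    refine JoinedIn.trans ?_ ih
    exact (joinedIn_arc D h.1).mono fun p hp => ⟨_, _, h.1, hBA h.2.1, hBA h.2.2, hp⟩

theorem no_K5_of_planar {V : Type} {G : SimpleGraph V} (D : Drawing G) (hg : D.IsGood)
    (hnc : ∀ e f, ¬ D.Cross e f) : ¬ HasK5 G := by
  rintro ⟨φ, h1, h2, h3⟩
  have hne : ∀ i, (φ i).Nonempty := by
    intro i
    obtain ⟨j, hj⟩ : ∃ j, i ≠ j := ⟨i + 1, by revert i; decide⟩
    obtain ⟨u, hu, _⟩ := h3 i j hj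
    exact ⟨u, hu⟩
  choose w hw using hne
  have hJ : ∀ i j, i ≠ j → JoinedIn (spanSet D (φ i ∪ φ j)) (D.pos (w i)) (D.pos (w j)) := by
    intro i j hij
    obtain ⟨u, hu, v, hv, huv⟩ := h3 i j hij
    have hmem : ∀ p ∈ D.arc huv, p ∈ spanSet D (φ i ∪ φ j) :=
      fun p hp => ⟨u, v, huv, Or.inl hu, Or.inr hv, hp⟩
    refine (spanSet_joined D subset_union_left (h1 i _ (hw i) _ hu) (hmem _ (pos_mem_arc D huv).1)).trans ?_
    refine ((joinedIn_arc D huv).mono hmem).trans ?_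
    exact (spanSet_joined D subset_union_right (h1 j _ (hw j) _ hv) (hmem _ (pos_mem_arc D huv).2)).symm
  have hP : ∀ i j, ∃ e : ℝ → ℝ × ℝ, i ≠ j → Continuous e ∧ e 0 = D.pos (w i) ∧ e 1 = D.pos (w j) ∧
      ∀ s, e s ∈ spanSet D (φ i ∪ φ j) := by
    intro i j
    by_cases hij : i = j
    · exact ⟨fun _ => 0, fun h => absurd hij h⟩
    · obtain ⟨γ, hγ⟩ := hJ i j hij
      refine ⟨γ.extend, fun _ => ⟨γ.continuous_extend, by simp, by simp, fun s => ?_⟩⟩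
      have : γ.extend s ∈ range γ := by rw [← γ.extend_range]; exact ⟨s, rfl⟩
      obtain ⟨t, ht⟩ := this
      rw [← ht]; exact hγ t
  choose e he using hP
  have hinj : Function.Injective (fun p : ℝ × ℝ => Complex.equivRealProdCLM.symm p) :=
    Complex.equivRealProdCLM.symm.injective
  have hwd : ∀ i k, w k ∈ φ i → k = i := by
    intro i k h
    by_contra hne
    exact Set.disjoint_left.1 (h2 k i hne) (hw k) h
  refine K5_paths (fun i => Complex.equivRealProdCLM.symm (D.pos (w i)))
    (fun i j s => Complex.equivRealProdCLM.symm (e i j s)) ?_ ?_ ?_ ?_ ?_ ?_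
  · intro i j hij
    have := D.pos_inj (hinj hij)
    by_contra hne
    exact hne (hwd j i (this ▸ hw j))
  · intro i j hij
    exact Complex.equivRealProdCLM.symm.continuous.comp (he i j hij.ne).1
  · intro i j hij
    simp only [(he i j hij.ne).2.1]
  · intro i j hij
    simp only [(he i j hij.ne).2.2.1]
  · intro i j k hij hki hkj s h
    have hh := hinj h
    have := (he i j hij.ne).2.2.2 s
    rw [hh] at this
    rcases spanSet_vertex D hg this with h | h
    · exact hki (hwd _ _ h)
    · exact hkj (hwd _ _ h)
  · intro i j k l hij hkl hik hil hjk hjl s t h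
    have hh := hinj h
    have h5 := (he i j hij.ne).2.2.2 s
    have h6 := (he k l hkl.ne).2.2.2 t
    rw [hh] at h5
    refine Set.disjoint_left.1 (spanSet_disjoint D hg hnc ?_) h5 h6
    simp only [Set.disjoint_union_left, Set.disjoint_union_right]
    exact ⟨⟨h2 _ _ hik, h2 _ _ hjk⟩, ⟨h2 _ _ hil, h2 _ _ hjl⟩⟩

open Classical in
theorem planar_card {V : Type} [Fintype V] {G : SimpleGraph V} (D : Drawing G) (hg : D.IsGood)
    (hnc : ∀ e f, ¬ D.Cross e f) (hn : 3 ≤ Fintype.card V) :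
    G.edgeFinset.card + 6 ≤ 3 * Fintype.card V := by
  by_contra hlt
  exact no_K5_of_planar D hg hnc
    (mader (Fintype.card V) Finset.univ G rfl hn (fun _ _ _ => Finset.mem_univ _) (by omega))

theorem restrict_edgeInt {V : Type} {G H : SimpleGraph V} (D : Drawing G) (hle : H ≤ G) (e : Sym2 V) :
    (D.restrict hle).edgeInt e ⊆ D.edgeInt e := by
  rintro p ⟨u, v, h, rfl, hp⟩
  exact ⟨u, v, hle h, rfl, hp⟩

theorem restrict_good {V : Type} {G H : SimpleGraph V} (D : Drawing G) (hle : H ≤ G) (hg : D.IsGood) :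
    (D.restrict hle).IsGood := by
  refine ⟨fun w u v h hp => hg.1 w (hle h) hp, fun e f hef => ?_, fun u v w h1 h2 hvw => hg.2.2 (hle h1) (hle h2) hvw⟩
  exact (hg.2.1 e f hef).anti (Set.inter_subset_inter (restrict_edgeInt D hle e) (restrict_edgeInt D hle f))

theorem edgeInt_edge {V : Type} {G : SimpleGraph V} (D : Drawing G) {e : Sym2 V} {p} (h : p ∈ D.edgeInt e) :
    e ∈ G.edgeSet := by
  obtain ⟨u, v, h, rfl, hp⟩ := h
  exact h

open Classical in
theorem edge_bound {V : Type} [Fintype V] {G : SimpleGraph V} (D : Drawing G) (hg : D.IsGood)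
    (hn : 3 ≤ Fintype.card V) :
    G.edgeFinset.card + 6 ≤ 3 * Fintype.card V + D.crNum := by
  let q := Fintype.equivFin (Sym2 V)
  set X : Finset (Sym2 V × Sym2 V) := Finset.univ.filter fun p => D.Cross p.1 p.2 ∧ q p.1 < q p.2 with hX
  set Y : Finset (Sym2 V × Sym2 V) := Finset.univ.filter fun p => D.Cross p.1 p.2 ∧ q p.2 < q p.1 with hY
  have hsymm : ∀ e f, D.Cross e f → D.Cross f e := fun e f h => ⟨h.1.symm, by rw [inter_comm]; exact h.2⟩
  have hXY : Y.card = X.card := by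
    apply Finset.card_bij (fun p _ => p.swap)
    · intro p hp
      simp only [hX, hY, Finset.mem_filter, Finset.mem_univ, true_and] at hp ⊢
      exact ⟨hsymm _ _ hp.1, hp.2⟩
    · intro p _ p' _ h
      exact Prod.swap_injective h
    · intro p hp
      refine ⟨p.swap, ?_, by simp⟩
      simp only [hX, hY, Finset.mem_filter, Finset.mem_univ, true_and] at hp ⊢
      exact ⟨hsymm _ _ hp.1, hp.2⟩
  have hcr : D.crNum = X.card := by
    have : {p : Sym2 V × Sym2 V | D.Cross p.1 p.2} = ((X ∪ Y : Finset _) : Set (Sym2 V × Sym2 V)) := by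
      ext p
      simp only [hX, hY, Finset.coe_union, Finset.coe_filter, Finset.mem_univ, true_and, mem_union, mem_setOf_eq]
      constructor
      · intro h
        have : q p.1 ≠ q p.2 := fun hh => h.1 (q.injective hh)
        rcases lt_or_gt_of_ne this with h' | h'
        · exact Or.inl ⟨h, h'⟩
        · exact Or.inr ⟨h, h'⟩
      · rintro (h | h) <;> exact h.1
    rw [Drawing.crNum, this, Set.ncard_coe_finset, Finset.card_union_of_disjoint, hXY]
    · omega
    · rw [Finset.disjoint_left]
      intro p hp hp'
      simp only [hX, hY, Finset.mem_filter, Finset.mem_univ, true_and] at hp hp'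
      exact absurd hp.2 (not_lt.2 hp'.2.le)
  set F : Finset (Sym2 V) := X.image Prod.fst with hF
  have hFX : F.card ≤ X.card := Finset.card_image_le
  obtain ⟨H, hH⟩ : ∃ H : SimpleGraph V, H = G.deleteEdges (F : Set (Sym2 V)) := ⟨_, rfl⟩
  have hle : H ≤ G := by rw [hH]; exact SimpleGraph.deleteEdges_le _
  have hsub : G.edgeFinset ⊆ H.edgeFinset ∪ F := by
    intro e he
    rw [Finset.mem_union]
    by_cases heF : e ∈ F
    · exact Or.inr heF
    · left
      rw [SimpleGraph.mem_edgeFinset] at he ⊢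
      rw [hH, SimpleGraph.edgeSet_deleteEdges]
      exact ⟨he, heF⟩
  have hc1 := (Finset.card_le_card hsub).trans (Finset.card_union_le _ _)
  have hF' : ∀ e ∈ H.edgeSet, e ∉ F := by
    intro e he
    rw [hH, SimpleGraph.edgeSet_deleteEdges] at he
    exact he.2
  have hpl := planar_card (D.restrict hle) (restrict_good D hle hg) ?_ hn
  · omega
  · rintro e f ⟨hef, p, hpe, hpf⟩
    have he := hF' e (edgeInt_edge _ hpe)
    have hf := hF' f (edgeInt_edge _ hpf)
    have hC : D.Cross e f := ⟨hef, p, restrict_edgeInt D hle e hpe, restrict_edgeInt D hle f hpf⟩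
    have : q e ≠ q f := fun hh => hef (q.injective hh)
    rcases lt_or_gt_of_ne this with h' | h'
    · apply he
      rw [hF, Finset.mem_image]
      exact ⟨(e, f), by simp [hX, hC, h'], rfl⟩
    · apply hf
      rw [hF, Finset.mem_image]
      exact ⟨(f, e), by simp [hX, hsymm _ _ hC, h'], rfl⟩

/-- Combinatorial and topological data describing a 1-plane drawing together with the
map sending a point of the plane to the open cell of the planarization containing it. -/
structure Pic (V X E : Type) where
  pos : V → ℝ × ℝ
  en : E → V × V
  fk : E → Option X
  xe : X → E × E
  arc : E → ℝ → ℝ × ℝ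
  lam : ℝ × ℝ → Set (V ⊕ X)
  Tri : Set (V ⊕ X) → Prop
  en_inj : ∀ e f, s((en e).1, (en e).2) = s((en f).1, (en f).2) → e = f
  en_ne : ∀ e, (en e).1 ≠ (en e).2
  arc_cont : ∀ e, ContinuousOn (arc e) (Icc 0 1)
  arc_inj : ∀ e, InjOn (arc e) (Icc 0 1)
  arc_zero : ∀ e, arc e 0 = pos (en e).1
  arc_one : ∀ e, arc e 1 = pos (en e).2
  lam_open : ∀ p, IsOpen {z | p ∈ lam z}
  lam_pos : ∀ v, lam (pos v) = {Sum.inl v}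
  lam_unc : ∀ e, fk e = none → ∀ s ∈ Ioo (0 : ℝ) 1, lam (arc e s) = {Sum.inl (en e).1, Sum.inl (en e).2}
  lam_crs : ∀ e x, fk e = some x → ∀ s ∈ Ioo (0 : ℝ) 1, lam (arc e s) = {Sum.inr x} ∨
    lam (arc e s) = {Sum.inl (en e).1, Sum.inr x} ∨ lam (arc e s) = {Sum.inl (en e).2, Sum.inr x}
  xuniq : ∀ x z z', lam z = {Sum.inr x} → lam z' = {Sum.inr x} → z = z'
  cover : ∀ z, (∃ v, z = pos v) ∨ (∃ e, ∃ s ∈ Icc (0 : ℝ) 1, z = arc e s) ∨ Tri (lam z)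
  tri_fin : ∀ τ, Tri τ → τ.Finite
  tri_eq : ∀ τ τ', Tri τ → Tri τ' → τ ⊆ τ' → τ = τ'
  tri_adj : ∀ τ, Tri τ → ∀ u v, u ≠ v → Sum.inl u ∈ τ → Sum.inl v ∈ τ →
    ∃ e, s(u, v) = s((en e).1, (en e).2)
  tri_adj2 : ∀ τ τ', Tri τ → Tri τ' → ∀ u v x y, x ≠ y → u ≠ x → u ≠ y → v ≠ x → v ≠ y → u ≠ v →
    Sum.inl u ∈ τ → Sum.inl x ∈ τ → Sum.inl y ∈ τ → Sum.inl v ∈ τ' → Sum.inl x ∈ τ' → Sum.inl y ∈ τ' →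
    ∃ e, s(u, v) = s((en e).1, (en e).2)
  fk_iff : ∀ e x, fk e = some x ↔ e = (xe x).1 ∨ e = (xe x).2
  xe_ne : ∀ x, (xe x).1 ≠ (xe x).2
  xe_cross : ∀ x, ∃ z, z ∈ arc (xe x).1 '' Ioo 0 1 ∧ z ∈ arc (xe x).2 '' Ioo 0 1
  fk_disj : ∀ e f x, fk e = some x → fk f = some x → e ≠ f →
    (en e).1 ≠ (en f).1 ∧ (en e).1 ≠ (en f).2 ∧ (en e).2 ≠ (en f).1 ∧ (en e).2 ≠ (en f).2

namespace Pic

variable {V X E : Type} (P : Pic V X E)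

/-- The underlying edge of an abstract edge. -/
def ed (e : E) : Sym2 V := s((P.en e).1, (P.en e).2)

theorem ed_inj {e f : E} (h : P.ed e = P.ed f) : e = f := P.en_inj e f h

/-- The graph of a picture. -/
def graph : SimpleGraph V where
  Adj u v := ∃ e, s(u, v) = P.ed e
  symm := ⟨fun u v ⟨e, he⟩ => ⟨e, by rw [Sym2.eq_swap]; exact he⟩⟩
  loopless := ⟨fun u ⟨e, he⟩ => by
    have h1 := P.en_ne e
    simp only [ed, Sym2.eq_iff] at he
    rcases he with ⟨h, h'⟩ | ⟨h, h'⟩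
    · exact h1 (h ▸ h')
    · exact h1 (h' ▸ h)⟩

theorem pos_inj : Function.Injective P.pos := by
  intro u v h
  have h1 := P.lam_pos u
  rw [h, P.lam_pos v] at h1
  simpa using h1.symm

/-- The drawing of a picture. -/
def drawing : Drawing P.graph where
  pos := P.pos
  pos_inj := P.pos_inj
  arc := fun u v _ => {p | ∃ e, s(u, v) = P.ed e ∧ p ∈ P.arc e '' Icc 0 1}
  arc_symm := by
    intro u v h
    rw [Sym2.eq_swap]
  arc_isArc := by
    rintro u v ⟨e, he⟩
    have hset : {p | ∃ e, s(u, v) = P.ed e ∧ p ∈ P.arc e '' Icc 0 1} = P.arc e '' Icc 0 1 := by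
      ext p
      constructor
      · rintro ⟨e', he', hp⟩
        rwa [P.ed_inj (he.symm.trans he')]
      · intro hp
        exact ⟨e, he, hp⟩
    rw [hset]
    simp only [ed, Sym2.eq_iff] at he
    rcases he with ⟨rfl, rfl⟩ | ⟨rfl, rfl⟩
    · exact ⟨P.arc e, P.arc_cont e, P.arc_inj e, P.arc_zero e, P.arc_one e, rfl⟩
    · have hmaps : MapsTo (fun s : ℝ => 1 - s) (Icc 0 1) (Icc 0 1) := fun s hs => by
        simp only [mem_Icc] at hs ⊢; constructor <;> linarith [hs.1, hs.2]
      refine ⟨fun s => P.arc e (1 - s), ?_, ?_, by simp [P.arc_one], by simp [P.arc_zero], ?_⟩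
      · exact (P.arc_cont e).comp (by fun_prop) hmaps
      · intro s hs t ht hst
        have := P.arc_inj e (hmaps hs) (hmaps ht) hst
        linarith
      · ext p
        constructor
        · rintro ⟨s, hs, rfl⟩
          exact ⟨1 - s, hmaps hs, by simp⟩
        · rintro ⟨s, hs, rfl⟩
          exact ⟨1 - s, hmaps hs, rfl⟩

theorem adj_ed (e : E) : P.graph.Adj (P.en e).1 (P.en e).2 := ⟨e, rfl⟩

theorem arc_eq {u v : V} (h : P.graph.Adj u v) {e : E} (he : s(u, v) = P.ed e) :
    P.drawing.arc h = P.arc e '' Icc 0 1 := by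
  ext p
  constructor
  · rintro ⟨e', he', hp⟩
    rwa [P.ed_inj (he.symm.trans he')]
  · intro hp
    exact ⟨e, he, hp⟩

theorem arcInt_eq {u v : V} (h : P.graph.Adj u v) {e : E} (he : s(u, v) = P.ed e) :
    P.drawing.arcInt h = P.arc e '' Ioo 0 1 := by
  have hends : ({P.drawing.pos u, P.drawing.pos v} : Set (ℝ × ℝ)) = {P.arc e 0, P.arc e 1} := by
    rw [P.arc_zero, P.arc_one]
    simp only [ed, Sym2.eq_iff] at he
    rcases he with ⟨rfl, rfl⟩ | ⟨rfl, rfl⟩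
    · rfl
    · rw [pair_comm]; rfl
  rw [Drawing.arcInt, hends, P.arc_eq h he]
  ext p
  constructor
  · rintro ⟨⟨s, hs, rfl⟩, hn⟩
    refine ⟨s, ⟨lt_of_le_of_ne hs.1 ?_, lt_of_le_of_ne hs.2 ?_⟩, rfl⟩
    · rintro rfl; simp at hn
    · rintro rfl; simp at hn
  · rintro ⟨s, hs, rfl⟩
    refine ⟨⟨s, ⟨hs.1.le, hs.2.le⟩, rfl⟩, ?_⟩
    rintro (h | h)
    · exact hs.1.ne' (P.arc_inj e ⟨hs.1.le, hs.2.le⟩ (by simp) h)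
    · exact hs.2.ne (P.arc_inj e ⟨hs.1.le, hs.2.le⟩ (by simp) h)

theorem mem_edgeInt {q : Sym2 V} {p} : p ∈ P.drawing.edgeInt q ↔ ∃ e, q = P.ed e ∧ p ∈ P.arc e '' Ioo 0 1 := by
  constructor
  · rintro ⟨u, v, h, rfl, hp⟩
    have h' := h
    obtain ⟨e, he⟩ := h'
    rw [P.arcInt_eq _ he] at hp
    exact ⟨e, he, hp⟩
  · rintro ⟨e, rfl, hp⟩
    refine ⟨(P.en e).1, (P.en e).2, P.adj_ed e, rfl, ?_⟩
    rwa [P.arcInt_eq _ (e := e) rfl]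

/-- Common interior points of two edges. -/
theorem common {e f : E} (hef : e ≠ f) {z} (hz : z ∈ P.arc e '' Ioo 0 1) (hz' : z ∈ P.arc f '' Ioo 0 1) :
    ∃ x, P.fk e = some x ∧ P.fk f = some x ∧ P.lam z = {Sum.inr x} := by
  obtain ⟨s, hs, rfl⟩ := hz
  obtain ⟨t, ht, hst⟩ := hz'
  rcases he : P.fk e with _ | x <;> rcases hf : P.fk f with _ | y
  · have h1 := P.lam_unc e he s hs
    have h2 := P.lam_unc f hf t ht
    rw [hst, h1, pair_eq_pair_iff] at h2
    exfalso
    apply hef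
    apply P.en_inj
    rw [Sym2.eq_iff]
    simpa using h2
  · exfalso
    have h1 := P.lam_unc e he s hs
    have h2 : Sum.inr y ∈ P.lam (P.arc f t) := by
      rcases P.lam_crs f y hf t ht with h | h | h <;> rw [h] <;> simp
    rw [hst, h1] at h2
    simp at h2
  · exfalso
    have h1 := P.lam_unc f hf t ht
    have h2 : Sum.inr x ∈ P.lam (P.arc e s) := by
      rcases P.lam_crs e x he s hs with h | h | h <;> rw [h] <;> simp
    rw [← hst, h1] at h2
    simp at h2
  · have hxy : x = y := by
      have h2 : Sum.inr x ∈ P.lam (P.arc e s) := by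
        rcases P.lam_crs e x he s hs with h | h | h <;> rw [h] <;> simp
      rw [← hst] at h2
      rcases P.lam_crs f y hf t ht with h | h | h <;> rw [h] at h2 <;> simpa using h2
    subst hxy
    refine ⟨x, rfl, rfl, ?_⟩
    have hd := P.fk_disj e f x he hf hef
    rcases P.lam_crs e x he s hs with h | h | h
    · exact h
    · exfalso
      have h2 : Sum.inl (P.en e).1 ∈ P.lam (P.arc e s) := by rw [h]; simp
      rw [← hst] at h2
      rcases P.lam_crs f x hf t ht with h | h | h <;> rw [h] at h2 <;> simp at h2
      · exact hd.1 h2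
      · exact hd.2.1 h2
    · exfalso
      have h2 : Sum.inl (P.en e).2 ∈ P.lam (P.arc e s) := by rw [h]; simp
      rw [← hst] at h2
      rcases P.lam_crs f x hf t ht with h | h | h <;> rw [h] at h2 <;> simp at h2
      · exact hd.2.2.1 h2
      · exact hd.2.2.2 h2

theorem pos_notMem (w : V) (e : E) : P.pos w ∉ P.arc e '' Ioo 0 1 := by
  rintro ⟨s, hs, h⟩
  have hw := P.lam_pos w
  rw [← h] at hw
  rcases he : P.fk e with _ | x
  · rw [P.lam_unc e he s hs] at hw
    have h1 : Sum.inl (P.en e).1 ∈ ({Sum.inl w} : Set (V ⊕ X)) := by rw [← hw]; simp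
    have h2 : Sum.inl (P.en e).2 ∈ ({Sum.inl w} : Set (V ⊕ X)) := by rw [← hw]; simp
    simp at h1 h2
    exact P.en_ne e (h1.trans h2.symm)
  · have h2 : Sum.inr x ∈ P.lam (P.arc e s) := by
      rcases P.lam_crs e x he s hs with h | h | h <;> rw [h] <;> simp
    rw [hw] at h2
    simp at h2

theorem good : P.drawing.IsGood := by
  refine ⟨?_, ?_, ?_⟩
  · rintro w u v h hp
    have h' := h
    obtain ⟨e, he⟩ := h'
    rw [P.arc_eq _ he] at hp
    obtain ⟨s, hs, hw⟩ := hp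
    have hw' : P.arc e s = P.pos w := hw
    have hor : w = (P.en e).1 ∨ w = (P.en e).2 := by
      by_cases h0 : s = 0
      · subst h0; rw [P.arc_zero] at hw'; exact Or.inl (P.pos_inj hw'.symm)
      by_cases h1 : s = 1
      · subst h1; rw [P.arc_one] at hw'; exact Or.inr (P.pos_inj hw'.symm)
      exact absurd ⟨s, ⟨lt_of_le_of_ne hs.1 (Ne.symm h0), lt_of_le_of_ne hs.2 h1⟩, hw'⟩ (P.pos_notMem w e)
    simp only [ed, Sym2.eq_iff] at he
    rcases he with ⟨rfl, rfl⟩ | ⟨rfl, rfl⟩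
    · exact hor
    · exact hor.symm
  · intro q r hqr z hz z' hz'
    obtain ⟨e, rfl, he⟩ := P.mem_edgeInt.1 hz.1
    obtain ⟨f, rfl, hf⟩ := P.mem_edgeInt.1 hz.2
    obtain ⟨e', hee, he'⟩ := P.mem_edgeInt.1 hz'.1
    obtain ⟨f', hff, hf'⟩ := P.mem_edgeInt.1 hz'.2
    obtain rfl := P.ed_inj hee
    obtain rfl := P.ed_inj hff
    have hef : e ≠ f := fun h => hqr (h ▸ rfl)
    obtain ⟨x, h1, _, h2⟩ := P.common hef he hf
    obtain ⟨x', h1', _, h2'⟩ := P.common hef he' hf'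
    rw [h1] at h1'
    obtain rfl := Option.some.inj h1'
    exact P.xuniq x _ _ h2 h2'
  · rintro u v w h h' hvw
    obtain ⟨e, he⟩ := id h
    obtain ⟨f, hf⟩ := id h'
    rw [P.arcInt_eq _ he, P.arcInt_eq _ hf, eq_empty_iff_forall_notMem]
    rintro z ⟨hz, hz'⟩
    have hef : e ≠ f := by
      rintro rfl
      rw [← hf] at he
      exact hvw (Sym2.congr_right.1 he)
    obtain ⟨x, h1, h2, _⟩ := P.common hef hz hz'
    have hd := P.fk_disj e f x h1 h2 hef
    simp only [ed, Sym2.eq_iff] at he hf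
    grind

theorem cross {q r : Sym2 V} (h : P.drawing.Cross q r) :
    ∃ e f x, e ≠ f ∧ q = P.ed e ∧ r = P.ed f ∧ P.fk e = some x ∧ P.fk f = some x := by
  obtain ⟨hqr, z, hz, hz'⟩ := h
  obtain ⟨e, rfl, he⟩ := P.mem_edgeInt.1 hz
  obtain ⟨f, rfl, hf⟩ := P.mem_edgeInt.1 hz'
  have hef : e ≠ f := fun h => hqr (h ▸ rfl)
  obtain ⟨x, h1, h1', _⟩ := P.common hef he hf
  exact ⟨e, f, x, hef, rfl, rfl, h1, h1'⟩

theorem onePlanar : P.drawing.IsOnePlanar := by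
  intro q r hr r' hr'
  obtain ⟨e, f, x, hef, rfl, rfl, h1, h2⟩ := P.cross hr
  obtain ⟨e', f', x', hef', hee, rfl, h1', h2'⟩ := P.cross hr'
  obtain rfl := P.ed_inj hee
  rw [h1] at h1'
  obtain rfl := Option.some.inj h1'
  rw [P.fk_iff] at h1 h2 h2'
  have : f = f' := by grind
  rw [this]

theorem crNum_le [Fintype X] : P.drawing.crNum ≤ Fintype.card X := by
  classical
  let F : X × Bool → Sym2 V × Sym2 V := fun p =>
    if p.2 then (P.ed (P.xe p.1).1, P.ed (P.xe p.1).2) else (P.ed (P.xe p.1).2, P.ed (P.xe p.1).1)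
  have hsub : {p : Sym2 V × Sym2 V | P.drawing.Cross p.1 p.2} ⊆ range F := by
    rintro ⟨q, r⟩ h
    obtain ⟨e, f, x, hef, rfl, rfl, h1, h2⟩ := P.cross h
    rw [P.fk_iff] at h1 h2
    rcases h1 with rfl | rfl <;> rcases h2 with rfl | rfl
    · exact absurd rfl hef
    · exact ⟨(x, true), rfl⟩
    · exact ⟨(x, false), rfl⟩
    · exact absurd rfl hef
  have h1 := Set.ncard_le_ncard hsub (Set.finite_range F)
  have h2 : (range F).ncard ≤ Fintype.card (X × Bool) := by
    rw [← image_univ]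
    refine (Set.ncard_image_le).trans ?_
    rw [Set.ncard_univ, Nat.card_eq_fintype_card]
  rw [Fintype.card_prod, Fintype.card_bool] at h2
  rw [Drawing.crNum]
  omega

theorem piece {γ : ℝ → ℝ × ℝ} {a b : ℝ} (hab : a < b) (hc : ContinuousOn γ (Icc a b))
    (hT : ∀ s ∈ Ioo a b, P.Tri (P.lam (γ s))) :
    ∃ τ, P.Tri τ ∧ P.lam (γ a) ⊆ τ ∧ P.lam (γ b) ⊆ τ := by
  have hm : (a + b) / 2 ∈ Ioo a b := ⟨by linarith, by linarith⟩
  set τ := P.lam (γ ((a + b) / 2)) with hτ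
  have hcI : ContinuousOn γ (Ioo a b) := hc.mono Ioo_subset_Icc_self
  have hop : ∀ p, IsOpen (Ioo a b ∩ {s | p ∈ P.lam (γ s)}) := fun p =>
    hcI.isOpen_inter_preimage isOpen_Ioo (P.lam_open p)
  have hopT : ∀ σ, P.Tri σ → IsOpen (Ioo a b ∩ {s | P.lam (γ s) = σ}) := by
    intro σ hσ
    have : Ioo a b ∩ {s | P.lam (γ s) = σ} = Ioo a b ∩ ⋂ p ∈ σ, (Ioo a b ∩ {s | p ∈ P.lam (γ s)}) := by
      ext s
      simp only [mem_inter_iff, mem_iInter]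
      constructor
      · rintro ⟨hs, h⟩
        exact ⟨hs, fun p hp => ⟨hs, by rw [mem_setOf_eq, show P.lam (γ s) = σ from h]; exact hp⟩⟩
      · rintro ⟨hs, h⟩
        exact ⟨hs, (P.tri_eq _ _ hσ (hT s hs) fun p hp => (h p hp).2).symm⟩
    rw [this]
    exact isOpen_Ioo.inter ((P.tri_fin σ hσ).isOpen_biInter fun p _ => hop p)
  have hconst : ∀ s ∈ Ioo a b, P.lam (γ s) = τ := by
    intro s hs
    by_contra hne
    have hpre : IsPreconnected (Ioo a b) := isPreconnected_Ioo
    have hopen2 : IsOpen (⋃ σ ∈ {σ | P.Tri σ ∧ σ ≠ τ}, (Ioo a b ∩ {s | P.lam (γ s) = σ})) :=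
      isOpen_biUnion fun σ hσ => hopT σ hσ.1
    obtain ⟨r, _, hr1, hr2⟩ := hpre _ _ (hopT τ (hT _ hm)) hopen2 (by
      intro r hr
      by_cases h : P.lam (γ r) = τ
      · exact Or.inl ⟨hr, h⟩
      · right
        simp only [mem_iUnion]
        exact ⟨_, ⟨hT r hr, h⟩, hr, rfl⟩) ⟨_, hm, hm, rfl⟩ ⟨s, hs, by
        simp only [mem_iUnion]
        exact ⟨_, ⟨hT s hs, hne⟩, hs, rfl⟩⟩
    simp only [mem_iUnion] at hr2
    obtain ⟨σ, ⟨_, hσ⟩, _, h⟩ := hr2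
    exact hσ (h.symm.trans hr1.2)
  have hend : ∀ r ∈ Icc a b, P.lam (γ r) ⊆ τ := by
    intro r hr p hp
    obtain ⟨u, hu, hu2⟩ := continuousOn_iff'.1 hc _ (P.lam_open p)
    have hru : r ∈ u := by
      have : r ∈ γ ⁻¹' {z | p ∈ P.lam z} ∩ Icc a b := ⟨hp, hr⟩
      rw [hu2] at this
      exact this.1
    have hcl : r ∈ closure (Ioo a b) := by rw [closure_Ioo hab.ne]; exact hr
    obtain ⟨s, hsu, hs⟩ := mem_closure_iff.1 hcl u hu hru
    have : s ∈ u ∩ Icc a b := ⟨hsu, Ioo_subset_Icc_self hs⟩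
    rw [← hu2] at this
    rw [← hconst s hs]
    exact this.1
  exact ⟨τ, hT _ hm, hend a ⟨le_rfl, hab.le⟩, hend b ⟨hab.le, le_rfl⟩⟩

theorem maximal : P.drawing.IsMaximalOnePlane := by
  refine ⟨P.good, P.onePlanar, ?_⟩
  rintro u v huv hnadj D' hpos harc ⟨hg, h1p⟩
  have hadj : (P.graph ⊔ SimpleGraph.fromEdgeSet {s(u, v)}).Adj u v := by
    rw [SimpleGraph.sup_adj, SimpleGraph.fromEdgeSet_adj]
    exact Or.inr ⟨rfl, huv⟩
  obtain ⟨γ, hc, hi, h0, h1, ha⟩ := D'.arc_isArc hadj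
  have hpos' : ∀ w, D'.pos w = P.pos w := fun w => by rw [hpos]; rfl
  have hnew : ∀ e, s(u, v) ≠ P.ed e := fun e he => hnadj ⟨e, he⟩
  have hint : ∀ s ∈ Ioo (0 : ℝ) 1, γ s ∈ D'.arcInt hadj := by
    intro s hs
    refine ⟨by rw [ha]; exact ⟨s, ⟨hs.1.le, hs.2.le⟩, rfl⟩, ?_⟩
    rw [← h0, ← h1]
    rintro (h | h)
    · exact hs.1.ne' (hi ⟨hs.1.le, hs.2.le⟩ (by simp) h)
    · exact hs.2.ne (hi ⟨hs.1.le, hs.2.le⟩ (by simp) h)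
  have hint' : ∀ s ∈ Ioo (0 : ℝ) 1, γ s ∈ D'.edgeInt s(u, v) := fun s hs => ⟨u, v, hadj, rfl, hint s hs⟩
  have hadj' : ∀ {x y}, P.graph.Adj x y → (P.graph ⊔ SimpleGraph.fromEdgeSet {s(u, v)}).Adj x y :=
    fun {x y} h => (SimpleGraph.sup_adj _ _ _ _).mpr (Or.inl h)
  have hold : ∀ e, P.arc e '' Ioo 0 1 ⊆ D'.edgeInt (P.ed e) := by
    intro e p hp
    refine ⟨_, _, hadj' (P.adj_ed e), rfl, ?_⟩
    have h := P.arcInt_eq (P.adj_ed e) (e := e) rfl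
    rw [← h] at hp
    rw [Drawing.arcInt, harc (P.adj_ed e), hpos]
    exact hp
  have hnv : ∀ s ∈ Ioo (0 : ℝ) 1, ∀ w, γ s ≠ P.pos w := by
    intro s hs w hw
    have h := hint s hs
    rw [hw, ← hpos'] at h
    rcases hg.1 w hadj h.1 with rfl | rfl
    · exact h.2 (by simp)
    · exact h.2 (by simp)
  have hcross : ∀ s ∈ Ioo (0 : ℝ) 1, ∀ e, γ s ∈ P.arc e '' Ioo 0 1 → D'.Cross s(u, v) (P.ed e) :=
    fun s hs e h => ⟨hnew e, γ s, hint' s hs, hold e h⟩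
  have htri : ∀ s ∈ Ioo (0 : ℝ) 1, (∃ e, γ s ∈ P.arc e '' Ioo 0 1) ∨ P.Tri (P.lam (γ s)) := by
    intro s hs
    rcases P.cover (γ s) with ⟨w, hw⟩ | ⟨e, t, ht, h⟩ | h
    · exact absurd hw (hnv s hs w)
    · left
      refine ⟨e, t, ⟨lt_of_le_of_ne ht.1 ?_, lt_of_le_of_ne ht.2 ?_⟩, h.symm⟩
      · rintro rfl; rw [P.arc_zero] at h; exact hnv s hs _ h
      · rintro rfl; rw [P.arc_one] at h; exact hnv s hs _ h
    · exact Or.inr h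
  have hlu : P.lam (γ 0) = {Sum.inl u} := by rw [h0, hpos', P.lam_pos]
  have hlv : P.lam (γ 1) = {Sum.inl v} := by rw [h1, hpos', P.lam_pos]
  by_cases hex : ∃ s ∈ Ioo (0 : ℝ) 1, ∃ e, γ s ∈ P.arc e '' Ioo 0 1
  · obtain ⟨r, hr, e, he⟩ := hex
    have huniq : ∀ s ∈ Ioo (0 : ℝ) 1, s ≠ r → P.Tri (P.lam (γ s)) := by
      intro s hs hsr
      refine (htri s hs).resolve_left ?_
      rintro ⟨f, hf⟩
      have hef := h1p s(u, v) (hcross r hr e he) (hcross s hs f hf)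
      have hh := hg.2.1 s(u, v) (P.ed e) (hnew e) ⟨hint' r hr, hold e he⟩
        ⟨hint' s hs, hef ▸ hold f hf⟩
      exact hsr (hi ⟨hs.1.le, hs.2.le⟩ ⟨hr.1.le, hr.2.le⟩ hh.symm)
    have hfk : P.fk e = none := by
      rcases hfe : P.fk e with _ | x
      · rfl
      exfalso
      -- the partner of `e`
      have hsame : ∀ f, D'.Cross (P.ed e) (P.ed f) → False := by
        intro f hC
        have hC' : D'.Cross (P.ed e) s(u, v) :=
          ⟨(hnew e).symm, γ r, hold e he, hint' r hr⟩
        exact hnew f (h1p (P.ed e) hC' hC)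
      obtain ⟨z, hz1, hz2⟩ := P.xe_cross x
      have hxne := P.xe_ne x
      rcases (P.fk_iff e x).1 hfe with h | h
      · rw [← h] at hz1 hxne
        exact hsame _ ⟨fun hh => hxne (P.ed_inj hh), z, hold _ hz1, hold _ hz2⟩
      · rw [← h] at hz2 hxne
        exact hsame _ ⟨fun hh => hxne (P.ed_inj hh).symm, z, hold _ hz2, hold _ hz1⟩
    obtain ⟨t, ht, htr⟩ := he
    have hlr : P.lam (γ r) = {Sum.inl (P.en e).1, Sum.inl (P.en e).2} := by
      rw [← htr]; exact P.lam_unc e hfk t ht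
    obtain ⟨τ, hτ, h2, h3⟩ := P.piece hr.1 (hc.mono (Icc_subset_Icc le_rfl hr.2.le))
      (fun s hs => huniq s ⟨hs.1, hs.2.trans hr.2⟩ hs.2.ne)
    obtain ⟨τ', hτ', h4, h5⟩ := P.piece hr.2 (hc.mono (Icc_subset_Icc hr.1.le le_rfl))
      (fun s hs => huniq s ⟨hr.1.trans hs.1, hs.2⟩ hs.1.ne')
    rw [hlu] at h2
    rw [hlv] at h5
    rw [hlr] at h3 h4
    have hadjne : ∀ w, w = u ∨ w = v → w ≠ (P.en e).1 ∧ w ≠ (P.en e).2 := by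
      -- the edge `e` is not incident with `u` or `v`
      have aux : ∀ {w w' a b : V} (hw : (P.graph ⊔ SimpleGraph.fromEdgeSet {s(u, v)}).Adj w w')
          (_ : s(w, w') = s(u, v)) (hab : (P.graph ⊔ SimpleGraph.fromEdgeSet {s(u, v)}).Adj a b)
          (_ : s(a, b) = P.ed e), w ≠ a := by
        rintro w w' a b hw hw2 hab hab2 rfl
        have hne : w' ≠ b := by
          rintro rfl
          exact hnew e (hw2.symm.trans hab2)
        have hemp := hg.2.2 hw hab hne
        have m1 : γ r ∈ D'.arcInt hw := by
          obtain ⟨x, y, hxy, h6, h7⟩ := hint' r hr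
          rcases Sym2.eq_iff.1 (hw2.trans h6) with ⟨rfl, rfl⟩ | ⟨rfl, rfl⟩
          · exact h7
          · rw [Drawing.arcInt, ← D'.arc_symm hw, pair_comm]; exact h7
        have m2 : γ r ∈ D'.arcInt hab := by
          obtain ⟨x, y, hxy, h6, h7⟩ := hold e ⟨t, ht, htr⟩
          rcases Sym2.eq_iff.1 (hab2.trans h6) with ⟨rfl, rfl⟩ | ⟨rfl, rfl⟩
          · exact h7
          · rw [Drawing.arcInt, ← D'.arc_symm hab, pair_comm]; exact h7
        exact (hemp ▸ ⟨m1, m2⟩ : γ r ∈ (∅ : Set (ℝ × ℝ)))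
      rintro w (rfl | rfl)
      · exact ⟨aux hadj rfl (hadj' (P.adj_ed e)) rfl, aux hadj rfl (hadj' (P.adj_ed e)).symm Sym2.eq_swap⟩
      · exact ⟨aux hadj.symm Sym2.eq_swap (hadj' (P.adj_ed e)) rfl,
          aux hadj.symm Sym2.eq_swap (hadj' (P.adj_ed e)).symm Sym2.eq_swap⟩
    have hu := hadjne u (Or.inl rfl)
    have hv := hadjne v (Or.inr rfl)
    obtain ⟨f, hf⟩ := P.tri_adj2 τ τ' hτ hτ' u v _ _ (P.en_ne e) hu.1 hu.2 hv.1 hv.2 huv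
      (h2 (by simp)) (h3 (by simp)) (h3 (by simp)) (h5 (by simp)) (h4 (by simp)) (h4 (by simp))
    exact hnew f hf
  · push Not at hex
    obtain ⟨τ, hτ, h2, h3⟩ := P.piece one_pos hc (fun s hs => (htri s hs).resolve_left (by
      rintro ⟨e, he⟩; exact hex s hs e he))
    rw [hlu] at h2
    rw [hlv] at h3
    obtain ⟨f, hf⟩ := P.tri_adj τ hτ u v huv (h2 (by simp)) (h3 (by simp))
    exact hnew f hf

end Pic

/-- Vertices of the construction. -/
inductive Vt (ι : Type) : Type
  | hub (ε : Bool) : Vt ι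
  | a (i : ι) (σ ε : Bool) : Vt ι
  | x (i : ι) (σ : Bool) : Vt ι
  | c (i : ι) : Vt ι
  | t (i : ι) (ε : Bool) : Vt ι

/-- Crossing points of the construction. -/
inductive Xt (ι : Type) : Type
  | d (i : ι) (ε : Bool) : Xt ι
  | M (i : ι) : Xt ι

/-- The sign of a Boolean. -/
def sg (b : Bool) : ℝ := if b then 1 else -1

@[simp] theorem sg_true : sg true = 1 := rfl
@[simp] theorem sg_false : sg false = -1 := rfl

/-- Open stars of the planarization in the strip. -/
def star0 : Vt ℤ ⊕ Xt ℤ → ℝ × ℝ → Prop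
  | .inl (.hub ε), q => 2 < sg ε * q.2 ∨ ∃ j : ℤ, 1 < sg ε * q.2 ∧ 2 < sg ε * q.2 + (q.1 - 6 * j) ∧
      2 < sg ε * q.2 + (6 * j + 6 - q.1) ∧ 0 < q.1 - 6 * j ∧ q.1 - 6 * j < 6
  | .inl (.a i σ ε), q => sg σ * (q.1 - 6 * i) < 3 ∧ 0 < sg σ * (q.1 - 6 * i) + sg ε * q.2 ∧
      (sg σ * (q.1 - 6 * i) - 2 < sg ε * q.2 ∨ 0 < sg ε * q.2) ∧
      (0 < sg σ * (q.1 - 6 * i) ∨ sg ε * q.2 < 2 + sg σ * (q.1 - 6 * i))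
  | .inl (.x i σ), q => 1 < sg σ * (q.1 - 6 * i) ∧ |q.2| < (3 - sg σ * (q.1 - 6 * i)) / 2
  | .inl (.c i), q => |q.2| < 1 ∧ |q.1 - (6 * i - 3)| < 1 + |q.2|
  | .inl (.t i ε), q => 1 < sg ε * q.2 ∧ |q.1 - 6 * i| < 1
  | .inr (.d i ε), q => |q.1 - (6 * i - 3)| / 2 < sg ε * q.2 ∧ |q.1 - (6 * i - 3)| < 2
  | .inr (.M i), q => |q.1 - 6 * i| < 1 ∧ |q.2| < 1

theorem star0_open (p : Vt ℤ ⊕ Xt ℤ) : IsOpen {q | star0 p q} := by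
  rcases p with (ε | ⟨i, σ, ε⟩ | ⟨i, σ⟩ | i | ⟨i, ε⟩) | (⟨i, ε⟩ | i)
  · simp only [star0, setOf_or, setOf_exists]
    refine (isOpen_lt (by fun_prop) (by fun_prop)).union (isOpen_iUnion fun j => ?_)
    simp only [setOf_and]
    repeat' apply IsOpen.inter
    all_goals exact isOpen_lt (by fun_prop) (by fun_prop)
  all_goals
    simp only [star0, setOf_or, setOf_and]
    repeat' first | apply IsOpen.inter | apply IsOpen.union
    all_goals exact isOpen_lt (by fun_prop) (by fun_prop)

/-- Folded coordinates. -/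
def pt (i : ℤ) (σ ε : Bool) (v Y : ℝ) : ℝ × ℝ := (6 * i + sg σ * v, sg ε * Y)

/-- The index of the crossing column on the `σ` side of cell `i`. -/
def cI {ι : Type} [Add ι] [One ι] (i : ι) (σ : Bool) : ι := if σ then i + 1 else i

theorem exists_pt (q : ℝ × ℝ) : ∃ i σ ε v Y, 0 ≤ v ∧ v ≤ 3 ∧ 0 ≤ Y ∧ q = pt i σ ε v Y := by
  obtain ⟨x, y⟩ := q
  obtain ⟨i, hi1, hi2⟩ : ∃ i : ℤ, (6 * i : ℝ) - 3 ≤ x ∧ x ≤ 6 * i + 3 := by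
    refine ⟨⌊(x + 3) / 6⌋, ?_, ?_⟩
    · have := Int.floor_le ((x + 3) / 6); linarith
    · have := Int.lt_floor_add_one ((x + 3) / 6); linarith
  obtain ⟨σ, v, hv0, hv3, hx⟩ : ∃ σ v, 0 ≤ v ∧ v ≤ 3 ∧ x = 6 * i + sg σ * v := by
    rcases le_total (6 * i : ℝ) x with h | h
    · exact ⟨true, x - 6 * i, by linarith, by linarith, by simp⟩
    · exact ⟨false, 6 * i - x, by linarith, by linarith, by simp⟩
  obtain ⟨ε, Y, hY, hy⟩ : ∃ ε Y, 0 ≤ Y ∧ y = sg ε * Y := by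
    rcases le_total 0 y with h | h
    · exact ⟨true, y, h, by simp⟩
    · exact ⟨false, -y, by linarith, by simp⟩
  exact ⟨i, σ, ε, v, Y, hv0, hv3, hY, by rw [pt, hx, hy]⟩

theorem int_eq_of {j i : ℤ} (h1 : (j : ℝ) < i + 1) (h2 : (i : ℝ) < j + 1) : j = i := by
  have h1' : j < i + 1 := by exact_mod_cast h1
  have h2' : i < j + 1 := by exact_mod_cast h2
  omega

theorem star0_fold (p : Vt ℤ ⊕ Xt ℤ) (i : ℤ) (σ ε : Bool) (v Y : ℝ) (h0 : 0 ≤ v) (h3 : v ≤ 3) (hY : 0 ≤ Y) :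
    star0 p (pt i σ ε v Y) ↔
      (p = .inl (.hub ε) ∧ 1 < Y ∧ 2 < v + Y) ∨
      (p = .inl (.a i σ ε) ∧ v < 3 ∧ 0 < v + Y ∧ (v < 2 ∨ 0 < Y) ∧ (0 < v ∨ Y < 2)) ∨
      (p = .inl (.a i σ !ε) ∧ Y < v ∧ v + Y < 2) ∨
      (p = .inl (.a i (!σ) ε) ∧ v < Y ∧ v + Y < 2) ∨
      (p = .inl (.x i σ) ∧ 1 < v ∧ Y < (3 - v) / 2) ∨
      (p = .inl (.t i ε) ∧ 1 < Y ∧ v < 1) ∨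
      (p = .inr (.M i) ∧ v < 1 ∧ Y < 1) ∨
      (p = .inl (.c (cI i σ)) ∧ Y < 1 ∧ 2 < v + Y) ∨
      (p = .inr (.d (cI i σ) ε) ∧ (3 - v) / 2 < Y ∧ 1 < v) := by
  rcases p with (ε' | ⟨j, σ', ε'⟩ | ⟨j, σ'⟩ | j | ⟨j, ε'⟩) | (⟨j, ε'⟩ | j)
  · -- hub
    simp only [star0, pt, Sum.inl.injEq, Vt.hub.injEq, reduceCtorEq, false_and, or_false]
    constructor
    · rintro (h | ⟨j, h1, h2, h3', h4, h5⟩)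
      · cases ε <;> cases ε' <;> simp at h ⊢ <;> first | (constructor <;> linarith) | linarith
      · have hy : 1 < Y ∧ ε' = ε := by
          cases ε <;> cases ε' <;> simp at h1 ⊢ <;> linarith
        obtain ⟨hy, rfl⟩ := hy
        refine ⟨rfl, hy, ?_⟩
        cases σ
        · have : j = i - 1 := by
            simp at h4 h5
            apply int_eq_of <;> push_cast <;> linarith
          subst this
          cases ε' <;> simp at h3' h2 ⊢ <;> linarith
        · have : j = i := by
            simp at h4 h5
            apply int_eq_of <;> linarith
          subst this
          cases ε' <;> simp at h3' h2 ⊢ <;> linarith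
    · rintro ⟨rfl, h1, h2⟩
      rcases h0.eq_or_lt with rfl | h0
      · left
        cases ε' <;> simp at h2 ⊢ <;> linarith
      · right
        refine ⟨if σ then i else i - 1, ?_⟩
        cases σ <;> cases ε' <;> simp <;> refine ⟨?_, ?_, ?_, ?_, ?_⟩ <;> linarith
  · -- a
    simp only [star0, pt, Sum.inl.injEq, Vt.a.injEq, reduceCtorEq, false_and, or_false, false_or]
    constructor
    · rintro ⟨h1, h2, h4, h5⟩
      have hj : j = i := by
        cases σ <;> cases ε <;> cases σ' <;> cases ε' <;> simp at h1 h2 h4 h5 <;>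
        apply int_eq_of <;>
        (rcases h5 with h5 | h5 <;> rcases h4 with h4 | h4 <;> linarith)
      subst hj
      cases σ <;> cases ε <;> cases σ' <;> cases ε' <;> simp at h1 h2 h4 h5 ⊢ <;> grind
    · intro h
      rcases h with ⟨⟨rfl, rfl, rfl⟩, h1, h2, h4, h5⟩ | ⟨⟨rfl, rfl, rfl⟩, h1, h2⟩ | ⟨⟨rfl, rfl, rfl⟩, h1, h2⟩
      · cases σ' <;> cases ε' <;> simp <;> grind
      · cases σ' <;> cases ε <;> simp <;> grind
      · cases σ <;> cases ε' <;> simp <;> grind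
  · -- x
    simp only [star0, pt, Sum.inl.injEq, Vt.x.injEq, reduceCtorEq, false_and, or_false, false_or, abs_lt]
    constructor
    · rintro ⟨h1, h2, h4⟩
      have hj : j = i := by
        cases σ <;> cases ε <;> cases σ' <;> simp at h1 h2 h4 <;>
        apply int_eq_of <;> linarith
      subst hj
      cases σ <;> cases ε <;> cases σ' <;> simp at h1 h2 h4 ⊢ <;> first | (constructor <;> linarith) | linarith
    · rintro ⟨⟨rfl, rfl⟩, h1, h2⟩
      cases σ' <;> cases ε <;> simp <;> refine ⟨?_, ?_, ?_⟩ <;> linarith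
  · -- c
    have habs : |sg ε * Y| = Y := by cases ε <;> simp [abs_of_nonneg hY]
    simp only [star0, pt, Sum.inl.injEq, Vt.c.injEq, reduceCtorEq, false_and, or_false, false_or, habs]
    constructor
    · rintro ⟨h1, h2⟩
      rw [abs_lt] at h2
      cases σ
      · have hj : j = i := by
          simp at h2
          apply int_eq_of <;> linarith
        subst hj
        simp at h2
        simp [cI]
        constructor <;> linarith
      · have hj : j = i + 1 := by
          simp at h2
          apply int_eq_of <;> push_cast <;> linarith
        subst hj
        simp at h2
        simp [cI]
        constructor <;> linarith
    · rintro ⟨rfl, h1, h2⟩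
      rw [abs_lt]
      cases σ <;> simp [cI] <;> refine ⟨?_, ?_, ?_⟩ <;> linarith
  · -- t
    simp only [star0, pt, Sum.inl.injEq, Vt.t.injEq, reduceCtorEq, false_and, or_false, false_or, abs_lt]
    constructor
    · rintro ⟨h1, h2, h4⟩
      have hj : j = i := by
        cases σ <;> simp at h2 h4 <;> apply int_eq_of <;> linarith
      subst hj
      cases σ <;> cases ε <;> cases ε' <;> simp at h1 h2 h4 ⊢ <;> first | (constructor <;> linarith) | linarith
    · rintro ⟨⟨rfl, rfl⟩, h1, h2⟩
      cases σ <;> cases ε' <;> simp <;> refine ⟨?_, ?_, ?_⟩ <;> linarith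
  · -- d
    simp only [star0, pt, Sum.inr.injEq, Xt.d.injEq, reduceCtorEq, false_and, or_false, false_or]
    constructor
    · rintro ⟨h1, h2⟩
      have h2' := abs_lt.1 h2
      have hpos := abs_nonneg (6 * (i : ℝ) + sg σ * v - (6 * j - 3))
      have hj : j = cI i σ := by
        cases σ <;> simp at h2' <;> simp [cI] <;> apply int_eq_of <;> push_cast <;> linarith
      subst hj
      have habs : |6 * (i : ℝ) + sg σ * v - (6 * (cI i σ : ℤ) - 3)| = 3 - v := by
        cases σ <;> simp [cI]
        · rw [abs_of_nonneg] <;> linarith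
        · rw [abs_of_nonpos] <;> linarith
      rw [habs] at h1 h2
      cases ε <;> cases ε' <;> simp at h1 ⊢ <;> first | (constructor <;> linarith) | linarith
    · rintro ⟨⟨rfl, rfl⟩, h1, h2⟩
      have habs : |6 * (i : ℝ) + sg σ * v - (6 * (cI i σ : ℤ) - 3)| = 3 - v := by
        cases σ <;> simp [cI]
        · rw [abs_of_nonneg] <;> linarith
        · rw [abs_of_nonpos] <;> linarith
      rw [habs]
      cases ε' <;> simp <;> constructor <;> linarith
  · -- M
    have habs : |sg ε * Y| = Y := by cases ε <;> simp [abs_of_nonneg hY]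
    simp only [star0, pt, Sum.inr.injEq, Xt.M.injEq, reduceCtorEq, false_and, or_false, false_or, abs_lt (b := (1:ℝ)) (a := 6 * (i : ℝ) + sg σ * v - 6 * j), habs]
    constructor
    · rintro ⟨⟨h2, h4⟩, h1⟩
      have hj : j = i := by
        cases σ <;> simp at h2 h4 <;> apply int_eq_of <;> linarith
      subst hj
      cases σ <;> simp at h2 h4 ⊢ <;> constructor <;> linarith
    · rintro ⟨rfl, h1, h2⟩
      cases σ <;> simp <;> refine ⟨⟨?_, ?_⟩, ?_⟩ <;> linarith

/-- Edges of the construction. -/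
inductive Et (ι : Type) : Type
  | Ta (i : ι) (σ ε : Bool) : Et ι
  | Tt (i : ι) (ε : Bool) : Et ι
  | Tc (i : ι) (ε : Bool) : Et ι
  | ta (i : ι) (σ ε : Bool) : Et ι
  | aa (i : ι) (ε : Bool) : Et ι
  | av (i : ι) (σ : Bool) : Et ι
  | ac (i : ι) (σ ε : Bool) : Et ι
  | xc (i : ι) (σ : Bool) : Et ι
  | xa (i : ι) (σ ε : Bool) : Et ι
  | dd (i : ι) (ε : Bool) : Et ι
  | mm (i : ι) (ε : Bool) : Et ι

/-- End vertices. -/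
def Et.en {ι : Type} [Ring ι] : Et ι → Vt ι × Vt ι
  | .Ta i σ ε => (.a i σ ε, .hub ε)
  | .Tt i ε => (.t i ε, .hub ε)
  | .Tc i ε => (.c i, .hub ε)
  | .ta i σ ε => (.a i σ ε, .t i ε)
  | .aa i ε => (.a i false ε, .a i true ε)
  | .av i σ => (.a i σ true, .a i σ false)
  | .ac i σ ε => (.a i σ ε, .c (cI i σ))
  | .xc i σ => (.x i σ, .c (cI i σ))
  | .xa i σ ε => (.x i σ, .a i σ ε)
  | .dd i ε => (.a i false ε, .a (i - 1) true ε)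
  | .mm i ε => (.a i false ε, .a i true !ε)

/-- The crossing on an edge. -/
def Et.fk {ι : Type} : Et ι → Option (Xt ι)
  | .Tc i ε => some (.d i ε)
  | .dd i ε => some (.d i ε)
  | .mm i _ => some (.M i)
  | _ => none

/-- The two edges at a crossing. -/
def Xt.xe {ι : Type} : Xt ι → Et ι × Et ι
  | .d i ε => (.Tc i ε, .dd i ε)
  | .M i => (.mm i false, .mm i true)

/-- The hub at the end of an edge, if any. -/
def Et.ray {ι : Type} : Et ι → Option Bool
  | .Ta _ _ ε => some ε
  | .Tt _ ε => some ε
  | .Tc _ ε => some ε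
  | _ => none

/-- Positions in the strip (irrelevant for hubs). -/
def posZ : Vt ℤ → ℝ × ℝ
  | .hub _ => (0, 0)
  | .a i σ ε => (6 * i + sg σ, sg ε)
  | .x i σ => (6 * i + 2 * sg σ, 0)
  | .c i => (6 * i - 3, 0)
  | .t i ε => (6 * i, 2 * sg ε)

/-- Points of a segment edge. -/
def segPt (e : Et ℤ) (s : ℝ) : ℝ × ℝ :=
  ((posZ e.en.1).1 + s * ((posZ e.en.2).1 - (posZ e.en.1).1),
   (posZ e.en.1).2 + s * ((posZ e.en.2).2 - (posZ e.en.1).2))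

/-- Points of a ray edge towards the hub `ε`. -/
def rayPt (e : Et ℤ) (ε : Bool) (h : ℝ) : ℝ × ℝ := ((posZ e.en.1).1, (posZ e.en.1).2 + sg ε * h)

/-- The open cell of the planarization containing a point of the strip. -/
def lamZ (q : ℝ × ℝ) : Set (Vt ℤ ⊕ Xt ℤ) := {p | star0 p q}

/-- The faces of the planarization. -/
inductive TriP {ι : Type} [Ring ι] : Set (Vt ι ⊕ Xt ι) → Prop
  | had (i : ι) (σ ε : Bool) : TriP {.inl (.hub ε), .inl (.a i σ ε), .inr (.d (cI i σ) ε)}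
  | hat (i : ι) (σ ε : Bool) : TriP {.inl (.hub ε), .inl (.a i σ ε), .inl (.t i ε)}
  | aat (i : ι) (σ ε : Bool) : TriP {.inl (.a i σ ε), .inl (.a i (!σ) ε), .inl (.t i ε)}
  | cda (i : ι) (σ ε : Bool) : TriP {.inl (.c (cI i σ)), .inr (.d (cI i σ) ε), .inl (.a i σ ε)}
  | cax (i : ι) (σ ε : Bool) : TriP {.inl (.c (cI i σ)), .inl (.a i σ ε), .inl (.x i σ)}
  | aax (i : ι) (σ ε : Bool) : TriP {.inl (.a i σ ε), .inl (.a i σ !ε), .inl (.x i σ)}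
  | mav (i : ι) (σ ε : Bool) : TriP {.inr (.M i), .inl (.a i σ ε), .inl (.a i σ !ε)}
  | mah (i : ι) (σ ε : Bool) : TriP {.inr (.M i), .inl (.a i σ ε), .inl (.a i (!σ) ε)}

section strata
variable (i : ℤ) (σ ε : Bool) {v Y : ℝ}

theorem st_had (h1 : 1 < v) (h2 : v < 3) (h3 : 1 < Y) :
    lamZ (pt i σ ε v Y) = {.inl (.hub ε), .inl (.a i σ ε), .inr (.d (cI i σ) ε)} := by
  ext p
  simp only [lamZ, mem_ofPred_eq, star0_fold p i σ ε v Y (by linarith) (by linarith) (by linarith), mem_insert_iff, mem_singleton_iff]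
  grind
theorem st_hd (h3 : 1 < Y) : lamZ (pt i σ ε 3 Y) = {.inl (.hub ε), .inr (.d (cI i σ) ε)} := by
  ext p
  simp only [lamZ, mem_ofPred_eq, star0_fold p i σ ε 3 Y (by linarith) (by linarith) (by linarith), mem_insert_iff, mem_singleton_iff]
  grind
theorem st_ha (h3 : 1 < Y) : lamZ (pt i σ ε 1 Y) = {.inl (.hub ε), .inl (.a i σ ε)} := by
  ext p
  simp only [lamZ, mem_ofPred_eq, star0_fold p i σ ε 1 Y (by linarith) (by linarith) (by linarith), mem_insert_iff, mem_singleton_iff]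
  grind
theorem st_hat (h1 : 0 < v) (h2 : v < 1) (h3 : 2 < v + Y) :
    lamZ (pt i σ ε v Y) = {.inl (.hub ε), .inl (.a i σ ε), .inl (.t i ε)} := by
  ext p
  simp only [lamZ, mem_ofPred_eq, star0_fold p i σ ε v Y (by linarith) (by linarith) (by linarith), mem_insert_iff, mem_singleton_iff]
  grind
theorem st_ht (h3 : 2 < Y) : lamZ (pt i σ ε 0 Y) = {.inl (.hub ε), .inl (.t i ε)} := by
  ext p
  simp only [lamZ, mem_ofPred_eq, star0_fold p i σ ε 0 Y (by linarith) (by linarith) (by linarith), mem_insert_iff, mem_singleton_iff]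
  grind
theorem st_t : lamZ (pt i σ ε 0 2) = {.inl (.t i ε)} := by
  ext p
  simp only [lamZ, mem_ofPred_eq, star0_fold p i σ ε 0 2 (by linarith) (by linarith) (by linarith), mem_singleton_iff]
  grind
theorem st_at (h1 : 0 < v) (h2 : v < 1) (h3 : v + Y = 2) :
    lamZ (pt i σ ε v Y) = {.inl (.a i σ ε), .inl (.t i ε)} := by
  ext p
  simp only [lamZ, mem_ofPred_eq, star0_fold p i σ ε v Y (by linarith) (by linarith) (by linarith), mem_insert_iff, mem_singleton_iff]
  grind
theorem st_aat (h1 : 0 ≤ v) (h2 : 1 < Y) (h3 : v + Y < 2) :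
    lamZ (pt i σ ε v Y) = {.inl (.a i σ ε), .inl (.a i (!σ) ε), .inl (.t i ε)} := by
  ext p
  simp only [lamZ, mem_ofPred_eq, star0_fold p i σ ε v Y (by linarith) (by linarith) (by linarith), mem_insert_iff, mem_singleton_iff]
  grind
theorem st_d : lamZ (pt i σ ε 3 1) = {.inr (.d (cI i σ) ε)} := by
  ext p
  simp only [lamZ, mem_ofPred_eq, star0_fold p i σ ε 3 1 (by linarith) (by linarith) (by linarith), mem_singleton_iff]
  grind
theorem st_da (h1 : 1 < v) (h2 : v < 3) :
    lamZ (pt i σ ε v 1) = {.inl (.a i σ ε), .inr (.d (cI i σ) ε)} := by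
  ext p
  simp only [lamZ, mem_ofPred_eq, star0_fold p i σ ε v 1 (by linarith) (by linarith) (by linarith), mem_insert_iff, mem_singleton_iff]
  grind
theorem st_a : lamZ (pt i σ ε 1 1) = {.inl (.a i σ ε)} := by
  ext p
  simp only [lamZ, mem_ofPred_eq, star0_fold p i σ ε 1 1 (by linarith) (by linarith) (by linarith), mem_singleton_iff]
  grind
theorem st_aa (h1 : 0 ≤ v) (h2 : v < 1) :
    lamZ (pt i σ ε v 1) = {.inl (.a i σ ε), .inl (.a i (!σ) ε)} := by
  ext p
  simp only [lamZ, mem_ofPred_eq, star0_fold p i σ ε v 1 (by linarith) (by linarith) (by linarith), mem_insert_iff, mem_singleton_iff]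
  grind
theorem st_c : lamZ (pt i σ ε 3 0) = {.inl (.c (cI i σ))} := by
  ext p
  simp only [lamZ, mem_ofPred_eq, star0_fold p i σ ε 3 0 (by linarith) (by linarith) (by linarith), mem_singleton_iff]
  grind
theorem st_cd (h1 : 0 < Y) (h2 : Y < 1) :
    lamZ (pt i σ ε 3 Y) = {.inl (.c (cI i σ)), .inr (.d (cI i σ) ε)} := by
  ext p
  simp only [lamZ, mem_ofPred_eq, star0_fold p i σ ε 3 Y (by linarith) (by linarith) (by linarith), mem_insert_iff, mem_singleton_iff]
  grind
theorem st_cda (h1 : v < 3) (h2 : Y < 1) (h3 : (3 - v) / 2 < Y) :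
    lamZ (pt i σ ε v Y) = {.inl (.c (cI i σ)), .inr (.d (cI i σ) ε), .inl (.a i σ ε)} := by
  ext p
  simp only [lamZ, mem_ofPred_eq, star0_fold p i σ ε v Y (by linarith) (by linarith) (by linarith), mem_insert_iff, mem_singleton_iff]
  grind
theorem st_ac (h1 : 1 < v) (h2 : v < 3) (h3 : Y = (3 - v) / 2) :
    lamZ (pt i σ ε v Y) = {.inl (.a i σ ε), .inl (.c (cI i σ))} := by
  ext p
  simp only [lamZ, mem_ofPred_eq, star0_fold p i σ ε v Y (by linarith) (by linarith) (by linarith), mem_insert_iff, mem_singleton_iff]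
  grind
theorem st_cax (h1 : 0 < Y) (h2 : Y < (3 - v) / 2) (h3 : 2 < v + Y) :
    lamZ (pt i σ ε v Y) = {.inl (.c (cI i σ)), .inl (.a i σ ε), .inl (.x i σ)} := by
  ext p
  simp only [lamZ, mem_ofPred_eq, star0_fold p i σ ε v Y (by linarith) (by linarith) (by linarith), mem_insert_iff, mem_singleton_iff]
  grind
theorem st_xc (h1 : 2 < v) (h2 : v < 3) :
    lamZ (pt i σ ε v 0) = {.inl (.x i σ), .inl (.c (cI i σ))} := by
  ext p
  simp only [lamZ, mem_ofPred_eq, star0_fold p i σ ε v 0 (by linarith) (by linarith) (by linarith), mem_insert_iff, mem_singleton_iff]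
  grind
theorem st_x : lamZ (pt i σ ε 2 0) = {.inl (.x i σ)} := by
  ext p
  simp only [lamZ, mem_ofPred_eq, star0_fold p i σ ε 2 0 (by linarith) (by linarith) (by linarith), mem_singleton_iff]
  grind
theorem st_xa (h1 : 0 < Y) (h2 : Y < 1) (h3 : v + Y = 2) :
    lamZ (pt i σ ε v Y) = {.inl (.x i σ), .inl (.a i σ ε)} := by
  ext p
  simp only [lamZ, mem_ofPred_eq, star0_fold p i σ ε v Y (by linarith) (by linarith) (by linarith), mem_insert_iff, mem_singleton_iff]
  grind
theorem st_aax (h0 : 0 ≤ Y) (h1 : 1 < v) (h3 : v + Y < 2) :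
    lamZ (pt i σ ε v Y) = {.inl (.a i σ ε), .inl (.a i σ !ε), .inl (.x i σ)} := by
  ext p
  simp only [lamZ, mem_ofPred_eq, star0_fold p i σ ε v Y (by linarith) (by linarith) (by linarith), mem_insert_iff, mem_singleton_iff]
  grind
theorem st_av (h0 : 0 ≤ Y) (h1 : Y < 1) :
    lamZ (pt i σ ε 1 Y) = {.inl (.a i σ ε), .inl (.a i σ !ε)} := by
  ext p
  simp only [lamZ, mem_ofPred_eq, star0_fold p i σ ε 1 Y (by linarith) (by linarith) (by linarith), mem_insert_iff, mem_singleton_iff]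
  grind
theorem st_mav (h0 : 0 ≤ Y) (h1 : Y < v) (h2 : v < 1) :
    lamZ (pt i σ ε v Y) = {.inr (.M i), .inl (.a i σ ε), .inl (.a i σ !ε)} := by
  ext p
  simp only [lamZ, mem_ofPred_eq, star0_fold p i σ ε v Y (by linarith) (by linarith) (by linarith), mem_insert_iff, mem_singleton_iff]
  grind
theorem st_mah (h0 : 0 ≤ v) (h1 : v < Y) (h2 : Y < 1) :
    lamZ (pt i σ ε v Y) = {.inr (.M i), .inl (.a i σ ε), .inl (.a i (!σ) ε)} := by
  ext p
  simp only [lamZ, mem_ofPred_eq, star0_fold p i σ ε v Y (by linarith) (by linarith) (by linarith), mem_insert_iff, mem_singleton_iff]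
  grind
theorem st_ma (h0 : 0 < v) (h1 : v < 1) :
    lamZ (pt i σ ε v v) = {.inl (.a i σ ε), .inr (.M i)} := by
  ext p
  simp only [lamZ, mem_ofPred_eq, star0_fold p i σ ε v v (by linarith) (by linarith) (by linarith), mem_insert_iff, mem_singleton_iff]
  grind
theorem st_m : lamZ (pt i σ ε 0 0) = {.inr (.M i)} := by
  ext p
  simp only [lamZ, mem_ofPred_eq, star0_fold p i σ ε 0 0 (by linarith) (by linarith) (by linarith), mem_singleton_iff]
  grind

end strata

/-- The cell of an interior point of an edge has the expected form. -/
def EdgeOK {ι : Type} [Ring ι] (e : Et ι) (L : Set (Vt ι ⊕ Xt ι)) : Prop :=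
  (e.fk = none → L = {Sum.inl e.en.1, Sum.inl e.en.2}) ∧
  ∀ x, e.fk = some x → L = {Sum.inr x} ∨ L = {Sum.inl e.en.1, Sum.inr x} ∨ L = {Sum.inl e.en.2, Sum.inr x}

theorem seg_ok (e : Et ℤ) (he : e.ray = none) (s : ℝ) (hs : s ∈ Ioo (0 : ℝ) 1) :
    EdgeOK e (lamZ (segPt e s)) := by
  obtain ⟨h0, h1⟩ := hs
  rcases e with ⟨i, σ, ε⟩ | ⟨i, ε⟩ | ⟨i, ε⟩ | ⟨i, σ, ε⟩ | ⟨i, ε⟩ | ⟨i, σ⟩ | ⟨i, σ, ε⟩ | ⟨i, σ⟩ | ⟨i, σ, ε⟩ | ⟨i, ε⟩ | ⟨i, ε⟩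
  · simp [Et.ray] at he
  · simp [Et.ray] at he
  · simp [Et.ray] at he
  · have : segPt (.ta i σ ε) s = pt i σ ε (1 - s) (1 + s) := by
      simp only [segPt, pt, Et.en, posZ]; ext <;> simp <;> ring
    refine ⟨fun _ => ?_, by simp [Et.fk]⟩
    rw [this, st_at i σ ε (by linarith) (by linarith) (by ring)]; rfl
  · refine ⟨fun _ => ?_, by simp [Et.fk]⟩
    rcases le_total s (1 / 2) with h | h
    · have : segPt (.aa i ε) s = pt i false ε (1 - 2 * s) 1 := by
        simp only [segPt, pt, Et.en, posZ]; ext <;> simp <;> ring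
      rw [this, st_aa i false ε (by linarith) (by linarith)]; rfl
    · have : segPt (.aa i ε) s = pt i true ε (2 * s - 1) 1 := by
        simp only [segPt, pt, Et.en, posZ]; ext <;> simp <;> ring
      rw [this, st_aa i true ε (by linarith) (by linarith), pair_comm]; rfl
  · refine ⟨fun _ => ?_, by simp [Et.fk]⟩
    rcases le_total s (1 / 2) with h | h
    · have : segPt (.av i σ) s = pt i σ true 1 (1 - 2 * s) := by
        simp only [segPt, pt, Et.en, posZ]; ext <;> simp <;> ring
      rw [this, st_av i σ true (by linarith) (by linarith)]; rfl
    · have : segPt (.av i σ) s = pt i σ false 1 (2 * s - 1) := by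
        simp only [segPt, pt, Et.en, posZ]; ext <;> simp <;> ring
      rw [this, st_av i σ false (by linarith) (by linarith), pair_comm]; rfl
  · have : segPt (.ac i σ ε) s = pt i σ ε (1 + 2 * s) (1 - s) := by
      simp only [segPt, pt, Et.en, posZ, cI]; cases σ <;> ext <;> simp <;> ring
    refine ⟨fun _ => ?_, by simp [Et.fk]⟩
    rw [this, st_ac i σ ε (by linarith) (by linarith) (by ring)]; rfl
  · have : segPt (.xc i σ) s = pt i σ true (2 + s) 0 := by
      simp only [segPt, pt, Et.en, posZ, cI]; cases σ <;> ext <;> simp <;> ring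
    refine ⟨fun _ => ?_, by simp [Et.fk]⟩
    rw [this, st_xc i σ true (by linarith) (by linarith)]; rfl
  · have : segPt (.xa i σ ε) s = pt i σ ε (2 - s) s := by
      simp only [segPt, pt, Et.en, posZ]; ext <;> simp <;> ring
    refine ⟨fun _ => ?_, by simp [Et.fk]⟩
    rw [this, st_xa i σ ε (by linarith) (by linarith) (by ring)]; rfl
  · refine ⟨by simp [Et.fk], ?_⟩
    intro x hx
    simp only [Et.fk, Option.some.injEq] at hx
    subst hx
    rcases lt_trichotomy s (1 / 2) with h | h | h
    · have : segPt (.dd i ε) s = pt i false ε (1 + 4 * s) 1 := by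
        simp only [segPt, pt, Et.en, posZ]; ext <;> simp <;> ring
      right; left
      rw [this, st_da i false ε (by linarith) (by linarith)]; rfl
    · have : segPt (.dd i ε) s = pt i false ε 3 1 := by
        subst h; simp only [segPt, pt, Et.en, posZ]; ext <;> simp <;> ring
      left
      rw [this, st_d i false ε]; rfl
    · have : segPt (.dd i ε) s = pt (i - 1) true ε (5 - 4 * s) 1 := by
        simp only [segPt, pt, Et.en, posZ]; ext <;> simp <;> ring
      right; right
      rw [this, st_da (i - 1) true ε (by linarith) (by linarith)]; simp [cI, Et.en]
  · refine ⟨by simp [Et.fk], ?_⟩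
    intro x hx
    simp only [Et.fk, Option.some.injEq] at hx
    subst hx
    rcases lt_trichotomy s (1 / 2) with h | h | h
    · have : segPt (.mm i ε) s = pt i false ε (1 - 2 * s) (1 - 2 * s) := by
        simp only [segPt, pt, Et.en, posZ]; cases ε <;> ext <;> simp <;> ring
      right; left
      rw [this, st_ma i false ε (by linarith) (by linarith)]; rfl
    · have : segPt (.mm i ε) s = pt i false ε 0 0 := by
        subst h; simp only [segPt, pt, Et.en, posZ]; cases ε <;> ext <;> simp <;> ring
      left
      rw [this, st_m i false ε]
    · have : segPt (.mm i ε) s = pt i true (!ε) (2 * s - 1) (2 * s - 1) := by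
        simp only [segPt, pt, Et.en, posZ]; cases ε <;> ext <;> simp <;> ring
      right; right
      rw [this, st_ma i true (!ε) (by linarith) (by linarith)]; simp [Et.en]

theorem ray_ok (e : Et ℤ) (ε : Bool) (he : e.ray = some ε) (h : ℝ) (h0 : 0 < h) :
    EdgeOK e (lamZ (rayPt e ε h)) := by
  rcases e with ⟨i, σ, ε⟩ | ⟨i, ε⟩ | ⟨i, ε⟩ | ⟨i, σ, ε⟩ | ⟨i, ε⟩ | ⟨i, σ⟩ | ⟨i, σ, ε⟩ | ⟨i, σ⟩ | ⟨i, σ, ε⟩ | ⟨i, ε⟩ | ⟨i, ε⟩ <;>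
    simp only [Et.ray, reduceCtorEq, Option.some.injEq] at he <;> subst he
  · have : rayPt (.Ta i σ ε) ε h = pt i σ ε 1 (1 + h) := by
      simp only [rayPt, pt, Et.en, posZ]; ext <;> simp; ring
    refine ⟨fun _ => ?_, by simp [Et.fk]⟩
    rw [this, st_ha i σ ε (by linarith), pair_comm]; rfl
  · have : rayPt (.Tt i ε) ε h = pt i true ε 0 (2 + h) := by
      simp only [rayPt, pt, Et.en, posZ]; ext <;> simp; ring
    refine ⟨fun _ => ?_, by simp [Et.fk]⟩
    rw [this, st_ht i true ε (by linarith), pair_comm]; rfl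
  · have : rayPt (.Tc i ε) ε h = pt i false ε 3 h := by
      simp only [rayPt, pt, Et.en, posZ]; ext <;> simp; ring
    refine ⟨by simp [Et.fk], ?_⟩
    intro x hx
    simp only [Et.fk, Option.some.injEq] at hx
    subst hx
    rw [this]
    rcases lt_trichotomy h 1 with h1 | h1 | h1
    · right; left; rw [st_cd i false ε h0 h1]; rfl
    · left; rw [h1, st_d i false ε]; rfl
    · right; right; rw [st_hd i false ε h1]; rfl

theorem lamZ_pos (u : Vt ℤ) (hu : ∀ ε, u ≠ .hub ε) : lamZ (posZ u) = {Sum.inl u} := by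
  rcases u with ε | ⟨i, σ, ε⟩ | ⟨i, σ⟩ | i | ⟨i, ε⟩
  · exact absurd rfl (hu ε)
  · rw [← st_a i σ ε]; congr 1; simp [pt, posZ]
  · rw [← st_x i σ true]; congr 1; simp [pt, posZ, mul_comm]
  · rw [show (Vt.c i) = Vt.c (cI i false) from rfl, ← st_c i false true]; congr 1; simp [pt, posZ, cI]; ring
  · rw [← st_t i true ε]; congr 1; simp [pt, posZ, mul_comm]

/-- Positions of the crossings in the strip. -/
def xposZ : Xt ℤ → ℝ × ℝ
  | .d i ε => (6 * i - 3, sg ε)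
  | .M i => (6 * i, 0)

theorem xpos_of (q : ℝ × ℝ) (x : Xt ℤ) (hx : Sum.inr x ∈ lamZ q) (hn : ∀ u, Sum.inl u ∉ lamZ q) : q = xposZ x := by
  obtain ⟨i, σ, ε, v, Y, hv0, hv3, hY, rfl⟩ := exists_pt q
  have key := fun p => star0_fold p i σ ε v Y hv0 hv3 hY
  simp only [lamZ, mem_ofPred_eq] at hx hn
  have h1 := hn (.hub ε)
  have h2 := hn (.a i σ ε)
  have h3 := hn (.c (cI i σ))
  rw [key] at hx h1 h2 h3
  simp only [reduceCtorEq, false_and, false_or, Sum.inr.injEq, or_false, true_and, Sum.inl.injEq, Vt.a.injEq] at hx h1 h2 h3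
  rcases hx with ⟨rfl, h4, h5⟩ | ⟨rfl, h4, h5⟩
  · have hv : v = 0 := by grind
    have hy : Y = 0 := by grind
    simp [hv, hy, pt, xposZ]
  · have hv : v = 3 := by grind
    have hy : Y = 1 := by grind
    cases σ <;> simp [hv, hy, pt, xposZ, cI] <;> ring

theorem strip_cover (q : ℝ × ℝ) :
    (∃ e ε, Et.ray e = some ε ∧ ∃ h, 0 ≤ h ∧ q = rayPt e ε h) ∨
    (∃ e, Et.ray e = none ∧ ∃ s ∈ Icc (0 : ℝ) 1, q = segPt e s) ∨ TriP (lamZ q) := by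
  obtain ⟨i, σ, ε, v, Y, hv0, hv3, hY, rfl⟩ := exists_pt q
  have tc : v = 3 → ∃ e ε', Et.ray e = some ε' ∧ ∃ h, 0 ≤ h ∧ pt i σ ε v Y = rayPt e ε' h := by
    rintro rfl
    refine ⟨.Tc (cI i σ) ε, ε, rfl, Y, hY, ?_⟩
    simp only [rayPt, pt, Et.en, posZ, cI]; cases σ <;> ext <;> simp <;> ring
  rcases hv3.eq_or_lt with h3 | h3
  · exact Or.inl (tc h3)
  rcases lt_trichotomy Y 1 with hY1 | hY1 | hY1
  · rcases lt_trichotomy v 1 with h1 | h1 | h1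
    · rcases lt_trichotomy v Y with h2 | h2 | h2
      · right; right; rw [st_mah i σ ε hv0 h2 hY1]; exact TriP.mah i σ ε
      · subst h2
        right; left
        refine ⟨.mm i (xor ε σ), rfl, (1 + sg σ * v) / 2, ?_, ?_⟩
        · cases σ <;> simp <;> constructor <;> linarith
        · simp only [segPt, pt, Et.en, posZ]; cases σ <;> cases ε <;> ext <;> simp <;> ring
      · right; right; rw [st_mav i σ ε hY h2 h1]; exact TriP.mav i σ ε
    · subst h1
      right; left
      refine ⟨.av i σ, rfl, (1 - sg ε * Y) / 2, ?_, ?_⟩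
      · cases ε <;> simp <;> constructor <;> linarith
      · simp only [segPt, pt, Et.en, posZ]; ext <;> simp; ring
    · rcases lt_trichotomy Y ((3 - v) / 2) with h2 | h2 | h2
      · rcases lt_trichotomy (v + Y) 2 with h4 | h4 | h4
        · right; right; rw [st_aax i σ ε hY h1 h4]; exact TriP.aax i σ ε
        · right; left
          refine ⟨.xa i σ ε, rfl, Y, ⟨hY, hY1.le⟩, ?_⟩
          have : v = 2 - Y := by linarith
          subst this
          simp only [segPt, pt, Et.en, posZ]; ext <;> simp <;> ring
        · rcases hY.eq_or_lt with h5 | h5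
          · right; left
            subst h5
            refine ⟨.xc i σ, rfl, v - 2, ⟨by linarith, by linarith⟩, ?_⟩
            simp only [segPt, pt, Et.en, posZ, cI]; cases σ <;> ext <;> simp <;> ring
          · right; right; rw [st_cax i σ ε h5 h2 h4]; exact TriP.cax i σ ε
      · right; left
        refine ⟨.ac i σ ε, rfl, (v - 1) / 2, ⟨by linarith, by linarith⟩, ?_⟩
        subst h2
        simp only [segPt, pt, Et.en, posZ, cI]; cases σ <;> ext <;> simp <;> ring
      · right; right; rw [st_cda i σ ε h3 hY1 h2]; exact TriP.cda i σ ε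
  · subst hY1
    right; left
    rcases le_total v 1 with h1 | h1
    · refine ⟨.aa i ε, rfl, (1 + sg σ * v) / 2, ?_, ?_⟩
      · cases σ <;> simp <;> constructor <;> linarith
      · simp only [segPt, pt, Et.en, posZ]; ext <;> simp; ring
    · refine ⟨.dd (cI i σ) ε, rfl, if σ then (5 - v) / 4 else (v - 1) / 4, ?_, ?_⟩
      · cases σ <;> simp <;> constructor <;> linarith
      · simp only [segPt, pt, Et.en, posZ, cI]; cases σ <;> ext <;> simp <;> ring
  · rcases lt_trichotomy v 1 with h1 | h1 | h1
    · rcases lt_trichotomy (v + Y) 2 with h2 | h2 | h2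
      · right; right; rw [st_aat i σ ε hv0 hY1 h2]; exact TriP.aat i σ ε
      · right; left
        refine ⟨.ta i σ ε, rfl, 1 - v, ⟨by linarith, by linarith⟩, ?_⟩
        have : Y = 2 - v := by linarith
        subst this
        simp only [segPt, pt, Et.en, posZ]; ext <;> simp <;> ring
      · rcases hv0.eq_or_lt with h5 | h5
        · left
          refine ⟨.Tt i ε, ε, rfl, Y - 2, by linarith, ?_⟩
          subst h5
          simp only [rayPt, pt, Et.en, posZ]; ext <;> simp; ring
        · right; right; rw [st_hat i σ ε h5 h1 h2]; exact TriP.hat i σ ε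
    · left
      refine ⟨.Ta i σ ε, ε, rfl, Y - 1, by linarith, ?_⟩
      subst h1
      simp only [rayPt, pt, Et.en, posZ]; ext <;> simp; ring
    · right; right; rw [st_had i σ ε h1 h3 hY1]; exact TriP.had i σ ε

/-- The lifts of the point at infinity. -/
theorem puncture_mem (k : ℤ) : (Sum.inl (.hub true) : Vt ℤ ⊕ Xt ℤ) ∈ lamZ (2 + 6 * k, 2) ∧
    Sum.inl (.a k true true) ∈ lamZ (2 + 6 * k, 2) ∧ Sum.inr (.d (k + 1) true) ∈ lamZ (2 + 6 * k, 2) := by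
  have h := st_had k true true (v := 2) (Y := 2) (by norm_num) (by norm_num) (by norm_num)
  have h2 : pt k true true 2 2 = (2 + 6 * (k : ℝ), 2) := by simp [pt]; ring
  rw [h2] at h
  rw [h]
  simp [cI]

theorem not_puncture_of_ok {e : Et ℤ} {q : ℝ × ℝ} (h : EdgeOK e (lamZ q)) (k : ℤ) : q ≠ (2 + 6 * (k : ℝ), 2) := by
  rintro rfl
  obtain ⟨h1, h2, h3⟩ := puncture_mem k
  obtain ⟨g1, g2⟩ := h
  cases hf : e.fk with
  | none => rw [g1 hf] at h3; simp at h3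
  | some x =>
    rcases g2 x hf with g | g | g <;> rw [g] at h1 h2 <;> simp at h1 h2
    all_goals rw [← h1] at h2; simp at h2

theorem not_puncture_pos (u : Vt ℤ) (hu : ∀ ε, u ≠ .hub ε) (k : ℤ) : posZ u ≠ (2 + 6 * (k : ℝ), 2) := by
  intro h
  have h1 := lamZ_pos u hu
  rw [h] at h1
  obtain ⟨h2, -, h3⟩ := puncture_mem k
  rw [h1] at h3
  simp at h3

/-! ### Change of index set -/

/-- Change of index set for vertices. -/
def Vt.map {ι κ : Type} (f : ι → κ) : Vt ι → Vt κ
  | .hub ε => .hub ε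
  | .a i σ ε => .a (f i) σ ε
  | .x i σ => .x (f i) σ
  | .c i => .c (f i)
  | .t i ε => .t (f i) ε

/-- Change of index set for crossings. -/
def Xt.map {ι κ : Type} (f : ι → κ) : Xt ι → Xt κ
  | .d i ε => .d (f i) ε
  | .M i => .M (f i)

/-- Change of index set for edges. -/
def Et.map {ι κ : Type} (f : ι → κ) : Et ι → Et κ
  | .Ta i σ ε => .Ta (f i) σ ε
  | .Tt i ε => .Tt (f i) ε
  | .Tc i ε => .Tc (f i) ε
  | .ta i σ ε => .ta (f i) σ ε
  | .aa i ε => .aa (f i) ε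
  | .av i σ => .av (f i) σ
  | .ac i σ ε => .ac (f i) σ ε
  | .xc i σ => .xc (f i) σ
  | .xa i σ ε => .xa (f i) σ ε
  | .dd i ε => .dd (f i) ε
  | .mm i ε => .mm (f i) ε

/-- Change of index set for cells. -/
def pm {ι κ : Type} (f : ι → κ) : Vt ι ⊕ Xt ι → Vt κ ⊕ Xt κ := Sum.map (Vt.map f) (Xt.map f)

/-- Maps of index sets compatible with the successor. -/
structure Nat1 {ι κ : Type} [Ring ι] [Ring κ] (f : ι → κ) : Prop where
  add : ∀ i, f (i + 1) = f i + 1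
  sub : ∀ i, f (i - 1) = f i - 1

section nat
variable {ι κ : Type} [Ring ι] [Ring κ] {f : ι → κ}

theorem Nat1.cI (hf : Nat1 f) (i : ι) (σ : Bool) : f (cI i σ) = _root_.cI (f i) σ := by
  cases σ <;> simp [_root_.cI, hf.add]

theorem en_map (hf : Nat1 f) (e : Et ι) : (e.map f).en = (e.en.1.map f, e.en.2.map f) := by
  cases e <;> simp [Et.map, Et.en, Vt.map, hf.cI, hf.sub]

theorem fk_map (e : Et ι) : (e.map f).fk = e.fk.map (Xt.map f) := by
  cases e <;> simp [Et.map, Et.fk, Xt.map]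

theorem ray_map (e : Et ι) : (e.map f).ray = e.ray := by
  cases e <;> simp [Et.map, Et.ray]

theorem ok_map (hf : Nat1 f) {e : Et ι} {L} (h : EdgeOK e L) : EdgeOK (e.map f) (pm f '' L) := by
  obtain ⟨h1, h2⟩ := h
  refine ⟨fun h => ?_, fun x hx => ?_⟩
  · rw [h1 (by simpa [fk_map] using h), en_map hf]; simp [image_pair, pm]
  · rw [fk_map] at hx
    obtain ⟨y, hy, rfl⟩ := Option.map_eq_some_iff.1 hx
    rw [en_map hf]
    rcases h2 y hy with h | h | h <;> rw [h] <;> simp [image_pair, pm]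

theorem tri_map (hf : Nat1 f) {L} (h : TriP L) : TriP (pm f '' L) := by
  cases h with
  | had i σ ε => simpa [image_insert_eq, pm, Vt.map, Xt.map, hf.cI] using TriP.had (f i) σ ε
  | hat i σ ε => simpa [image_insert_eq, pm, Vt.map, Xt.map, hf.cI] using TriP.hat (f i) σ ε
  | aat i σ ε => simpa [image_insert_eq, pm, Vt.map, Xt.map, hf.cI] using TriP.aat (f i) σ ε
  | cda i σ ε => simpa [image_insert_eq, pm, Vt.map, Xt.map, hf.cI] using TriP.cda (f i) σ ε
  | cax i σ ε => simpa [image_insert_eq, pm, Vt.map, Xt.map, hf.cI] using TriP.cax (f i) σ ε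
  | aax i σ ε => simpa [image_insert_eq, pm, Vt.map, Xt.map, hf.cI] using TriP.aax (f i) σ ε
  | mav i σ ε => simpa [image_insert_eq, pm, Vt.map, Xt.map, hf.cI] using TriP.mav (f i) σ ε
  | mah i σ ε => simpa [image_insert_eq, pm, Vt.map, Xt.map, hf.cI] using TriP.mah (f i) σ ε

end nat

theorem nat1_shift (k : ℤ) : Nat1 (fun i : ℤ => i + k) := ⟨fun i => by ring, fun i => by ring⟩
theorem nat1_cast (m : ℕ) : Nat1 (fun i : ℤ => (i : ZMod m)) := ⟨fun i => by simp, fun i => by simp⟩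

theorem star0_shift (k : ℤ) (p : Vt ℤ ⊕ Xt ℤ) (q : ℝ × ℝ) (h : star0 p q) :
    star0 (pm (fun i : ℤ => i + k) p) (q.1 + 6 * k, q.2) := by
  rcases p with (ε | ⟨i, σ, ε⟩ | ⟨i, σ⟩ | i | ⟨i, ε⟩) | (⟨i, ε⟩ | i) <;>
    simp only [pm, Sum.map_inl, Sum.map_inr, Vt.map, Xt.map, star0] at h ⊢
  · rcases h with h | ⟨j, h⟩
    · exact Or.inl h
    · refine Or.inr ⟨j + k, ?_⟩
      push_cast
      rw [show q.1 + 6 * (k : ℝ) - 6 * (j + k) = q.1 - 6 * j by ring,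
        show 6 * ((j : ℝ) + k) + 6 - (q.1 + 6 * k) = 6 * j + 6 - q.1 by ring]
      exact h
  all_goals
    push_cast
    first
    | rw [show q.1 + 6 * (k : ℝ) - 6 * (i + k) = q.1 - 6 * i by ring]
      exact h
    | rw [show q.1 + 6 * (k : ℝ) - (6 * (i + k) - 3) = q.1 - (6 * i - 3) by ring]
      exact h

theorem lamZ_shift (k : ℤ) (q : ℝ × ℝ) :
    lamZ (q.1 + 6 * k, q.2) = pm (fun i : ℤ => i + k) '' lamZ q := by
  ext p
  constructor
  · intro h
    have h' := star0_shift (-k) p _ h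
    refine ⟨pm (fun i : ℤ => i + -k) p, ?_, ?_⟩
    rotate_left
    · rcases p with (ε | ⟨i, σ, ε⟩ | ⟨i, σ⟩ | i | ⟨i, ε⟩) | (⟨i, ε⟩ | i) <;> simp [pm, Vt.map, Xt.map]
    · have : (q.1 + 6 * (k : ℝ) + 6 * ((-k : ℤ) : ℝ), q.2) = q := by ext <;> simp
      rw [this] at h'
      exact h'
  · rintro ⟨p', hp', rfl⟩
    exact star0_shift k p' q hp'

theorem pm_pm {ι κ μ : Type} (f : ι → κ) (g : κ → μ) (p) : pm g (pm f p) = pm (fun i => g (f i)) p := by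
  rcases p with (ε | ⟨i, σ, ε⟩ | ⟨i, σ⟩ | i | ⟨i, ε⟩) | (⟨i, ε⟩ | i) <;> rfl

theorem posZ_shift (k : ℤ) (u : Vt ℤ) (hu : ∀ ε, u ≠ .hub ε) :
    posZ (u.map fun i => i + k) = ((posZ u).1 + 6 * k, (posZ u).2) := by
  rcases u with ε | ⟨i, σ, ε⟩ | ⟨i, σ⟩ | i | ⟨i, ε⟩
  · exact absurd rfl (hu ε)
  all_goals ext <;> simp [posZ, Vt.map] ; try ring

theorem xposZ_shift (k : ℤ) (u : Xt ℤ) :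
    xposZ (u.map fun i => i + k) = ((xposZ u).1 + 6 * k, (xposZ u).2) := by
  rcases u with ⟨i, ε⟩ | i
  all_goals ext <;> simp [xposZ, Xt.map] ; try ring

theorem en_not_hub {ι : Type} [Ring ι] (e : Et ι) (ε : Bool) : e.en.1 ≠ .hub ε := by
  cases e <;> simp [Et.en]

theorem en_not_hub' {ι : Type} [Ring ι] (e : Et ι) (he : e.ray = none) (ε : Bool) : e.en.2 ≠ .hub ε := by
  cases e <;> simp [Et.en, Et.ray] at he ⊢

theorem en_hub {ι : Type} [Ring ι] (e : Et ι) (ε : Bool) (he : e.ray = some ε) : e.en.2 = .hub ε := by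
  cases e <;> simp [Et.en, Et.ray] at he ⊢ <;> exact he

theorem map_ne_hub {ι κ : Type} (f : ι → κ) {u : Vt ι} (hu : ∀ ε, u ≠ .hub ε) (ε : Bool) : u.map f ≠ .hub ε := by
  cases u <;> simp [Vt.map] at hu ⊢

theorem segPt_shift (k : ℤ) (e : Et ℤ) (he : e.ray = none) (s : ℝ) :
    segPt (e.map fun i => i + k) s = ((segPt e s).1 + 6 * k, (segPt e s).2) := by
  simp only [segPt, en_map (nat1_shift k), posZ_shift k _ (en_not_hub e), posZ_shift k _ (en_not_hub' e he)]
  ext <;> simp; ring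

theorem rayPt_shift (k : ℤ) (e : Et ℤ) (ε : Bool) (s : ℝ) :
    rayPt (e.map fun i => i + k) ε s = ((rayPt e ε s).1 + 6 * k, (rayPt e ε s).2) := by
  simp only [rayPt, en_map (nat1_shift k), posZ_shift k _ (en_not_hub e)]

/-- An edge determines a shift for each map with given residue. -/
theorem Et.map_eq_shift (g : ℤ → ℤ) (m : ℤ) (hg : ∀ i, m ∣ g i - i) (e : Et ℤ) :
    ∃ k : ℤ, e.map g = e.map (fun i => i + m * k) := by
  cases e with
  | Ta i _ _ | Tt i _ | Tc i _ | ta i _ _ | aa i _ | av i _ | ac i _ _ | xc i _ | xa i _ _ | dd i _ | mm i _ =>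
    obtain ⟨k, hk⟩ := hg i
    exact ⟨k, by simp [Et.map, ← hk]⟩

theorem cast_shift {m : ℕ} {i j : ℤ} (h : (i : ZMod m) = j) : ∃ k : ℤ, j = i + m * k := by
  rw [ZMod.intCast_eq_intCast_iff_dvd_sub] at h
  obtain ⟨k, hk⟩ := h
  exact ⟨k, by omega⟩

theorem Vt.eq_shift (m : ℕ) (u u' : Vt ℤ) (hu : ∀ ε, u ≠ .hub ε)
    (h : u.map (fun i : ℤ => (i : ZMod m)) = u'.map (fun i : ℤ => (i : ZMod m))) :
    ∃ k : ℤ, u' = u.map (fun i => i + m * k) := by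
  cases u <;> cases u' <;> simp [Vt.map] at h hu ⊢
  · obtain ⟨h, rfl, rfl⟩ := h; simpa using cast_shift h
  · obtain ⟨h, rfl⟩ := h; simpa using cast_shift h
  · exact cast_shift h
  · obtain ⟨h, rfl⟩ := h; simpa using cast_shift h

theorem Xt.eq_shift (m : ℕ) (u u' : Xt ℤ)
    (h : u.map (fun i : ℤ => (i : ZMod m)) = u'.map (fun i : ℤ => (i : ZMod m))) :
    ∃ k : ℤ, u' = u.map (fun i => i + m * k) := by
  cases u <;> cases u' <;> simp [Xt.map] at h ⊢
  · obtain ⟨h, rfl⟩ := h; simpa using cast_shift h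
  · exact cast_shift h

/-- The involution exchanging `1` and infinity. -/
noncomputable def psi (w : ℂ) : ℂ := w / (w - 1)

theorem psi_psi {w : ℂ} (hw : w ≠ 1) : psi (psi w) = w := by
  have h : w - 1 ≠ 0 := sub_ne_zero.2 hw
  unfold psi
  have h2 : w / (w - 1) - 1 = 1 / (w - 1) := by field_simp; ring
  rw [h2]
  field_simp

theorem psi_ne_one {w : ℂ} (hw : w ≠ 1) : psi w ≠ 1 := by
  have h : w - 1 ≠ 0 := sub_ne_zero.2 hw
  unfold psi
  intro h2
  rw [div_eq_one_iff_eq h] at h2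
  have : (0 : ℂ) = 1 := by linear_combination -h2
  exact zero_ne_one this

theorem psi_zero : psi 0 = 0 := by simp [psi]
theorem psi_one : psi 1 = 0 := by simp [psi]

theorem psi_ne_zero {w : ℂ} (h0 : w ≠ 0) (hw : w ≠ 1) : psi w ≠ 0 :=
  div_ne_zero h0 (sub_ne_zero.2 hw)

theorem psi_inj {w w' : ℂ} (hw : w ≠ 1) (hw' : w' ≠ 1) (h : psi w = psi w') : w = w' := by
  rw [← psi_psi hw, h, psi_psi hw']

section plane
variable (m : ℕ) [hm : NeZero m]

/-- The scale of the strip. -/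
noncomputable def kap : ℝ := Real.pi / (3 * m)

theorem kap_pos : 0 < kap m := by
  have : (0 : ℝ) < m := by exact_mod_cast hm.pos
  unfold kap
  positivity

/-- The universal covering of the punctured plane. -/
noncomputable def W (q : ℝ × ℝ) : ℂ := Complex.exp (kap m * (Complex.I * ((q.1 : ℂ) - 2) - ((q.2 : ℂ) - 2)))

theorem W_ne_zero (q) : W m q ≠ 0 := Complex.exp_ne_zero _

theorem W_eq_iff (q q' : ℝ × ℝ) : W m q = W m q' ↔ ∃ k : ℤ, q' = (q.1 + 6 * (m * k : ℤ), q.2) := by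
  have hk := kap_pos m
  have hm0 : (m : ℝ) ≠ 0 := by exact_mod_cast hm.ne
  unfold W
  have h2 : kap m * (6 * m) = 2 * Real.pi := by
    unfold kap; field_simp; ring
  rw [eq_comm, Complex.exp_eq_exp_iff_exists_int]
  constructor
  · rintro ⟨n, hn⟩
    refine ⟨n, ?_⟩
    have hr := congrArg Complex.re hn
    have hi := congrArg Complex.im hn
    simp at hr hi
    have hi' : kap m * (q'.1 - (q.1 + 6 * (m * n))) = 0 := by linear_combination hi + n * -h2
    have hr' : q'.2 = q.2 := hr.resolve_right hk.ne'
    rw [mul_eq_zero, or_iff_right hk.ne'] at hi'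
    ext
    · push_cast; linarith
    · push_cast; linarith
  · rintro ⟨n, rfl⟩
    refine ⟨n, ?_⟩
    have h2' : (kap m : ℂ) * (6 * m) = 2 * Real.pi := by exact_mod_cast h2
    push_cast
    linear_combination (Complex.I * n) * h2'

theorem W_shift (q : ℝ × ℝ) (k : ℤ) : W m (q.1 + 6 * (m * k : ℤ), q.2) = W m q :=
  ((W_eq_iff m _ _).2 ⟨k, rfl⟩).symm

theorem W_eq_one {q : ℝ × ℝ} (h : W m q = 1) : ∃ k : ℤ, q = (2 + 6 * (k : ℝ), 2) := by
  have h1 : W m (2, 2) = 1 := by simp [W]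
  rw [← h1, eq_comm, W_eq_iff] at h
  obtain ⟨k, rfl⟩ := h
  exact ⟨m * k, rfl⟩

theorem W_surj {w : ℂ} (hw : w ≠ 0) : ∃ q, W m q = w := by
  have hk : (kap m : ℂ) ≠ 0 := by exact_mod_cast (kap_pos m).ne'
  refine ⟨(2 + (Complex.log w).im / kap m, 2 - (Complex.log w).re / kap m), ?_⟩
  rw [W]
  conv_rhs => rw [← Complex.exp_log hw, ← Complex.re_add_im (Complex.log w)]
  congr 1
  push_cast
  field_simp
  ring

theorem W_norm (q : ℝ × ℝ) : ‖W m q‖ = Real.exp (-(kap m * (q.2 - 2))) := by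
  rw [W, Complex.norm_exp]
  congr 1
  simp
  ring

theorem W_cont : Continuous (W m) := by
  unfold W
  fun_prop

theorem W_open : IsOpenMap (W m) := by
  have hk : kap m ≠ 0 := (kap_pos m).ne'
  have h1 : IsOpenMap (fun q : ℝ × ℝ => (kap m * (Complex.I * ((q.1 : ℂ) - 2) - ((q.2 : ℂ) - 2)) : ℂ)) := by
    apply IsOpenMap.of_inverse (f' := fun z : ℂ => (2 + z.im / kap m, 2 - z.re / kap m))
    · fun_prop
    · intro z
      apply Complex.ext <;> simp <;> field_simp
    · rintro ⟨x, y⟩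
      ext <;> simp <;> field_simp <;> ring
  exact Complex.isOpenMap_exp.comp h1

/-- The reduction of indices modulo `m`. -/
def red : Vt ℤ ⊕ Xt ℤ → Vt (ZMod m) ⊕ Xt (ZMod m) := pm (fun i : ℤ => (i : ZMod m))

/-- Stars in the strip, indexed modulo `m`. -/
def Ust (p : Vt (ZMod m) ⊕ Xt (ZMod m)) : Set (ℝ × ℝ) := {q | p ∈ red m '' lamZ q}

theorem Ust_open (p) : IsOpen (Ust m p) := by
  have : Ust m p = ⋃ p' : Vt ℤ ⊕ Xt ℤ, ⋃ _ : red m p' = p, {q | star0 p' q} := by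
    ext q
    simp only [Ust, lamZ, mem_ofPred_eq, mem_image, mem_iUnion, exists_prop]
    constructor
    · rintro ⟨p', h1, h2⟩; exact ⟨p', h2, h1⟩
    · rintro ⟨p', h1, h2⟩; exact ⟨p', h2, h1⟩
  rw [this]
  exact isOpen_iUnion fun p' => isOpen_iUnion fun _ => star0_open p'

theorem red_shift (q : ℝ × ℝ) (k : ℤ) : red m '' lamZ (q.1 + 6 * (m * k : ℤ), q.2) = red m '' lamZ q := by
  rw [lamZ_shift, image_image]
  simp only [red, pm_pm]
  congr! 3
  simp

theorem W_mem (q : ℝ × ℝ) (p) : W m q ∈ W m '' Ust m p ↔ p ∈ red m '' lamZ q := by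
  constructor
  · rintro ⟨q', hq', h⟩
    rw [W_eq_iff] at h
    obtain ⟨k, rfl⟩ := h
    rw [red_shift]
    exact hq'
  · intro h
    exact ⟨q, h, rfl⟩

/-- The cell of a point of the plane. -/
def lamC (z : ℂ) : Set (Vt (ZMod m) ⊕ Xt (ZMod m)) :=
  {p | psi z ∈ W m '' Ust m p ∨ (p = Sum.inl (.hub true) ∧ z = 0) ∨ (p = Sum.inl (.hub false) ∧ z = 1)}

/-- The map from the strip to the plane. -/
noncomputable def Phi (q : ℝ × ℝ) : ℂ := psi (W m q)

theorem lamC_Phi {q : ℝ × ℝ} (h1 : W m q ≠ 1) : lamC m (Phi m q) = red m '' lamZ q := by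
  ext p
  have h2 : Phi m q ≠ 0 := psi_ne_zero (W_ne_zero m q) h1
  have h3 : Phi m q ≠ 1 := psi_ne_one h1
  simp only [lamC, mem_ofPred_eq, h2, h3, and_false, or_false]
  rw [Phi, psi_psi h1, W_mem]

theorem zero_notMem (S) : (0 : ℂ) ∉ W m '' S := by
  rintro ⟨q, -, h⟩
  exact W_ne_zero m q h

theorem lamC_zero : lamC m 0 = {Sum.inl (.hub true)} := by
  ext p
  simp [lamC, psi_zero, zero_notMem, -mem_image]

theorem lamC_one : lamC m 1 = {Sum.inl (.hub false)} := by
  ext p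
  simp [lamC, psi_one, zero_notMem, -mem_image]

theorem lamC_cover (z : ℂ) : z = 0 ∨ z = 1 ∨ ∃ q, W m q ≠ 1 ∧ z = Phi m q := by
  by_cases h0 : z = 0
  · exact Or.inl h0
  by_cases h1 : z = 1
  · exact Or.inr (Or.inl h1)
  right; right
  obtain ⟨q, hq⟩ := W_surj m (psi_ne_zero h0 h1)
  have h2 : z = Phi m q := by rw [Phi, hq, psi_psi h1]
  exact ⟨q, fun h3 => psi_ne_one h1 (h3 ▸ hq.symm), h2⟩

theorem lamC_open (p) : IsOpen {z | p ∈ lamC m z} := by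
  have hA : IsOpen {z | psi z ∈ W m '' Ust m p} := by
    have hc : ContinuousOn psi {z | z ≠ 1} := by
      unfold psi
      exact continuousOn_id.div (by fun_prop) fun z hz => sub_ne_zero.2 hz
    have := hc.isOpen_inter_preimage isOpen_ne ((W_open m) _ (Ust_open m p))
    convert this using 1
    ext z
    constructor
    · intro h
      refine ⟨?_, h⟩
      rintro rfl
      rw [mem_ofPred_eq, psi_one] at h
      exact zero_notMem m _ h
    · exact fun h => h.2
  have hk := kap_pos m
  by_cases h1 : p = Sum.inl (.hub true)
  · subst h1
    have : {z | Sum.inl (.hub true) ∈ lamC m z} =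
        {z | psi z ∈ W m '' Ust m (Sum.inl (.hub true))} ∪ {z | ‖z‖ < ‖z - 1‖} := by
      ext z
      simp only [lamC, mem_union, mem_ofPred_eq]
      constructor
      · rintro (h | ⟨-, rfl⟩ | ⟨h, -⟩)
        · exact Or.inl h
        · right; simp
        · simp at h
      · rintro (h | h)
        · exact Or.inl h
        · by_cases hz : z = 0
          · exact Or.inr (Or.inl ⟨trivial, hz⟩)
          left
          have hz1 : z ≠ 1 := by rintro rfl; simp at h; linarith
          obtain ⟨q, hq⟩ := W_surj m (psi_ne_zero hz hz1)
          refine ⟨q, ?_, hq⟩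
          have hn : ‖psi z‖ < 1 := by
            rw [psi, norm_div, div_lt_one (norm_pos_iff.2 (sub_ne_zero.2 hz1))]; exact h
          rw [← hq, W_norm, Real.exp_lt_one_iff] at hn
          refine ⟨Sum.inl (.hub true), ?_, rfl⟩
          left
          simp
          nlinarith
    rw [this]
    exact hA.union (isOpen_lt (by fun_prop) (by fun_prop))
  by_cases h2 : p = Sum.inl (.hub false)
  · subst h2
    have : {z | Sum.inl (.hub false) ∈ lamC m z} =
        {z | psi z ∈ W m '' Ust m (Sum.inl (.hub false))} ∪ {z | Real.exp (kap m * 4) * ‖z - 1‖ < ‖z‖} := by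
      ext z
      simp only [lamC, mem_union, mem_ofPred_eq]
      constructor
      · rintro (h | ⟨h, -⟩ | ⟨-, rfl⟩)
        · exact Or.inl h
        · simp at h
        · right; simp
      · rintro (h | h)
        · exact Or.inl h
        · by_cases hz1 : z = 1
          · exact Or.inr (Or.inr ⟨trivial, hz1⟩)
          left
          have hz : z ≠ 0 := by
            rintro rfl
            simp at h
            linarith [Real.exp_pos (kap m * 4)]
          obtain ⟨q, hq⟩ := W_surj m (psi_ne_zero hz hz1)
          refine ⟨q, ?_, hq⟩
          have hn : Real.exp (kap m * 4) < ‖psi z‖ := by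
            rw [psi, norm_div, lt_div_iff₀ (norm_pos_iff.2 (sub_ne_zero.2 hz1))]; exact h
          rw [← hq, W_norm, Real.exp_lt_exp] at hn
          refine ⟨Sum.inl (.hub false), ?_, rfl⟩
          left
          simp
          nlinarith
    rw [this]
    exact hA.union (isOpen_lt (by fun_prop) (by fun_prop))
  · convert hA using 3 with z
    simp [lamC, h1, h2]

end plane

section plane
variable (m : ℕ) [hm : NeZero m]

/-- Vertex positions. -/
noncomputable def posC : Vt ℤ → ℂ
  | .hub true => 0
  | .hub false => 1
  | u => Phi m (posZ u)

theorem posC_eq {u : Vt ℤ} (hu : ∀ ε, u ≠ .hub ε) : posC m u = Phi m (posZ u) := by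
  cases u with
  | hub ε => exact absurd rfl (hu ε)
  | _ => rfl

/-- Edge arcs. -/
noncomputable def arcC (e : Et ℤ) (s : ℝ) : ℂ :=
  match e.ray with
  | none => Phi m (segPt e s)
  | some true => psi (W m (posZ e.en.1) * (1 - s))
  | some false => W m (posZ e.en.1) / (W m (posZ e.en.1) - (1 - s))

theorem arcC_seg {e : Et ℤ} (he : e.ray = none) (s : ℝ) : arcC m e s = Phi m (segPt e s) := by
  simp [arcC, he]

theorem W_ray (e : Et ℤ) (ε : Bool) (h : ℝ) :
    W m (rayPt e ε h) = W m (posZ e.en.1) * Complex.exp (-(kap m * (sg ε * h))) := by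
  rw [W, W, ← Complex.exp_add]
  congr 1
  simp [rayPt]
  ring

theorem arcC_ray {e : Et ℤ} {ε : Bool} (he : e.ray = some ε) {h : ℝ} {s : ℝ} (hs : Real.exp (-(kap m * h)) = 1 - s) :
    arcC m e s = Phi m (rayPt e ε h) := by
  have hs' : Complex.exp (-(kap m * h)) = 1 - s := by exact_mod_cast congrArg (fun x : ℝ => (x : ℂ)) hs
  have h0 : (1 - s : ℂ) ≠ 0 := by rw [← hs']; exact Complex.exp_ne_zero _
  rw [Phi, W_ray]
  cases ε
  · simp only [arcC, he, sg_false]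
    have : Complex.exp (-(kap m * (((-1 : ℝ) : ℂ) * h))) = (1 - s : ℂ)⁻¹ := by
      rw [← hs', ← Complex.exp_neg]; congr 1; push_cast; ring
    rw [this, psi]
    have h2 : W m (posZ e.en.1) * (1 - (s : ℂ))⁻¹ - 1 = (W m (posZ e.en.1) - (1 - s)) * (1 - (s : ℂ))⁻¹ := by
      field_simp
    rw [h2, mul_div_mul_right _ _ (inv_ne_zero h0)]
  · simp only [arcC, he, sg_true, Complex.ofReal_one, one_mul, hs']

theorem exists_h {s : ℝ} (hs : s < 1) : ∃ h : ℝ, Real.exp (-(kap m * h)) = 1 - s ∧ (0 < s → 0 < h) := by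
  have hk := kap_pos m
  have hs1 : 0 < 1 - s := by linarith
  refine ⟨-Real.log (1 - s) / kap m, ?_, fun h => ?_⟩
  · rw [show -(kap m * (-Real.log (1 - s) / kap m)) = Real.log (1 - s) by field_simp, Real.exp_log hs1]
  · have := Real.log_neg hs1 (by linarith)
    apply div_pos (by linarith) hk

theorem W_ne_one_of_ok {e : Et ℤ} {q : ℝ × ℝ} (h : EdgeOK e (lamZ q)) : W m q ≠ 1 := fun h1 => by
  obtain ⟨k, hk⟩ := W_eq_one m h1
  exact not_puncture_of_ok h k hk

theorem W_ne_one_pos {u : Vt ℤ} (hu : ∀ ε, u ≠ .hub ε) : W m (posZ u) ≠ 1 := fun h1 => by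
  obtain ⟨k, hk⟩ := W_eq_one m h1
  exact not_puncture_pos u hu k hk

theorem arcC_zero (e : Et ℤ) : arcC m e 0 = posC m e.en.1 := by
  rw [posC_eq m (en_not_hub e)]
  cases he : e.ray with
  | none => rw [arcC_seg m he]; simp [segPt]
  | some ε =>
    rw [arcC_ray m he (h := 0) (by simp)]
    simp [rayPt]

theorem arcC_one (e : Et ℤ) : arcC m e 1 = posC m e.en.2 := by
  cases he : e.ray with
  | none =>
    rw [posC_eq m (en_not_hub' e he), arcC_seg m he]; simp [segPt]
  | some ε =>
    rw [en_hub e ε he]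
    cases ε
    · simp [arcC, he, posC, W_ne_zero]
    · simp [arcC, he, posC, psi_zero]

theorem lamC_posC (u : Vt ℤ) : lamC m (posC m u) = {Sum.inl (u.map fun i : ℤ => (i : ZMod m))} := by
  by_cases hu : ∀ ε, u ≠ .hub ε
  · rw [posC_eq m hu, lamC_Phi m (W_ne_one_pos m hu), lamZ_pos u hu]
    simp [red, pm]
  · push Not at hu
    obtain ⟨ε, rfl⟩ := hu
    cases ε
    · exact lamC_one m
    · exact lamC_zero m

theorem lamC_arc (e : Et ℤ) {s : ℝ} (hs : s ∈ Ioo (0 : ℝ) 1) :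
    EdgeOK (e.map fun i : ℤ => (i : ZMod m)) (lamC m (arcC m e s)) := by
  cases he : e.ray with
  | none =>
    have h := seg_ok e he s hs
    rw [arcC_seg m he, lamC_Phi m (W_ne_one_of_ok m h)]
    exact ok_map (nat1_cast m) h
  | some ε =>
    obtain ⟨h, h1, h2⟩ := exists_h m hs.2
    have hk := ray_ok e ε he h (h2 hs.1)
    rw [arcC_ray m he h1, lamC_Phi m (W_ne_one_of_ok m hk)]
    exact ok_map (nat1_cast m) hk

theorem seg_ne_one {e : Et ℤ} (he : e.ray = none) {s : ℝ} (hs : s ∈ Icc (0 : ℝ) 1) : W m (segPt e s) ≠ 1 := by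
  rcases hs.1.eq_or_lt with h0 | h0
  · have : segPt e s = posZ e.en.1 := by simp [segPt, ← h0]
    rw [this]; exact W_ne_one_pos m (en_not_hub e)
  rcases hs.2.eq_or_lt with h1 | h1
  · have : segPt e s = posZ e.en.2 := by simp [segPt, h1]
    rw [this]; exact W_ne_one_pos m (en_not_hub' e he)
  exact W_ne_one_of_ok m (seg_ok e he s ⟨h0, h1⟩)

theorem ray_ne_one {e : Et ℤ} {ε : Bool} (he : e.ray = some ε) {s : ℝ} (h0 : 0 ≤ s) (h1 : s < 1) :
    ∃ h, Real.exp (-(kap m * h)) = 1 - s ∧ W m (rayPt e ε h) ≠ 1 := by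
  rcases h0.eq_or_lt with h0 | h0
  · subst h0
    refine ⟨0, by simp, ?_⟩
    have : rayPt e ε 0 = posZ e.en.1 := by simp [rayPt]
    rw [this]; exact W_ne_one_pos m (en_not_hub e)
  · obtain ⟨h, h2, h3⟩ := exists_h m h1
    exact ⟨h, h2, W_ne_one_of_ok m (ray_ok e ε he h (h3 h0))⟩

theorem ray_true_ne {e : Et ℤ} (he : e.ray = some true) {s : ℝ} (hs : s ∈ Icc (0 : ℝ) 1) :
    W m (posZ e.en.1) * (1 - s) ≠ 1 := by
  rcases hs.2.eq_or_lt with h1 | h1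
  · simp [h1]
  obtain ⟨h, h2, h3⟩ := ray_ne_one m he hs.1 h1
  rw [W_ray] at h3
  have hs' : Complex.exp (-(kap m * h)) = 1 - s := by exact_mod_cast congrArg (fun x : ℝ => (x : ℂ)) h2
  simpa [hs'] using h3

theorem ray_false_ne {e : Et ℤ} (he : e.ray = some false) {s : ℝ} (hs : s ∈ Icc (0 : ℝ) 1) :
    W m (posZ e.en.1) - (1 - s) ≠ 0 := by
  rcases hs.2.eq_or_lt with h1 | h1
  · simp [h1, W_ne_zero]
  obtain ⟨h, h2, h3⟩ := ray_ne_one m he hs.1 h1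
  rw [W_ray] at h3
  have hs' : Complex.exp (-(kap m * h)) = 1 - s := by exact_mod_cast congrArg (fun x : ℝ => (x : ℂ)) h2
  intro h4
  apply h3
  rw [sub_eq_zero] at h4
  rw [h4, ← hs', ← Complex.exp_add]
  simp

theorem arcC_cont (e : Et ℤ) : ContinuousOn (arcC m e) (Icc 0 1) := by
  cases he : e.ray with
  | none =>
    have h1 : ContinuousOn (fun s => psi (W m (segPt e s))) (Icc 0 1) := by
      unfold psi
      have : Continuous fun s => W m (segPt e s) := (W_cont m).comp (by unfold segPt; fun_prop)
      exact this.continuousOn.div (this.sub continuous_const).continuousOn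
        fun s hs => sub_ne_zero.2 (seg_ne_one m he hs)
    exact h1.congr fun s _ => arcC_seg m he s
  | some ε =>
    cases ε
    · have h1 : ContinuousOn (fun s : ℝ => W m (posZ e.en.1) / (W m (posZ e.en.1) - (1 - s))) (Icc 0 1) :=
        continuousOn_const.div (by fun_prop) fun s hs => ray_false_ne m he hs
      exact h1.congr fun s _ => by simp [arcC, he]
    · have h1 : ContinuousOn (fun s : ℝ => psi (W m (posZ e.en.1) * (1 - s))) (Icc 0 1) := by
        unfold psi
        exact ContinuousOn.div (by fun_prop) (by fun_prop) fun s hs => sub_ne_zero.2 (ray_true_ne m he hs)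
      exact h1.congr fun s _ => by simp [arcC, he]

theorem en_ne_Z (e : Et ℤ) : e.en.1 ≠ e.en.2 := by
  cases e <;> simp [Et.en]

theorem span_le (e : Et ℤ) (he : e.ray = none) : |(posZ e.en.2).1 - (posZ e.en.1).1| ≤ 4 := by
  rw [abs_le]
  rcases e with ⟨i, σ, ε⟩ | ⟨i, ε⟩ | ⟨i, ε⟩ | ⟨i, σ, ε⟩ | ⟨i, ε⟩ | ⟨i, σ⟩ | ⟨i, σ, ε⟩ | ⟨i, σ⟩ | ⟨i, σ, ε⟩ | ⟨i, ε⟩ | ⟨i, ε⟩ <;>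
    simp only [Et.ray, reduceCtorEq] at he <;> (try cases σ) <;> simp [Et.en, posZ, cI] <;>
    (try constructor) <;> linarith

theorem arcC_inj (e : Et ℤ) : InjOn (arcC m e) (Icc 0 1) := by
  intro s hs s' hs' h
  cases he : e.ray with
  | none =>
    rw [arcC_seg m he, arcC_seg m he] at h
    have hw := psi_inj (seg_ne_one m he hs) (seg_ne_one m he hs') h
    rw [W_eq_iff] at hw
    obtain ⟨k, hk⟩ := hw
    have hx := congrArg Prod.fst hk
    have hy := congrArg Prod.snd hk
    simp only [segPt] at hx hy
    have hsp := span_le e he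
    have hd : |s' - s| ≤ 1 := by rw [abs_le]; constructor <;> linarith [hs.1, hs.2, hs'.1, hs'.2]
    have hk0 : (m * k : ℤ) = 0 := by
      have h1 : (6 * (m * k : ℤ) : ℝ) = (s' - s) * ((posZ e.en.2).1 - (posZ e.en.1).1) := by linarith
      have h2 : |(6 * (m * k : ℤ) : ℝ)| ≤ 4 := by
        rw [h1, abs_mul]
        calc _ ≤ 1 * 4 := mul_le_mul hd hsp (abs_nonneg _) zero_le_one
          _ = 4 := by norm_num
      rw [abs_le] at h2
      have h3 : (-1 : ℝ) < ((m * k : ℤ) : ℝ) := by linarith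
      have h4 : ((m * k : ℤ) : ℝ) < 1 := by linarith
      have h3' : -1 < (m * k : ℤ) := by exact_mod_cast h3
      have h4' : (m * k : ℤ) < 1 := by exact_mod_cast h4
      omega
    rw [hk0] at hx
    by_contra hne
    have hss : s' - s ≠ 0 := fun h => hne (by linarith)
    have hx' : (posZ e.en.1).1 = (posZ e.en.2).1 := by
      have : (s' - s) * ((posZ e.en.2).1 - (posZ e.en.1).1) = 0 := by push_cast at hx; linarith
      rcases mul_eq_zero.1 this with h | h
      · exact absurd h hss
      · linarith
    have hy' : (posZ e.en.1).2 = (posZ e.en.2).2 := by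
      have : (s' - s) * ((posZ e.en.2).2 - (posZ e.en.1).2) = 0 := by linarith
      rcases mul_eq_zero.1 this with h | h
      · exact absurd h hss
      · linarith
    have h1 := lamZ_pos _ (en_not_hub e)
    rw [Prod.ext hx' hy', lamZ_pos _ (en_not_hub' e he)] at h1
    exact en_ne_Z e (by simpa using h1.symm)
  | some ε =>
    have h0 := W_ne_zero m (posZ e.en.1)
    cases ε
    · simp only [arcC, he] at h
      rw [div_eq_div_iff (ray_false_ne m he hs) (ray_false_ne m he hs'), mul_right_inj' h0] at h
      simpa using h.symm
    · simp only [arcC, he] at h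
      have := psi_inj (ray_true_ne m he hs) (ray_true_ne m he hs') h
      rw [mul_right_inj' h0] at this
      simpa using this

theorem Phi_shift (q : ℝ × ℝ) (k : ℤ) : Phi m (q.1 + 6 * (m * k : ℤ), q.2) = Phi m q := by
  rw [Phi, W_shift, Phi]

theorem arcC_shift (e : Et ℤ) (k : ℤ) (s : ℝ) : arcC m (e.map fun i => i + m * k) s = arcC m e s := by
  have hp : W m (posZ (e.map fun i => i + m * k).en.1) = W m (posZ e.en.1) := by
    rw [en_map (nat1_shift (m * k)), posZ_shift _ _ (en_not_hub e), W_shift]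
  cases he : e.ray with
  | none => rw [arcC_seg m (by rw [ray_map, he]), arcC_seg m he, segPt_shift _ _ he, Phi_shift]
  | some ε =>
    cases ε
    · simp only [arcC, ray_map, he, hp]
    · simp only [arcC, ray_map, he, hp]

theorem posC_shift (u : Vt ℤ) (k : ℤ) : posC m (u.map fun i => i + m * k) = posC m u := by
  by_cases hu : ∀ ε, u ≠ .hub ε
  · rw [posC_eq m hu, posC_eq m (map_ne_hub _ hu), posZ_shift _ _ hu, Phi_shift]
  · push Not at hu
    obtain ⟨ε, rfl⟩ := hu
    rfl

/-- The reduction of vertices. -/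
def vr : Vt ℤ → Vt (ZMod m) := Vt.map fun i : ℤ => (i : ZMod m)

theorem posC_congr {u u' : Vt ℤ} (h : vr m u = vr m u') : posC m u = posC m u' := by
  by_cases hu : ∀ ε, u ≠ .hub ε
  · obtain ⟨k, rfl⟩ := Vt.eq_shift m u u' hu h
    rw [posC_shift]
  · push Not at hu
    obtain ⟨ε, rfl⟩ := hu
    cases u' <;> simp [vr, Vt.map] at h
    rw [h]

theorem lamC_xuniq (x : Xt (ZMod m)) (z z' : ℂ) (h : lamC m z = {Sum.inr x}) (h' : lamC m z' = {Sum.inr x}) : z = z' := by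
  have key : ∀ z, lamC m z = {Sum.inr x} → ∃ y : Xt ℤ, (y.map fun i : ℤ => (i : ZMod m)) = x ∧ z = Phi m (xposZ y) := by
    intro z h
    rcases lamC_cover m z with rfl | rfl | ⟨q, hq, rfl⟩
    · rw [lamC_zero] at h; simp at h
    · rw [lamC_one] at h; simp at h
    · rw [lamC_Phi m hq] at h
      have h1 : Sum.inr x ∈ red m '' lamZ q := by rw [h]; rfl
      obtain ⟨p, hp, hp2⟩ := h1
      have h2 : ∀ u, Sum.inl u ∉ lamZ q := by
        intro u hu
        have : red m (Sum.inl u) ∈ red m '' lamZ q := ⟨_, hu, rfl⟩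
        rw [h] at this
        simp [red, pm] at this
      rcases p with u | y
      · exact absurd hp (h2 u)
      · refine ⟨y, by simpa [red, pm] using hp2, ?_⟩
        rw [← xpos_of q y hp h2]
  obtain ⟨y, hy, rfl⟩ := key z h
  obtain ⟨y', hy', rfl⟩ := key z' h'
  obtain ⟨k, rfl⟩ := Xt.eq_shift m y y' (hy.trans hy'.symm)
  rw [xposZ_shift, Phi_shift]

theorem plane_cover (z : ℂ) : (∃ u, z = posC m u) ∨ (∃ e, ∃ s ∈ Icc (0 : ℝ) 1, z = arcC m e s) ∨ TriP (lamC m z) := by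
  rcases lamC_cover m z with rfl | rfl | ⟨q, hq, rfl⟩
  · exact Or.inl ⟨.hub true, rfl⟩
  · exact Or.inl ⟨.hub false, rfl⟩
  rcases strip_cover q with ⟨e, ε, he, h, h0, rfl⟩ | ⟨e, he, s, hs, rfl⟩ | h
  · right; left
    have hk := kap_pos m
    refine ⟨e, 1 - Real.exp (-(kap m * h)), ⟨?_, ?_⟩, ?_⟩
    · have : Real.exp (-(kap m * h)) ≤ 1 := Real.exp_le_one_iff.2 (by nlinarith)
      linarith
    · linarith [Real.exp_pos (-(kap m * h))]
    · rw [arcC_ray m he (h := h)]; ring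
  · right; left
    exact ⟨e, s, hs, (arcC_seg m he s).symm⟩
  · right; right
    rw [lamC_Phi m hq]
    exact tri_map (nat1_cast m) h

theorem xe_crossC (x : Xt ℤ) : ∃ z, z ∈ arcC m x.xe.1 '' Ioo 0 1 ∧ z ∈ arcC m x.xe.2 '' Ioo 0 1 := by
  have hk := kap_pos m
  refine ⟨Phi m (xposZ x), ?_⟩
  rcases x with ⟨i, ε⟩ | i
  · constructor
    · refine ⟨1 - Real.exp (-(kap m * 1)), ⟨?_, ?_⟩, ?_⟩
      · have : Real.exp (-(kap m * 1)) < 1 := Real.exp_lt_one_iff.2 (by linarith)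
        linarith
      · linarith [Real.exp_pos (-(kap m * 1))]
      · rw [arcC_ray m (e := (Xt.d i ε).xe.1) (ε := ε) rfl (h := 1) (by ring)]
        simp [rayPt, Xt.xe, Et.en, posZ, xposZ]
    · refine ⟨1 / 2, by norm_num, ?_⟩
      rw [arcC_seg m rfl]
      congr 1
      simp [segPt, Xt.xe, Et.en, posZ, xposZ]
      ring
  · constructor
    · refine ⟨1 / 2, by norm_num, ?_⟩
      rw [arcC_seg m rfl]
      congr 1
      simp [segPt, Xt.xe, Et.en, posZ, xposZ]
      norm_num
    · refine ⟨1 / 2, by norm_num, ?_⟩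
      rw [arcC_seg m rfl]
      congr 1
      simp [segPt, Xt.xe, Et.en, posZ, xposZ]
      norm_num

end plane

section comb
variable {ι : Type} [Ring ι] [Nontrivial ι]

theorem Et.en_inj (e f : Et ι) (h : s(e.en.1, e.en.2) = s(f.en.1, f.en.2)) : e = f := by
  have h1 : ∀ i : ι, i - 1 ≠ i := fun i h => one_ne_zero (sub_eq_self.1 h)
  cases e <;> cases f <;> simp only [Et.en, Sym2.eq_iff, Vt.a.injEq, Vt.x.injEq, Vt.t.injEq, Vt.c.injEq, Vt.hub.injEq,
    reduceCtorEq, false_and, and_false, or_false, false_or] at h <;> grind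

theorem Et.en_ne (e : Et ι) : e.en.1 ≠ e.en.2 := by
  cases e <;> simp [Et.en]

theorem TriP.ncard {τ : Set (Vt ι ⊕ Xt ι)} (h : TriP τ) : τ.ncard = 3 := by
  cases h <;> rw [ncard_eq_three] <;> exact ⟨_, _, _, by simp, by simp, by simp, rfl⟩

theorem TriP.finite {τ : Set (Vt ι ⊕ Xt ι)} (h : TriP τ) : τ.Finite := by
  cases h <;> exact toFinite _

theorem TriP.eq {τ τ' : Set (Vt ι ⊕ Xt ι)} (h : TriP τ) (h' : TriP τ') (hs : τ ⊆ τ') : τ = τ' :=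
  eq_of_subset_of_ncard_le hs (by rw [h.ncard, h'.ncard]) h'.finite

/-- Adjacency in the construction. -/
def RA (u v : Vt ι) : Prop := ∃ e : Et ι, s(u, v) = s(e.en.1, e.en.2)

theorem RA.symm {u v : Vt ι} (h : RA u v) : RA v u := by
  obtain ⟨e, he⟩ := h
  exact ⟨e, by rw [Sym2.eq_swap]; exact he⟩

theorem RA_Ta (i : ι) (σ ε) : RA (.a i σ ε) (.hub ε) := ⟨.Ta i σ ε, rfl⟩
theorem RA_Tt (i : ι) (ε) : RA (.t i ε) (.hub ε) := ⟨.Tt i ε, rfl⟩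
theorem RA_Tc (i : ι) (ε) : RA (.c i) (.hub ε) := ⟨.Tc i ε, rfl⟩
theorem RA_ta (i : ι) (σ ε) : RA (.a i σ ε) (.t i ε) := ⟨.ta i σ ε, rfl⟩
theorem RA_aa (i : ι) (ε) : RA (.a i false ε) (.a i true ε) := ⟨.aa i ε, rfl⟩
theorem RA_av (i : ι) (σ) : RA (.a i σ true) (.a i σ false) := ⟨.av i σ, rfl⟩
theorem RA_ac (i : ι) (σ ε) : RA (.a i σ ε) (.c (cI i σ)) := ⟨.ac i σ ε, rfl⟩
theorem RA_xc (i : ι) (σ) : RA (.x i σ) (.c (cI i σ)) := ⟨.xc i σ, rfl⟩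
theorem RA_xa (i : ι) (σ ε) : RA (.x i σ) (.a i σ ε) := ⟨.xa i σ ε, rfl⟩
theorem RA_aa' (i : ι) (σ ε) : RA (.a i σ ε) (.a i (!σ) ε) := by
  cases σ
  · exact RA_aa i ε
  · exact (RA_aa i ε).symm
theorem RA_av' (i : ι) (σ ε) : RA (.a i σ ε) (.a i σ !ε) := by
  cases ε
  · exact (RA_av i σ).symm
  · exact (RA_av i σ)

theorem TriP.adj {τ : Set (Vt ι ⊕ Xt ι)} (h : TriP τ) (u v : Vt ι) (huv : u ≠ v) (hu : Sum.inl u ∈ τ)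
    (hv : Sum.inl v ∈ τ) : RA u v := by
  cases h <;> simp only [mem_insert_iff, mem_singleton_iff, Sum.inl.injEq, reduceCtorEq, or_false, false_or] at hu hv <;>
  (try rcases hu with rfl | rfl | rfl) <;> (try rcases hu with rfl | rfl) <;> (try subst hu) <;>
  (try rcases hv with rfl | rfl | rfl) <;> (try rcases hv with rfl | rfl) <;> (try subst hv) <;>
  first
  | exact absurd rfl huv
  | exact RA_Ta _ _ _
  | exact RA_Tt _ _
  | exact RA_ta _ _ _
  | exact RA_aa' _ _ _
  | exact RA_av' _ _ _
  | exact RA_ac _ _ _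
  | exact RA_xc _ _
  | exact RA_xa _ _ _
  | exact (RA_Ta _ _ _).symm
  | exact (RA_Tt _ _).symm
  | exact (RA_ta _ _ _).symm
  | exact (RA_aa' _ _ _).symm
  | exact (RA_av' _ _ _).symm
  | exact (RA_ac _ _ _).symm
  | exact (RA_xc _ _).symm
  | exact (RA_xa _ _ _).symm

/-- The maximal cliques around vertices of degree three. -/
def Kc : (ι × Bool) ⊕ (ι × Bool) → Set (Vt ι)
  | .inl (i, ε) => {.t i ε, .hub ε, .a i false ε, .a i true ε}
  | .inr (i, σ) => {.x i σ, .c (cI i σ), .a i σ true, .a i σ false}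

theorem Kc_inter {w w' : (ι × Bool) ⊕ (ι × Bool)} {x y : Vt ι} (hxy : x ≠ y) (hx : x ∈ Kc w) (hy : y ∈ Kc w)
    (hx' : x ∈ Kc w') (hy' : y ∈ Kc w') : w = w' := by
  rcases w with ⟨i, b⟩ | ⟨i, b⟩ <;> rcases w' with ⟨j, b'⟩ | ⟨j, b'⟩ <;>
    simp only [Kc, mem_insert_iff, mem_singleton_iff] at hx hy hx' hy' <;> grind

theorem Kc_adj {w : (ι × Bool) ⊕ (ι × Bool)} {u v : Vt ι} (huv : u ≠ v) (hu : u ∈ Kc w) (hv : v ∈ Kc w) : RA u v := by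
  rcases w with ⟨i, b⟩ | ⟨i, b⟩ <;> simp only [Kc, mem_insert_iff, mem_singleton_iff] at hu hv <;>
  rcases hu with rfl | rfl | rfl | rfl <;> rcases hv with rfl | rfl | rfl | rfl <;>
  first
  | exact absurd rfl huv
  | exact RA_Ta _ _ _
  | exact RA_Tt _ _
  | exact RA_ta _ _ _
  | exact RA_aa _ _
  | exact RA_av _ _
  | exact RA_ac _ _ _
  | exact RA_xc _ _
  | exact RA_xa _ _ _
  | exact (RA_Ta _ _ _).symm
  | exact (RA_Tt _ _).symm
  | exact (RA_ta _ _ _).symm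
  | exact (RA_aa _ _).symm
  | exact (RA_av _ _).symm
  | exact (RA_ac _ _ _).symm
  | exact (RA_xc _ _).symm
  | exact (RA_xa _ _ _).symm

theorem TriP.cluster {τ : Set (Vt ι ⊕ Xt ι)} (h : TriP τ) {u x y : Vt ι} (hxy : x ≠ y) (hux : u ≠ x) (huy : u ≠ y)
    (hu : Sum.inl u ∈ τ) (hx : Sum.inl x ∈ τ) (hy : Sum.inl y ∈ τ) : ∃ w, u ∈ Kc w ∧ x ∈ Kc w ∧ y ∈ Kc w := by
  have key : (∃ w, ∀ v, Sum.inl v ∈ τ → v ∈ Kc w) ∨ ∃ a b : Vt ι, ∀ v, Sum.inl v ∈ τ → v = a ∨ v = b := by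
    cases h with
    | had i σ ε => right; exact ⟨.hub ε, .a i σ ε, by simp⟩
    | cda i σ ε => right; exact ⟨.c (cI i σ), .a i σ ε, by simp⟩
    | mav i σ ε => right; exact ⟨.a i σ ε, .a i σ !ε, by simp⟩
    | mah i σ ε => right; exact ⟨.a i σ ε, .a i (!σ) ε, by simp⟩
    | hat i σ ε => left; refine ⟨.inl (i, ε), ?_⟩; cases σ <;> simp [Kc]
    | aat i σ ε => left; refine ⟨.inl (i, ε), ?_⟩; cases σ <;> simp [Kc]
    | cax i σ ε => left; refine ⟨.inr (i, σ), ?_⟩; cases ε <;> simp [Kc]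
    | aax i σ ε => left; refine ⟨.inr (i, σ), ?_⟩; cases ε <;> simp [Kc]
  rcases key with ⟨w, hw⟩ | ⟨a, b, hab⟩
  · exact ⟨w, hw u hu, hw x hx, hw y hy⟩
  · have h1 := hab u hu
    have h2 := hab x hx
    have h3 := hab y hy
    grind

theorem Et.fk_iff (e : Et ι) (x : Xt ι) : e.fk = some x ↔ e = x.xe.1 ∨ e = x.xe.2 := by
  cases e <;> cases x <;> simp [Et.fk, Xt.xe]
  all_goals grind

theorem Xt.xe_ne (x : Xt ι) : x.xe.1 ≠ x.xe.2 := by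
  cases x <;> simp [Xt.xe]

theorem Et.fk_disj (e f : Et ι) (x : Xt ι) (he : e.fk = some x) (hf : f.fk = some x) (hef : e ≠ f) :
    e.en.1 ≠ f.en.1 ∧ e.en.1 ≠ f.en.2 ∧ e.en.2 ≠ f.en.1 ∧ e.en.2 ≠ f.en.2 := by
  rw [Et.fk_iff] at he hf
  rcases he with rfl | rfl <;> rcases hf with rfl | rfl
  · exact absurd rfl hef
  · cases x <;> simp [Xt.xe, Et.en]
  · cases x <;> simp [Xt.xe, Et.en]
  · exact absurd rfl hef

end comb

/-- Vertices as a sum type. -/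
def Vt.equiv (ι : Type) : Vt ι ≃ Bool ⊕ (ι × Bool × Bool) ⊕ (ι × Bool) ⊕ ι ⊕ (ι × Bool) where
  toFun
    | .hub ε => .inl ε
    | .a i σ ε => .inr (.inl (i, σ, ε))
    | .x i σ => .inr (.inr (.inl (i, σ)))
    | .c i => .inr (.inr (.inr (.inl i)))
    | .t i ε => .inr (.inr (.inr (.inr (i, ε))))
  invFun
    | .inl ε => .hub ε
    | .inr (.inl (i, σ, ε)) => .a i σ ε
    | .inr (.inr (.inl (i, σ))) => .x i σ
    | .inr (.inr (.inr (.inl i))) => .c i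
    | .inr (.inr (.inr (.inr (i, ε)))) => .t i ε
  left_inv u := by cases u <;> rfl
  right_inv u := by rcases u with _ | ⟨_, _, _⟩ | ⟨_, _⟩ | _ | ⟨_, _⟩ <;> rfl

/-- Crossings as a sum type. -/
def Xt.equiv (ι : Type) : Xt ι ≃ (ι × Bool) ⊕ ι where
  toFun
    | .d i ε => .inl (i, ε)
    | .M i => .inr i
  invFun
    | .inl (i, ε) => .d i ε
    | .inr i => .M i
  left_inv u := by cases u <;> rfl
  right_inv u := by rcases u with ⟨_, _⟩ | _ <;> rfl

/-- Edges as a product type. -/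
def Et.equiv (ι : Type) : Et ι ≃ (ι × Bool × Bool) ⊕ (ι × Bool) ⊕ (ι × Bool) ⊕ (ι × Bool × Bool) ⊕ (ι × Bool) ⊕
    (ι × Bool) ⊕ (ι × Bool × Bool) ⊕ (ι × Bool) ⊕ (ι × Bool × Bool) ⊕ (ι × Bool) ⊕ (ι × Bool) where
  toFun
    | .Ta i σ ε => .inl (i, σ, ε)
    | .Tt i ε => .inr (.inl (i, ε))
    | .Tc i ε => .inr (.inr (.inl (i, ε)))
    | .ta i σ ε => .inr (.inr (.inr (.inl (i, σ, ε))))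
    | .aa i ε => .inr (.inr (.inr (.inr (.inl (i, ε)))))
    | .av i σ => .inr (.inr (.inr (.inr (.inr (.inl (i, σ))))))
    | .ac i σ ε => .inr (.inr (.inr (.inr (.inr (.inr (.inl (i, σ, ε)))))))
    | .xc i σ => .inr (.inr (.inr (.inr (.inr (.inr (.inr (.inl (i, σ))))))))
    | .xa i σ ε => .inr (.inr (.inr (.inr (.inr (.inr (.inr (.inr (.inl (i, σ, ε)))))))))
    | .dd i ε => .inr (.inr (.inr (.inr (.inr (.inr (.inr (.inr (.inr (.inl (i, ε))))))))))
    | .mm i ε => .inr (.inr (.inr (.inr (.inr (.inr (.inr (.inr (.inr (.inr (i, ε))))))))))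
  invFun
    | .inl (i, σ, ε) => .Ta i σ ε
    | .inr (.inl (i, ε)) => .Tt i ε
    | .inr (.inr (.inl (i, ε))) => .Tc i ε
    | .inr (.inr (.inr (.inl (i, σ, ε)))) => .ta i σ ε
    | .inr (.inr (.inr (.inr (.inl (i, ε))))) => .aa i ε
    | .inr (.inr (.inr (.inr (.inr (.inl (i, σ)))))) => .av i σ
    | .inr (.inr (.inr (.inr (.inr (.inr (.inl (i, σ, ε))))))) => .ac i σ ε
    | .inr (.inr (.inr (.inr (.inr (.inr (.inr (.inl (i, σ)))))))) => .xc i σ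
    | .inr (.inr (.inr (.inr (.inr (.inr (.inr (.inr (.inl (i, σ, ε))))))))) => .xa i σ ε
    | .inr (.inr (.inr (.inr (.inr (.inr (.inr (.inr (.inr (.inl (i, ε)))))))))) => .dd i ε
    | .inr (.inr (.inr (.inr (.inr (.inr (.inr (.inr (.inr (.inr (i, ε)))))))))) => .mm i ε
  left_inv u := by cases u <;> rfl
  right_inv u := by
    rcases u with ⟨_, _, _⟩ | ⟨_, _⟩ | ⟨_, _⟩ | ⟨_, _, _⟩ | ⟨_, _⟩ | ⟨_, _⟩ | ⟨_, _, _⟩ | ⟨_, _⟩ | ⟨_, _, _⟩ | ⟨_, _⟩ | ⟨_, _⟩ <;> rfl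

noncomputable instance {ι : Type} [Fintype ι] : Fintype (Vt ι) := Fintype.ofEquiv _ (Vt.equiv ι).symm
noncomputable instance {ι : Type} [Fintype ι] : Fintype (Xt ι) := Fintype.ofEquiv _ (Xt.equiv ι).symm
noncomputable instance {ι : Type} [Fintype ι] : Fintype (Et ι) := Fintype.ofEquiv _ (Et.equiv ι).symm

theorem Vt.card (ι : Type) [Fintype ι] : Fintype.card (Vt ι) = 9 * Fintype.card ι + 2 := by
  rw [Fintype.card_congr (Vt.equiv ι)]; simp; ring
theorem Xt.card (ι : Type) [Fintype ι] : Fintype.card (Xt ι) = 3 * Fintype.card ι := by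
  rw [Fintype.card_congr (Xt.equiv ι)]; simp; ring
theorem Et.card (ι : Type) [Fintype ι] : Fintype.card (Et ι) = 30 * Fintype.card ι := by
  rw [Fintype.card_congr (Et.equiv ι)]; simp; ring

section build
variable (m : ℕ) [hm : NeZero m]

theorem cast_lift (e : ZMod m) : (((ZMod.cast e : ℤ)) : ZMod m) = e := by simp

/-- Lift of vertices. -/
def vl : Vt (ZMod m) → Vt ℤ := Vt.map ZMod.cast

theorem vr_vl (u) : vr m (vl m u) = u := by
  cases u <;> simp [vr, vl, Vt.map]

/-- Lift of edges. -/
def el : Et (ZMod m) → Et ℤ := Et.map ZMod.cast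

theorem er_el (e) : (el m e).map (fun i : ℤ => (i : ZMod m)) = e := by
  cases e <;> simp [el, Et.map]

theorem el_er (e : Et ℤ) (s : ℝ) : arcC m (el m (e.map (fun i : ℤ => (i : ZMod m)))) s = arcC m e s := by
  have h1 : el m (e.map (fun i : ℤ => (i : ZMod m))) = e.map (fun i : ℤ => (ZMod.cast (i : ZMod m) : ℤ)) := by
    cases e <;> simp [el, Et.map]
  rw [h1]
  obtain ⟨k, hk⟩ := Et.map_eq_shift (fun i : ℤ => (ZMod.cast (i : ZMod m) : ℤ)) m
    (fun i => by rw [← ZMod.intCast_eq_intCast_iff_dvd_sub]; simp) e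
  rw [hk, arcC_shift]

theorem en_el (e : Et (ZMod m)) : vr m (el m e).en.1 = e.en.1 ∧ vr m (el m e).en.2 = e.en.2 := by
  have h := en_map (nat1_cast m) (el m e)
  rw [er_el] at h
  rw [h]
  exact ⟨rfl, rfl⟩

/-- The picture of the construction. -/
noncomputable def picZ [Nontrivial (ZMod m)] : Pic (Vt (ZMod m)) (Xt (ZMod m)) (Et (ZMod m)) where
  pos u := Complex.equivRealProdCLM (posC m (vl m u))
  en := Et.en
  fk := Et.fk
  xe := Xt.xe
  arc e s := Complex.equivRealProdCLM (arcC m (el m e) s)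
  lam z := lamC m (Complex.equivRealProdCLM.symm z)
  Tri := TriP
  en_inj := Et.en_inj
  en_ne := Et.en_ne
  arc_cont e := Complex.equivRealProdCLM.continuous.comp_continuousOn (arcC_cont m _)
  arc_inj e := Complex.equivRealProdCLM.injective.comp_injOn (arcC_inj m _)
  arc_zero e := by
    rw [arcC_zero]
    congr 1
    apply posC_congr
    rw [vr_vl, (en_el m e).1]
  arc_one e := by
    rw [arcC_one]
    congr 1
    apply posC_congr
    rw [vr_vl, (en_el m e).2]
  lam_open p := (lamC_open m p).preimage Complex.equivRealProdCLM.symm.continuous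
  lam_pos u := by
    rw [ContinuousLinearEquiv.symm_apply_apply, lamC_posC]
    have := vr_vl m u
    rw [vr] at this
    rw [this]
  lam_unc e he s hs := by
    rw [ContinuousLinearEquiv.symm_apply_apply]
    have := lamC_arc m (el m e) hs
    rw [er_el] at this
    exact this.1 he
  lam_crs e x he s hs := by
    rw [ContinuousLinearEquiv.symm_apply_apply]
    have := lamC_arc m (el m e) hs
    rw [er_el] at this
    exact this.2 x he
  xuniq x z z' h h' := Complex.equivRealProdCLM.symm.injective (lamC_xuniq m x _ _ h h')
  cover z := by
    rcases plane_cover m (Complex.equivRealProdCLM.symm z) with ⟨u, hu⟩ | ⟨e, s, hs, h⟩ | h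
    · left
      refine ⟨vr m u, ?_⟩
      rw [ContinuousLinearEquiv.symm_apply_eq] at hu
      rw [hu]
      congr 1
      apply posC_congr
      rw [vr_vl]
    · right; left
      refine ⟨e.map (fun i : ℤ => (i : ZMod m)), s, hs, ?_⟩
      rw [ContinuousLinearEquiv.symm_apply_eq] at h
      rw [h, el_er]
    · exact Or.inr (Or.inr h)
  tri_fin τ h := h.finite
  tri_eq τ τ' h h' := h.eq h'
  tri_adj τ h := h.adj
  tri_adj2 τ τ' h h' u v x y hxy hux huy hvx hvy huv h1 h2 h3 h4 h5 h6 := by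
    obtain ⟨w, a1, a2, a3⟩ := h.cluster hxy hux huy h1 h2 h3
    obtain ⟨w', b1, b2, b3⟩ := h'.cluster hxy hvx hvy h4 h5 h6
    obtain rfl := Kc_inter hxy a2 a3 b2 b3
    exact Kc_adj huv a1 b1
  fk_iff := Et.fk_iff
  xe_ne := Xt.xe_ne
  xe_cross x := by
    have key : ∀ x : Xt (ZMod m), el m x.xe.1 = (x.map (ZMod.cast : ZMod m → ℤ)).xe.1 ∧
        el m x.xe.2 = (x.map (ZMod.cast : ZMod m → ℤ)).xe.2 := by
      intro x; cases x <;> simp [el, Et.map, Xt.xe, Xt.map]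
    obtain ⟨z, ⟨s, hs, rfl⟩, s', hs', h'⟩ := xe_crossC m (x.map (ZMod.cast : ZMod m → ℤ))
    rw [(key x).1, (key x).2]
    exact ⟨_, ⟨s, hs, rfl⟩, s', hs', congrArg _ h'⟩
  fk_disj := Et.fk_disj

end build

/-- Relabelling of the vertices of a picture. -/
def Pic.map {V V' X E : Type} (P : Pic V X E) (φ : V ≃ V') : Pic V' X E where
  pos u := P.pos (φ.symm u)
  en e := (φ (P.en e).1, φ (P.en e).2)
  fk := P.fk
  xe := P.xe
  arc := P.arc
  lam z := Sum.map φ id '' P.lam z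
  Tri τ := P.Tri (Sum.map φ id ⁻¹' τ)
  en_inj e f h := P.en_inj e f (by
    rw [Sym2.eq_iff] at h ⊢
    simpa using h)
  en_ne e := by simpa using P.en_ne e
  arc_cont := P.arc_cont
  arc_inj := P.arc_inj
  arc_zero e := by simpa using P.arc_zero e
  arc_one e := by simpa using P.arc_one e
  lam_open p := by
    have : {z | p ∈ Sum.map φ id '' P.lam z} = {z | Sum.map φ.symm id p ∈ P.lam z} := by
      ext z
      rcases p with u | x <;> simp [Sum.exists, ← φ.eq_symm_apply]
    rw [this]
    exact P.lam_open _
  lam_pos u := by rw [P.lam_pos]; simp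
  lam_unc e he s hs := by rw [P.lam_unc e he s hs]; simp [image_pair]
  lam_crs e x he s hs := by
    rcases P.lam_crs e x he s hs with h | h | h <;> rw [h] <;> simp [image_pair]
  xuniq x z z' h h' := by
    have hi : Function.Injective (Sum.map φ (id : X → X)) := φ.injective.sumMap Function.injective_id
    have h0 : ({Sum.inr x} : Set (V' ⊕ X)) = Sum.map φ id '' {Sum.inr x} := by simp
    rw [h0] at h h'
    exact P.xuniq x z z' (hi.image_injective h) (hi.image_injective h')
  cover z := by
    have hi : Function.Injective (Sum.map φ (id : X → X)) := φ.injective.sumMap Function.injective_id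
    rcases P.cover z with ⟨v, h⟩ | h | h
    · exact Or.inl ⟨φ v, by simpa using h⟩
    · exact Or.inr (Or.inl h)
    · exact Or.inr (Or.inr (by rwa [hi.preimage_image]))
  tri_fin τ h := by
    have hs : Function.Surjective (Sum.map φ (id : X → X)) := φ.surjective.sumMap Function.surjective_id
    rw [← image_preimage_eq τ hs]
    exact (P.tri_fin _ h).image _
  tri_eq τ τ' h h' hs := by
    have hsu : Function.Surjective (Sum.map φ (id : X → X)) := φ.surjective.sumMap Function.surjective_id
    exact hsu.preimage_injective (P.tri_eq _ _ h h' (preimage_mono hs))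
  tri_adj τ h u v huv hu hv := by
    obtain ⟨e, he⟩ := P.tri_adj _ h (φ.symm u) (φ.symm v) (by simpa using huv) (by simpa using hu) (by simpa using hv)
    refine ⟨e, ?_⟩
    have := congrArg (Sym2.map φ) he
    simpa using this
  tri_adj2 τ τ' h h' u v x y h1 h2 h3 h4 h5 h6 a1 a2 a3 a4 a5 a6 := by
    obtain ⟨e, he⟩ := P.tri_adj2 _ _ h h' (φ.symm u) (φ.symm v) (φ.symm x) (φ.symm y) (by simpa using h1)
      (by simpa using h2) (by simpa using h3) (by simpa using h4) (by simpa using h5) (by simpa using h6)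
      (by simpa using a1) (by simpa using a2) (by simpa using a3) (by simpa using a4) (by simpa using a5)
      (by simpa using a6)
    refine ⟨e, ?_⟩
    have := congrArg (Sym2.map φ) he
    simpa using this
  fk_iff := P.fk_iff
  xe_ne := P.xe_ne
  xe_cross := P.xe_cross
  fk_disj e f x h1 h2 h3 := by simpa using P.fk_disj e f x h1 h2 h3

theorem no_three {V : Type} [Finite V] {S : Set V} (hS : S.ncard < 3) {p q r : V} (hp : p ∈ S) (hq : q ∈ S) (hr : r ∈ S)
    (hpq : p ≠ q) (hpr : p ≠ r) (hqr : q ≠ r) : False := by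
  have h1 : ({p, q, r} : Set V) ⊆ S := by
    rintro x (rfl | rfl | rfl) <;> assumption
  have h2 := ncard_le_ncard h1 (toFinite S)
  have h3 : ({p, q, r} : Set V).ncard = 3 := ncard_eq_three.2 ⟨p, q, r, hpq, hpr, hqr, rfl⟩
  omega

section conn
variable {m : ℕ} [hm : NeZero m] [Nontrivial (ZMod m)]

theorem const_of {S : Set (Vt (ZMod m))} (hS : S.ncard < 3) (f : Vt (ZMod m) → Prop)
    (h : ∀ u v, RA u v → u ∉ S → v ∉ S → (f u ↔ f v)) : ∃ F : Prop, ∀ u, u ∉ S → (f u ↔ F) := by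
  have n3 : ∀ {p q r : Vt (ZMod m)}, p ∈ S → q ∈ S → r ∈ S → p ≠ q → p ≠ r → q ≠ r → False :=
    fun hp hq hr => no_three hS hp hq hr
  by_cases hh : ∃ ε, Vt.hub ε ∉ S
  · obtain ⟨ε, hε⟩ := hh
    refine ⟨f (.hub ε), ?_⟩
    have hc : ∀ i, Vt.c i ∉ S → (f (.c i) ↔ f (.hub ε)) := fun i hi => h _ _ (RA_Tc i ε) hi hε
    have ha : ∀ i σ, Vt.a i σ ε ∉ S → (f (.a i σ ε) ↔ f (.hub ε)) := fun i σ hi => h _ _ (RA_Ta i σ ε) hi hε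
    have ht : ∀ i, Vt.t i ε ∉ S → (f (.t i ε) ↔ f (.hub ε)) := fun i hi => h _ _ (RA_Tt i ε) hi hε
    have ha' : ∀ i σ, Vt.a i σ (!ε) ∉ S → (f (.a i σ !ε) ↔ f (.hub ε)) := by
      intro i σ hi
      by_cases h1 : Vt.a i σ ε ∈ S
      · by_cases h2 : Vt.c (cI i σ) ∈ S
        · have h3 : Vt.hub (!ε) ∉ S := fun h3 => n3 h1 h2 h3 (by simp) (by simp) (by simp)
          have h4 : Vt.c (cI i σ + 1) ∉ S := fun h4 => n3 h1 h2 h4 (by simp) (by simp) (by simp)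
          rw [h _ _ (RA_Ta i σ !ε) hi h3, ← h _ _ (RA_Tc _ !ε) h4 h3, hc _ h4]
        · rw [h _ _ (RA_ac i σ !ε) hi h2, hc _ h2]
      · rw [← h _ _ (RA_av' i σ ε) h1 hi, ha i σ h1]
    have hh' : Vt.hub (!ε) ∉ S → (f (.hub !ε) ↔ f (.hub ε)) := by
      intro hi
      by_cases h1 : Vt.c (0 : ZMod m) ∈ S
      · by_cases h2 : Vt.c (1 : ZMod m) ∈ S
        · have h3 : Vt.a (0 : ZMod m) true (!ε) ∉ S := fun h3 => n3 h1 h2 h3 (by simp) (by simp) (by simp)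
          rw [← h _ _ (RA_Ta 0 true !ε) h3 hi, ha' _ _ h3]
        · rw [← h _ _ (RA_Tc 1 !ε) h2 hi, hc _ h2]
      · rw [← h _ _ (RA_Tc 0 !ε) h1 hi, hc _ h1]
    have haa : ∀ i σ ε', Vt.a i σ ε' ∉ S → (f (.a i σ ε') ↔ f (.hub ε)) := by
      intro i σ ε'
      by_cases h1 : ε' = ε
      · subst h1; exact ha i σ
      · rw [Bool.eq_not_of_ne h1]; exact ha' i σ
    intro u hu
    rcases u with ε' | ⟨i, σ, ε'⟩ | ⟨i, σ⟩ | i | ⟨i, ε'⟩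
    · by_cases h1 : ε' = ε
      · subst h1; rfl
      · rw [Bool.eq_not_of_ne h1] at hu ⊢; exact hh' hu
    · exact haa i σ ε' hu
    · by_cases h1 : Vt.c (cI i σ) ∈ S
      · by_cases h2 : Vt.a i σ true ∈ S
        · have h3 : Vt.a i σ false ∉ S := fun h3 => n3 h1 h2 h3 (by simp) (by simp) (by simp)
          rw [h _ _ (RA_xa i σ false) hu h3, haa _ _ _ h3]
        · rw [h _ _ (RA_xa i σ true) hu h2, haa _ _ _ h2]
      · rw [h _ _ (RA_xc i σ) hu h1, hc _ h1]
    · exact hc i hu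
    · by_cases h1 : Vt.hub ε' ∈ S
      · by_cases h2 : Vt.a i true ε' ∈ S
        · have h3 : Vt.a i false ε' ∉ S := fun h3 => n3 h1 h2 h3 (by simp) (by simp) (by simp)
          rw [← h _ _ (RA_ta i false ε') h3 hu, haa _ _ _ h3]
        · rw [← h _ _ (RA_ta i true ε') h2 hu, haa _ _ _ h2]
      · rw [h _ _ (RA_Tt i ε') hu h1]
        by_cases h4 : ε' = ε
        · rw [h4]
        · rw [Bool.eq_not_of_ne h4] at h1 ⊢; exact hh' h1
  · push Not at hh
    have hn : ∀ u : Vt (ZMod m), u ≠ .hub true → u ≠ .hub false → u ∉ S := fun u h1 h2 h3 =>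
      n3 h3 (hh true) (hh false) h1 h2 (by simp)
    have g : ∀ {u v : Vt (ZMod m)}, RA u v → u ≠ .hub true → u ≠ .hub false → v ≠ .hub true → v ≠ .hub false → (f u ↔ f v) :=
      fun h1 h2 h3 h4 h5 => h _ _ h1 (hn _ h2 h3) (hn _ h4 h5)
    have hac : ∀ i σ ε, f (.a i σ ε) ↔ f (.c (cI i σ)) := fun i σ ε => g (RA_ac i σ ε) (by simp) (by simp) (by simp) (by simp)
    have hcc : ∀ i : ZMod m, f (.c (i + 1)) ↔ f (.c i) := by
      intro i
      have h1 := hac i true true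
      have h2 := hac i false true
      have h3 := g (RA_aa i true) (by simp) (by simp) (by simp) (by simp)
      simp only [cI, if_true, Bool.false_eq_true, if_false] at h1 h2
      rw [← h1, ← h2, h3]
    have hc : ∀ i : ZMod m, f (.c i) ↔ f (.c 0) := by
      have hnat : ∀ n : ℕ, f (.c (n : ZMod m)) ↔ f (.c 0) := by
        intro n
        induction n with
        | zero => simp
        | succ n ih => rw [Nat.cast_succ, hcc, ih]
      intro i
      have := hnat i.val
      rwa [ZMod.natCast_zmod_val] at this
    refine ⟨f (.c 0), ?_⟩
    intro u hu
    rcases u with ε' | ⟨i, σ, ε'⟩ | ⟨i, σ⟩ | i | ⟨i, ε'⟩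
    · exact absurd (hh ε') hu
    · rw [hac, hc]
    · rw [g (RA_xc i σ) (by simp) (by simp) (by simp) (by simp), hc]
    · exact hc i
    · rw [← g (RA_ta i true ε') (by simp) (by simp) (by simp) (by simp), hac, hc]

end conn

theorem kconn_of {V : Type} [Finite V] (G : SimpleGraph V) (hV : 3 ≤ Nat.card V)
    (h : ∀ S : Set V, S.ncard < 3 → ∀ f : V → Prop, (∀ u v, G.Adj u v → u ∉ S → v ∉ S → (f u ↔ f v)) →
      ∃ F : Prop, ∀ u, u ∉ S → (f u ↔ F)) : KConnected G 3 := by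
  intro S hS
  have hne : Nonempty ↥(Sᶜ) := by
    by_contra hne
    have : S = univ := by
      ext x
      simp only [mem_univ, iff_true]
      by_contra hx
      exact hne ⟨⟨x, hx⟩⟩
    rw [this, ncard_univ] at hS
    omega
  refine SimpleGraph.Connected.mk ?_
  rintro ⟨u, hu⟩ ⟨v, hv⟩
  obtain ⟨F, hF⟩ := h S hS (fun w => ∃ hw : w ∈ Sᶜ, (G.induce Sᶜ).Reachable ⟨u, hu⟩ ⟨w, hw⟩) (by
    intro x y hxy hx hy
    have hadj : (G.induce Sᶜ).Adj ⟨x, hx⟩ ⟨y, hy⟩ := hxy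
    constructor
    · rintro ⟨_, hr⟩
      exact ⟨hy, hr.trans hadj.reachable⟩
    · rintro ⟨_, hr⟩
      exact ⟨hx, hr.trans hadj.symm.reachable⟩)
  have h1 := (hF u hu).1 ⟨hu, SimpleGraph.Reachable.refl _⟩
  obtain ⟨_, h2⟩ := (hF v hv).2 h1
  exact h2

theorem map_graph_kconn {m : ℕ} [NeZero m] [Nontrivial (ZMod m)] {V : Type} [Finite V] (φ : Vt (ZMod m) ≃ V) :
    KConnected ((picZ m).map φ).graph 3 := by
  apply kconn_of
  · rw [← Nat.card_congr φ, Nat.card_eq_fintype_card, Vt.card, ZMod.card]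
    have := NeZero.pos m
    omega
  intro S hS f h
  have hS' : (φ ⁻¹' S).ncard < 3 := by
    rwa [ncard_preimage_of_injective_subset_range φ.injective (by simp [φ.surjective.range_eq])]
  obtain ⟨F, hF⟩ := const_of hS' (fun u => f (φ u)) (by
    rintro u v ⟨e, he⟩ hu hv
    refine h _ _ ⟨e, ?_⟩ hu hv
    have := congrArg (Sym2.map φ) he
    exact this)
  refine ⟨F, fun u hu => ?_⟩
  have := hF (φ.symm u) (by simpa using hu)
  simpa using this

theorem Pic.edge_card {V X E : Type} [Fintype V] [Fintype E] (P : Pic V X E) [Fintype P.graph.edgeSet] :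
    Fintype.card E ≤ P.graph.edgeFinset.card := by
  rw [SimpleGraph.edgeFinset_card]
  refine Fintype.card_le_of_injective (fun e => (⟨P.ed e, P.adj_ed e⟩ : P.graph.edgeSet)) ?_
  intro e f h
  exact P.ed_inj (congrArg Subtype.val h)

/-- For every `n = 9 · 2^(k+1) - 16` with `k ≥ 1`, there is a 3-connected
maximal 1-plane graph on `n` vertices with crossing number `(n - 2)/3`. -/
theorem stmt_15 (k : ℕ) (hk : 1 ≤ k) :
    ∃ (G : SimpleGraph (Fin (9 * 2 ^ (k + 1) - 16))) (D : Drawing G),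
      D.IsMaximalOnePlane ∧ KConnected G 3 ∧
      3 * crossingNumber G = 9 * 2 ^ (k + 1) - 16 - 2 := by
  classical
  obtain ⟨m, hm⟩ : ∃ m, m = 2 * (2 ^ k - 1) := ⟨_, rfl⟩
  have h2 : 2 ≤ 2 ^ k := by
    calc 2 = 2 ^ 1 := rfl
      _ ≤ 2 ^ k := Nat.pow_le_pow_right (by norm_num) hk
  have hn : 9 * 2 ^ (k + 1) - 16 = 9 * m + 2 := by
    rw [pow_succ]; omega
  have hm2 : 2 ≤ m := by omega
  rw [hn]
  haveI : NeZero m := ⟨by omega⟩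
  haveI : Fact (1 < m) := ⟨by omega⟩
  have hc : Fintype.card (Vt (ZMod m)) = 9 * m + 2 := by rw [Vt.card, ZMod.card]
  let φ : Vt (ZMod m) ≃ Fin (9 * m + 2) := Fintype.equivFinOfCardEq hc
  let P := (picZ m).map φ
  refine ⟨P.graph, P.drawing, P.maximal, map_graph_kconn φ, ?_⟩
  have hup : crossingNumber P.graph ≤ 3 * m := by
    refine (Nat.sInf_le (m := P.drawing.crNum) (show ∃ D : Drawing P.graph, D.IsGood ∧ D.crNum = P.drawing.crNum from ⟨P.drawing, P.good, rfl⟩)).trans ?_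
    have := P.crNum_le
    rwa [Xt.card, ZMod.card] at this
  have hlo : 3 * m ≤ crossingNumber P.graph := by
    obtain ⟨D, hD, hDc⟩ := Nat.sInf_mem (s := {n | ∃ D : Drawing P.graph, D.IsGood ∧ D.crNum = n})
      ⟨_, P.drawing, P.good, rfl⟩
    have h1 := edge_bound D hD (by simp; omega)
    have h3 := P.edge_card
    rw [Et.card, ZMod.card] at h3
    rw [hDc, Fintype.card_fin] at h1
    change 3 * m ≤ sInf {n | ∃ D : Drawing P.graph, D.IsGood ∧ D.crNum = n}
    have h4 := h3.trans (le_of_eq (by congr!))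
    have h5 := Nat.add_le_add_right h4 6 |>.trans h1
    omega
  omega
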